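/- Let u ∈ C(C̄₁) ∩ W^{1,2}_{d+1,loc}(C₁). Then there exist constants γ ∈ (0,1] and N, depending only on δ, K, and d, such that for any L ∈ 𝔏_{δ,K} one has ∫_{C₁} |Du|^γ dx dt ≤ N (∫_{C₁} |Lu|^{d+1} dx dt)^{γ/(d+1)} + N sup_{∂'C₁} |u|^γ. -/

import Mathlib

open MeasureTheory ENNReal Set

noncomputable section

/-- The Frobenius norm of a matrix, used as `|D²u|`. -/
def frobNorm {d : ℕ} (m : Matrix (Fin d) (Fin d) ℝ) : ℝ :=
  Real.sqrt (∑ i, ∑ j, (m i j) ^ 2)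

namespace PGE
open Filter Topology

/-! ## Linear algebra -/

/-- pairing of matrices -/
def mdot {d : ℕ} (a B : Matrix (Fin d) (Fin d) ℝ) : ℝ := ∑ i, ∑ j, a i j * B i j

/-- ellipticity -/
def Ell {d : ℕ} (δ : ℝ) (a : Matrix (Fin d) (Fin d) ℝ) : Prop :=
  ∀ ξ : EuclideanSpace ℝ (Fin d), δ * ‖ξ‖ ^ 2 ≤ ∑ i, ∑ j, a i j * ξ i * ξ j ∧
          ∑ i, ∑ j, a i j * ξ i * ξ j ≤ δ⁻¹ * ‖ξ‖ ^ 2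

lemma exists_sqrt {d : ℕ} {B : Matrix (Fin d) (Fin d) ℝ} (h : B.PosSemidef) :
    ∃ C : Matrix (Fin d) (Fin d) ℝ, B = C.transpose * C := by
  open scoped MatrixOrder in
  obtain ⟨X, hX⟩ := CStarAlgebra.nonneg_iff_eq_star_mul_self.mp h.nonneg
  refine ⟨X, ?_⟩
  rw [hX]; congr 1

lemma trace_le_mdot {d : ℕ} {δ : ℝ} {a B : Matrix (Fin d) (Fin d) ℝ} (ha : Ell δ a)
    (h : B.PosSemidef) : δ * B.trace ≤ mdot a B := by
  obtain ⟨C, rfl⟩ := exists_sqrt h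
  have h1 : ∀ k, δ * ∑ i, C k i ^ 2 ≤ ∑ i, ∑ j, a i j * C k i * C k j := by
    intro k
    have := (ha (WithLp.toLp 2 (C k))).1
    simpa [EuclideanSpace.norm_sq_eq] using this
  have h2 := Finset.sum_le_sum (s := Finset.univ) fun k _ => h1 k
  have e1 : (C.transpose * C).trace = ∑ k, ∑ i, C k i ^ 2 := by
    simp only [Matrix.trace, Matrix.diag, Matrix.mul_apply, Matrix.transpose_apply]
    rw [Finset.sum_comm]; simp [sq]
  have e2 : mdot a (C.transpose * C) = ∑ k, ∑ i, ∑ j, a i j * C k i * C k j := by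
    simp only [mdot, Matrix.mul_apply, Matrix.transpose_apply, Finset.mul_sum]
    rw [Finset.sum_comm' (t' := Finset.univ) (s' := fun _ => Finset.univ) (by simp)]
    conv_rhs => rw [Finset.sum_comm]
    rw [Finset.sum_comm]
    refine Finset.sum_congr rfl fun i _ => ?_
    rw [Finset.sum_comm]
    refine Finset.sum_congr rfl fun i _ => ?_
    refine Finset.sum_congr rfl fun i _ => ?_
    ring
  rw [e1, e2, Finset.mul_sum]; exact h2

lemma det_le_trace_pow {d : ℕ} {B : Matrix (Fin d) (Fin d) ℝ}
    (h : B.PosSemidef) : B.det ≤ B.trace ^ d := by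
  rw [h.1.det_eq_prod_eigenvalues, h.1.trace_eq_sum_eigenvalues]
  simp only [RCLike.ofReal_real_eq_id, id]
  calc ∏ i, h.1.eigenvalues i ≤ ∏ i : Fin d, ∑ j, h.1.eigenvalues j := by
        refine Finset.prod_le_prod (fun i _ => h.eigenvalues_nonneg i) fun i _ => ?_
        exact Finset.single_le_sum (f := h.1.eigenvalues)
          (fun i _ => h.eigenvalues_nonneg i) (Finset.mem_univ i)
    _ = _ := by simp

lemma mul_det_le {d : ℕ} {δ : ℝ} (hδ : 0 < δ) {a B : Matrix (Fin d) (Fin d) ℝ}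
    (ha : Ell δ a) (h : B.PosSemidef) {s : ℝ} (hs : 0 ≤ s) :
    s * B.det ≤ δ⁻¹ ^ d * (s + mdot a B) ^ (d + 1) := by
  have h0 : 0 ≤ B.trace := h.trace_nonneg
  have h1 := trace_le_mdot ha h
  have h2 : B.trace ≤ δ⁻¹ * (s + mdot a B) := by
    rw [inv_mul_eq_div, le_div_iff₀ hδ]; linarith
  have h3 : 0 ≤ mdot a B := le_trans (by positivity) h1
  calc s * B.det ≤ s * B.trace ^ d := by gcongr; exact det_le_trace_pow h
    _ ≤ (s + mdot a B) * (δ⁻¹ * (s + mdot a B)) ^ d := by gcongr; linarith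
    _ = _ := by rw [mul_pow]; ring

lemma mdot_one_le {d : ℕ} {δ : ℝ} {a : Matrix (Fin d) (Fin d) ℝ} (ha : Ell δ a) :
    mdot a 1 ≤ d * δ⁻¹ := by
  have h1 : ∀ k, a k k ≤ δ⁻¹ := by
    intro k
    have := (ha (EuclideanSpace.single k 1)).2
    simpa [Finset.sum_ite_eq, Pi.single_apply] using this
  calc mdot a 1 = ∑ i, a i i := by simp [mdot, Matrix.one_apply]
    _ ≤ ∑ i : Fin d, δ⁻¹ := Finset.sum_le_sum fun k _ => h1 k
    _ = _ := by simp

lemma abs_entry_le {d : ℕ} {δ : ℝ} {a : Matrix (Fin d) (Fin d) ℝ} (hδ : 0 < δ)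
    (hs : a.IsSymm) (ha : Ell δ a) (i j : Fin d) : |a i j| ≤ 2 * δ⁻¹ := by
  have hd : ∀ k, 0 ≤ a k k ∧ a k k ≤ δ⁻¹ := by
    intro k
    have := (ha (EuclideanSpace.single k 1))
    simp at this
    exact ⟨hδ.le.trans this.1, this.2⟩
  have hp : 0 < δ⁻¹ := inv_pos.mpr hδ
  by_cases hij : i = j
  · subst hij; rw [abs_of_nonneg (hd i).1]; linarith [hd i]
  · have e : ∀ s : ℝ, ∑ k, ∑ l, a k l * (EuclideanSpace.single i (1:ℝ) + EuclideanSpace.single j s : EuclideanSpace ℝ (Fin d)) k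
        * (EuclideanSpace.single i (1:ℝ) + EuclideanSpace.single j s : EuclideanSpace ℝ (Fin d)) l
        = a i i + s * a i j + s * a j i + s ^ 2 * a j j := by
      intro s
      simp only [PiLp.add_apply, PiLp.single_apply, mul_add, add_mul, Finset.sum_add_distrib]
      simp [mul_ite]
      ring
    have h1 := (ha (EuclideanSpace.single i (1:ℝ) + EuclideanSpace.single j 1)).1
    have h2 := (ha (EuclideanSpace.single i (1:ℝ) + EuclideanSpace.single j (-1))).1
    rw [e] at h1 h2
    have hsym : a j i = a i j := hs.apply i j
    have h3 := mul_nonneg hδ.le (sq_nonneg ‖(EuclideanSpace.single i (1:ℝ) + EuclideanSpace.single j 1 : EuclideanSpace ℝ (Fin d))‖)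
    have h4 := mul_nonneg hδ.le (sq_nonneg ‖(EuclideanSpace.single i (1:ℝ) + EuclideanSpace.single j (-1) : EuclideanSpace ℝ (Fin d))‖)
    rw [hsym] at h1 h2
    rw [abs_le]; constructor <;> nlinarith [hd i, hd j]

/-- determinant of the derivative of the parabolic Legendre map -/
lemma det_legendre {d : ℕ} (B : EuclideanSpace ℝ (Fin d) →ₗ[ℝ] EuclideanSpace ℝ (Fin d))
    (v x : EuclideanSpace ℝ (Fin d)) (s : ℝ)
    (T : (ℝ × EuclideanSpace ℝ (Fin d)) →L[ℝ] (ℝ × EuclideanSpace ℝ (Fin d)))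
    (hT : ∀ τ ξ, T (τ, ξ) = (s * τ - inner ℝ x (τ • v + B ξ), τ • v + B ξ)) :
    T.det = s * LinearMap.det B := by
  let E := EuclideanSpace ℝ (Fin d)
  let Sx : Module.End ℝ (ℝ × E) :=
    LinearMap.transvection (-(innerₛₗ ℝ x ∘ₗ LinearMap.snd ℝ ℝ E)) ((1 : ℝ), (0 : E))
  let Sv : Module.End ℝ (ℝ × E) :=
    LinearMap.transvection (LinearMap.fst ℝ ℝ E) ((0 : ℝ), v)
  let D1 : Module.End ℝ (ℝ × E) := LinearMap.prodMap (LinearMap.mulLeft ℝ s) LinearMap.id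
  let D2 : Module.End ℝ (ℝ × E) := LinearMap.prodMap LinearMap.id B
  have key : (T : (ℝ × E) →ₗ[ℝ] (ℝ × E)) = Sx * (D1 * (Sv * D2)) := by
    refine LinearMap.ext ?_
    rintro ⟨τ, ξ⟩
    simp [Sx, Sv, D1, D2, hT, LinearMap.transvection.apply, Module.End.mul_apply,
      sub_eq_add_neg, add_comm]
  have h1 : LinearMap.det Sx = 1 := by
    simp only [Sx]; rw [LinearMap.transvection.det]; simp
  have h2 : LinearMap.det Sv = 1 := by
    simp only [Sv]; rw [LinearMap.transvection.det]; simp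
  have h3 : LinearMap.det D1 = s := by simp [D1, LinearMap.det_prodMap]
  have h4 : LinearMap.det D2 = LinearMap.det B := by simp [D2, LinearMap.det_prodMap]
  rw [ContinuousLinearMap.det, key]
  rw [map_mul, map_mul, map_mul, h1, h2, h3, h4]; ring

end PGE

namespace PGE
open Filter Topology

/-! ## Smooth area estimate -/

abbrev E (d : ℕ) := EuclideanSpace ℝ (Fin d)
abbrev infty : WithTop ℕ∞ := ((⊤ : ℕ∞) : WithTop ℕ∞)
abbrev V (d : ℕ) := ℝ × EuclideanSpace ℝ (Fin d)

variable {d : ℕ}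

instance : (volume : Measure (V d)).IsAddHaarMeasure :=
  inferInstanceAs ((volume : Measure ℝ).prod (volume : Measure (E d))).IsAddHaarMeasure

def bs (i : Fin d) : E d := EuclideanSpace.single i (1 : ℝ)

def pT (ψ : V d → ℝ) (z : V d) : ℝ := fderiv ℝ ψ z (1, 0)
def pX (ψ : V d → ℝ) (i : Fin d) (z : V d) : ℝ := fderiv ℝ ψ z (0, bs i)
def grad (ψ : V d → ℝ) (z : V d) : E d := WithLp.toLp 2 (fun i => pX ψ i z)
def hess (ψ : V d → ℝ) (z : V d) : Matrix (Fin d) (Fin d) ℝ :=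
  Matrix.of fun i j => fderiv ℝ (pX ψ i) z (0, bs j)
def leg (ψ : V d → ℝ) (z : V d) : V d := (ψ z - inner ℝ z.2 (grad ψ z), grad ψ z)

lemma sum_bs (ξ : E d) : ξ = ∑ i, ξ i • bs i := by
  ext k
  simp [bs, Finset.sum_apply, Pi.single_apply]

lemma inner_eq (x y : E d) : inner ℝ x y = ∑ i, x i * y i := by
  simp [PiLp.inner_apply, mul_comm]

lemma pX_contDiff {ψ : V d → ℝ} (h : ContDiff ℝ infty ψ) (i : Fin d) : ContDiff ℝ infty (pX ψ i) := by
  unfold pX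
  exact (h.fderiv_right (m := infty) (by simp)).clm_apply contDiff_const

lemma pT_contDiff {ψ : V d → ℝ} (h : ContDiff ℝ infty ψ) : ContDiff ℝ infty (pT ψ) := by
  unfold pT
  exact (h.fderiv_right (m := infty) (by simp)).clm_apply contDiff_const

lemma grad_contDiff {ψ : V d → ℝ} (h : ContDiff ℝ infty ψ) : ContDiff ℝ infty (grad ψ) := by
  unfold grad
  rw [contDiff_euclidean]
  intro i
  exact pX_contDiff h i

lemma hess_continuous {ψ : V d → ℝ} (h : ContDiff ℝ infty ψ) (i j : Fin d) :
    Continuous fun z => hess ψ z i j := by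
  exact (pX_contDiff (ψ := pX ψ i) (pX_contDiff h i) j).continuous

lemma fderiv_split (L : V d →L[ℝ] ℝ) (τ : ℝ) (ξ : E d) :
    L (τ, ξ) = τ * L (1, 0) + ∑ i, ξ i * L (0, bs i) := by
  have : ((τ, ξ) : V d) = τ • (1, 0) + ∑ i, ξ i • ((0 : ℝ), bs i) := by
    ext k
    · simp [Prod.fst_sum]
    · conv_lhs => rw [sum_bs ξ]
      simp [Prod.snd_sum]
  rw [this, map_add, map_smul, map_sum]; simp only [map_smul, smul_eq_mul]

lemma hasFDerivAt_leg {ψ : V d → ℝ} (h : ContDiff ℝ infty ψ) (z : V d) :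
    ∃ T : V d →L[ℝ] V d, HasFDerivAt (leg ψ) T z ∧
      T.det = pT ψ z * (hess ψ z).det := by
  have hg : HasFDerivAt (grad ψ) (fderiv ℝ (grad ψ) z) z :=
    ((grad_contDiff h).differentiable (by simp) z).hasFDerivAt
  have hψ : HasFDerivAt ψ (fderiv ℝ ψ z) z := (h.differentiable (by simp) z).hasFDerivAt
  have h2 : HasFDerivAt (fun z : V d => z.2) (ContinuousLinearMap.snd ℝ ℝ (E d)) z :=
    hasFDerivAt_snd
  have hi := h2.inner ℝ hg
  have hT := (hψ.sub hi).prodMk hg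
  refine ⟨_, hT, ?_⟩
  have hgi : ∀ i w, (fderiv ℝ (grad ψ) z w) i = fderiv ℝ (pX ψ i) z w := by
    intro i w
    have := ((EuclideanSpace.proj (𝕜 := ℝ) i : E d →L[ℝ] ℝ).hasFDerivAt (x := grad ψ z)).comp z hg
    have e : HasFDerivAt (pX ψ i) (fderiv ℝ (pX ψ i) z) z :=
      ((pX_contDiff h i).differentiable (by simp) z).hasFDerivAt
    have := HasFDerivAt.unique (f := pX ψ i) this e
    rw [← this]; simp
  rw [det_legendre (Matrix.toEuclideanLin (hess ψ z)) (fderiv ℝ (grad ψ) z (1, 0)) z.2 (pT ψ z)]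
  · congr 1
    rw [Matrix.toEuclideanLin_eq_toLin_orthonormal, LinearMap.det_toLin]
  · intro τ ξ
    have hq : fderiv ℝ (grad ψ) z (τ, ξ)
        = τ • fderiv ℝ (grad ψ) z (1, 0) + Matrix.toEuclideanLin (hess ψ z) ξ := by
      ext i
      rw [hgi, fderiv_split]
      simp [hgi, Matrix.toLpLin_apply, Matrix.mulVec, dotProduct, hess, mul_comm]
    have h0 : fderiv ℝ ψ z (τ, ξ) = τ * pT ψ z + inner ℝ ξ (grad ψ z) := by
      rw [fderiv_split, inner_eq]; rfl
    simp only [ContinuousLinearMap.prod_apply, _root_.sub_apply,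
      ContinuousLinearMap.comp_apply, ContinuousLinearMap.coe_snd', fderivInnerCLM_apply, hq, h0]
    refine Prod.ext ?_ rfl
    simp only
    ring

lemma area_smooth {δ : ℝ} (hδ : 0 < δ) {a : V d → Matrix (Fin d) (Fin d) ℝ}
    (ha : ∀ z, Ell δ (a z)) {ψ : V d → ℝ} (h : ContDiff ℝ infty ψ)
    {O : Set (V d)} (hO : MeasurableSet O) :
    volume (leg ψ '' {z ∈ O | 0 ≤ pT ψ z ∧ (hess ψ z).PosSemidef}) ≤
      ∫⁻ z in O, ENNReal.ofReal (δ⁻¹ ^ d) *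
        ENNReal.ofReal (pT ψ z + mdot (a z) (hess ψ z)) ^ (d + 1) := by
  choose T hT hdet using fun z => hasFDerivAt_leg h z
  have hcl : IsClosed {z | 0 ≤ pT ψ z ∧ (hess ψ z).PosSemidef} := by
    have hc : Continuous (hess ψ) := by
      refine continuous_matrix fun i j => hess_continuous h i j
    rw [Set.ofPred_and]
    refine IsClosed.inter (isClosed_le continuous_const (pT_contDiff h).continuous) ?_
    have e : {z | (hess ψ z).PosSemidef} = {z | (hess ψ z).transpose = hess ψ z} ∩
        ⋂ x : Fin d → ℝ, {z | 0 ≤ x ⬝ᵥ (hess ψ z).mulVec x} := by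
      ext z
      simp [Matrix.posSemidef_iff_dotProduct_mulVec, Matrix.IsHermitian,
        Matrix.conjTranspose_eq_transpose_of_trivial]
    rw [e]
    refine (isClosed_eq hc.matrix_transpose hc).inter (isClosed_iInter fun x => ?_)
    refine isClosed_le continuous_const ?_
    exact continuous_const.dotProduct (hc.matrix_mulVec continuous_const)
  have hm : MeasurableSet {z ∈ O | 0 ≤ pT ψ z ∧ (hess ψ z).PosSemidef} := hO.inter hcl.measurableSet
  refine (addHaar_image_le_lintegral_abs_det_fderiv volume hm
    (fun z _ => (hT z).hasFDerivWithinAt)).trans ?_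
  refine (setLIntegral_mono' hm ?_).trans (lintegral_mono_set (t := O) (fun z hz => hz.1))
  rintro z ⟨_, h1, h2⟩
  have h3 := mul_det_le hδ (ha z) h2 h1
  have h4 : 0 ≤ pT ψ z + mdot (a z) (hess ψ z) := by
    have := trace_le_mdot (ha z) h2
    have h0 : 0 ≤ (hess ψ z).trace := h2.trace_nonneg
    have : 0 ≤ δ * (hess ψ z).trace := by positivity
    linarith
  rw [hdet, abs_of_nonneg (mul_nonneg h1 h2.det_nonneg), ← ENNReal.ofReal_pow h4,
    ← ENNReal.ofReal_mul (by positivity)]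
  exact ENNReal.ofReal_le_ofReal h3

end PGE

namespace PGE
open Filter Topology
variable {d : ℕ}

/-! ## Mollification -/

open ContinuousLinearMap in
/-- mollification -/
def cv (φ : ContDiffBump (0 : V d)) (g : V d → ℝ) : V d → ℝ :=
  convolution (φ.normed volume) g (lsmul ℝ ℝ) volume

lemma cv_def (φ : ContDiffBump (0 : V d)) (g : V d → ℝ) (z : V d) :
    cv φ g z = ∫ w, φ.normed volume w * g (z - w) := by
  unfold cv; rw [convolution_def]; rfl

lemma cv_swap (φ : ContDiffBump (0 : V d)) (g : V d → ℝ) (z : V d) :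
    cv φ g z = ∫ w, φ.normed volume (z - w) * g w := by
  unfold cv; rw [convolution_eq_swap]; rfl

lemma cv_contDiff (φ : ContDiffBump (0 : V d)) {g : V d → ℝ} (hg : LocallyIntegrable g volume) :
    ContDiff ℝ infty (cv φ g) :=
  HasCompactSupport.contDiff_convolution_left _ φ.hasCompactSupport_normed φ.contDiff_normed hg

lemma cv_exists (φ : ContDiffBump (0 : V d)) {g : V d → ℝ} (hg : LocallyIntegrable g volume) (z : V d) :
    Integrable (fun w => φ.normed volume w * g (z - w)) :=
  HasCompactSupport.convolutionExists_left (L := ContinuousLinearMap.lsmul ℝ ℝ)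
    φ.hasCompactSupport_normed φ.continuous_normed hg z

lemma cv_sub (φ : ContDiffBump (0 : V d)) {g k : V d → ℝ} (hg : LocallyIntegrable g volume)
    (hk : LocallyIntegrable k volume) (z : V d) : cv φ (g - k) z = cv φ g z - cv φ k z := by
  simp only [cv_def]
  rw [← integral_sub (cv_exists φ hg z) (cv_exists φ hk z)]
  simp [mul_sub]

lemma jensen {α : Type*} [MeasurableSpace α] {μ : Measure α} [IsProbabilityMeasure μ] {f : α → ℝ≥0∞}
    (hf : AEMeasurable f μ) {p : ℝ} (hp : 1 ≤ p) :
    (∫⁻ x, f x ∂μ) ^ p ≤ ∫⁻ x, f x ^ p ∂μ := by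
  rcases hp.eq_or_lt with rfl | hp
  · simp
  have hpq := Real.HolderConjugate.conjExponent hp
  have := ENNReal.lintegral_mul_le_Lp_mul_Lq μ hpq hf (g := fun _ => 1) aemeasurable_const
  simp only [Pi.mul_apply, mul_one, one_rpow, lintegral_const, measure_univ, mul_one] at this
  calc _ ≤ ((∫⁻ x, f x ^ p ∂μ) ^ (1 / p)) ^ p := by gcongr
    _ = _ := by rw [← ENNReal.rpow_mul, one_div_mul_cancel (by linarith), ENNReal.rpow_one]

lemma lintegral_normed (φ : ContDiffBump (0 : V d)) :
    ∫⁻ w, ENNReal.ofReal (φ.normed volume w) = 1 := by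
  rw [← ofReal_integral_eq_lintegral_ofReal φ.integrable_normed
    (Eventually.of_forall fun w => φ.nonneg_normed w), φ.integral_normed]; simp

lemma cv_Lp (φ : ContDiffBump (0 : V d)) {g : V d → ℝ} (hg : Measurable g) {p : ℝ} (hp : 1 ≤ p) :
    ∫⁻ z, ‖cv φ g z‖ₑ ^ p ≤ ∫⁻ z, ‖g z‖ₑ ^ p := by
  have hη : Measurable fun w => ENNReal.ofReal (φ.normed volume w) :=
    (φ.continuous_normed.measurable).ennreal_ofReal
  set μ : Measure (V d) := volume.withDensity fun w => ENNReal.ofReal (φ.normed volume w)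
  have : IsProbabilityMeasure μ := ⟨by simp [μ, lintegral_normed]⟩
  have h1 : ∀ z, ‖cv φ g z‖ₑ ^ p ≤ ∫⁻ w, ENNReal.ofReal (φ.normed volume w) * ‖g (z - w)‖ₑ ^ p := by
    intro z
    have hm : Measurable fun w => ‖g (z - w)‖ₑ := (hg.comp (measurable_const.sub measurable_id)).enorm
    calc ‖cv φ g z‖ₑ ^ p ≤ (∫⁻ w, ‖g (z - w)‖ₑ ∂μ) ^ p := by
          gcongr
          rw [cv_def, lintegral_withDensity_eq_lintegral_mul _ hη hm]
          refine (enorm_integral_le_lintegral_enorm _).trans (le_of_eq ?_)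
          congr 1; ext w
          simp only [Pi.mul_apply, enorm_mul]
          rw [Real.enorm_of_nonneg (φ.nonneg_normed w)]
      _ ≤ ∫⁻ w, ‖g (z - w)‖ₑ ^ p ∂μ := jensen hm.aemeasurable hp
      _ = _ := by rw [lintegral_withDensity_eq_lintegral_mul _ hη (hm.pow_const p)]; rfl
  calc _ ≤ ∫⁻ z, ∫⁻ w, ENNReal.ofReal (φ.normed volume w) * ‖g (z - w)‖ₑ ^ p := lintegral_mono h1
    _ = ∫⁻ w, ∫⁻ z, ENNReal.ofReal (φ.normed volume w) * ‖g (z - w)‖ₑ ^ p := by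
        rw [lintegral_lintegral_swap]
        refine Measurable.aemeasurable ?_
        exact (hη.comp measurable_snd).mul
          ((hg.comp (measurable_fst.sub measurable_snd)).enorm.pow_const p)
    _ = ∫⁻ w, ENNReal.ofReal (φ.normed volume w) * ∫⁻ z, ‖g z‖ₑ ^ p := by
        congr 1; ext w
        rw [lintegral_const_mul]
        · rw [lintegral_sub_right_eq_self (fun z => ‖g z‖ₑ ^ p)]
        · exact (hg.comp (measurable_id.sub measurable_const)).enorm.pow_const p
    _ = _ := by
        rw [lintegral_mul_const _ hη, lintegral_normed, one_mul]

/-- standard sequence of bumps -/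
def bump (n : ℕ) : ContDiffBump (0 : V d) where
  rIn := 1 / (2 * ((n : ℝ) + 1))
  rOut := 1 / ((n : ℝ) + 1)
  rIn_pos := by positivity
  rIn_lt_rOut := by
    apply one_div_lt_one_div_of_lt <;> [positivity; (have : (0:ℝ) ≤ n := n.cast_nonneg; linarith)]

lemma bump_rOut (n : ℕ) : (bump n : ContDiffBump (0 : V d)).rOut = 1 / ((n : ℝ) + 1) := rfl

lemma tendsto_rOut : Tendsto (fun n : ℕ => (bump n : ContDiffBump (0 : V d)).rOut) atTop (𝓝 0) :=
  tendsto_one_div_add_atTop_nhds_zero_nat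

lemma eLpNorm_key {p : ℝ} (hp0 : 0 < p) (f : V d → ℝ) (μ : Measure (V d)) :
    eLpNorm f (ENNReal.ofReal p) μ = (∫⁻ z, ‖f z‖ₑ ^ p ∂μ) ^ (1 / p) := by
  rw [eLpNorm_eq_lintegral_rpow_enorm_toReal (by simp [hp0]) (by simp), ENNReal.toReal_ofReal hp0.le]

lemma cv_tendsto_Lp {g : V d → ℝ} (hg : Measurable g) {p : ℝ} (hp : 1 ≤ p)
    (hgi : LocallyIntegrable g volume)
    (hmem : MemLp g (ENNReal.ofReal p) volume) {S : Set (V d)} (hSv : volume S ≠ ⊤) :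
    Tendsto (fun n => eLpNorm (fun z => cv (bump n) g z - g z) (ENNReal.ofReal p)
      (volume.restrict S)) atTop (𝓝 0) := by
  have hp0 : 0 < p := by linarith
  have key := fun f μ => eLpNorm_key (d := d) hp0 f μ
  rw [ENNReal.tendsto_nhds_zero]
  intro ε hε
  by_cases hεt : ε = ⊤
  · simp [hεt]
  have hε3 : ε / 3 ≠ 0 := by simp [hε.ne']
  obtain ⟨k, hkc, hk, hkcont, hkm⟩ := hmem.exists_hasCompactSupport_eLpNorm_sub_le (by simp) hε3
  have hki : LocallyIntegrable k volume := hkcont.locallyIntegrable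
  -- small number
  obtain ⟨η, hη0, hη⟩ : ∃ η : ℝ, 0 < η ∧
      ENNReal.ofReal η * volume S ^ (1 / p) ≤ ε / 3 := by
    have hv : volume S ^ (1 / p) ≠ ⊤ := ENNReal.rpow_ne_top_of_nonneg (by positivity) hSv
    obtain ⟨η, h0, h1⟩ := ENNReal.exists_nnreal_pos_mul_lt hv hε3
    exact ⟨η, by exact_mod_cast h0, by simpa using h1.le⟩
  have huc : UniformContinuous k := hkcont.uniformContinuous_of_tendsto_cocompact (x := 0) hkc.is_zero_at_infty
  obtain ⟨r, hr, hkr⟩ := Metric.uniformContinuous_iff.1 huc η hη0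
  have hev : ∀ᶠ n : ℕ in atTop, (bump n : ContDiffBump (0 : V d)).rOut < r :=
    tendsto_rOut.eventually (gt_mem_nhds hr)
  filter_upwards [hev] with n hn
  have e1 : (fun z => cv (bump n) g z - g z)
      = (fun z => cv (bump n) (g - k) z) + ((fun z => cv (bump n) k z - k z) + (k - g)) := by
    ext z
    simp only [Pi.add_apply, Pi.sub_apply, cv_sub _ hgi hki]; ring
  have hgk : Measurable (g - k) := hg.sub hkcont.measurable
  have m1 : AEStronglyMeasurable (fun z => cv (bump n) (g - k) z) (volume.restrict S) :=
    (cv_contDiff _ (hgi.sub hki)).continuous.aestronglyMeasurable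
  have m2 : AEStronglyMeasurable (fun z => cv (bump n) k z - k z) (volume.restrict S) :=
    ((cv_contDiff _ hki).continuous.sub hkcont).aestronglyMeasurable
  have m3 : AEStronglyMeasurable (k - g) (volume.restrict S) :=
    (hkcont.measurable.sub hg).aestronglyMeasurable
  have hp1 : 1 ≤ ENNReal.ofReal p := by simpa using hp
  rw [e1]
  refine (eLpNorm_add_le m1 (m2.add m3) hp1).trans ?_
  have b1 : eLpNorm (fun z => cv (bump n) (g - k) z) (ENNReal.ofReal p) (volume.restrict S) ≤ ε / 3 := by
    refine (eLpNorm_mono_measure _ Measure.restrict_le_self).trans (le_trans ?_ hk)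
    rw [key, key]
    exact ENNReal.rpow_le_rpow (cv_Lp _ hgk hp) (by positivity)
  have b3 : eLpNorm (k - g) (ENNReal.ofReal p) (volume.restrict S) ≤ ε / 3 := by
    refine (eLpNorm_mono_measure _ Measure.restrict_le_self).trans (le_trans ?_ hk)
    rw [eLpNorm_sub_comm]
  have b2 : eLpNorm (fun z => cv (bump n) k z - k z) (ENNReal.ofReal p) (volume.restrict S) ≤ ε / 3 := by
    refine (eLpNorm_le_of_ae_bound (C := η) (Eventually.of_forall fun z => ?_)).trans ?_
    · rw [← dist_eq_norm]
      refine ContDiffBump.dist_normed_convolution_le hkcont.aestronglyMeasurable ?_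
      intro x hx
      exact (hkr ((Metric.mem_ball.1 hx).trans hn)).le
    · rw [mul_comm, Measure.restrict_apply_univ, ENNReal.toReal_ofReal hp0.le, ← one_div]
      exact hη
  calc _ ≤ ε / 3 + (ε / 3 + ε / 3) := by
        gcongr
        exact (eLpNorm_add_le m2 m3 hp1).trans (by gcongr)
    _ = ε := by rw [← add_assoc]; exact ENNReal.add_thirds ε

/-- differentiation of mollifications by parts -/
lemma cv_deriv (φ : ContDiffBump (0 : V d)) {f f' : V d → ℝ} {S : Set (V d)} (hS : MeasurableSet S)
    (hf : IntegrableOn f S) (hf' : IntegrableOn f' S) (v z : V d)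
    (hz : Metric.closedBall z φ.rOut ⊆ S)
    (hd : ∀ w ∈ Metric.closedBall z φ.rOut, HasLineDerivAt ℝ f (f' w) w v) :
    fderiv ℝ (cv φ (S.indicator f)) z v = cv φ (S.indicator f') z := by
  have hfi : Integrable (S.indicator f) := hf.integrable_indicator hS
  have hfi' : Integrable (S.indicator f') := hf'.integrable_indicator hS
  have hη : ContDiff ℝ infty (φ.normed volume) := φ.contDiff_normed
  have hD := HasCompactSupport.hasFDerivAt_convolution_left (ContinuousLinearMap.lsmul ℝ ℝ)
    (φ.hasCompactSupport_normed (μ := volume)) (hη.of_le (by simp)) hfi.locallyIntegrable z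
  have hc1 : HasCompactSupport (fderiv ℝ (φ.normed (volume : Measure (V d)))) :=
    (φ.hasCompactSupport_normed (μ := volume)).fderiv (𝕜 := ℝ)
  have hcont1 : Continuous (fderiv ℝ (φ.normed (volume : Measure (V d)))) :=
    hη.continuous_fderiv (by simp)
  have hex := HasCompactSupport.convolutionExists_left
    (L := (ContinuousLinearMap.lsmul ℝ ℝ : ℝ →L[ℝ] ℝ →L[ℝ] ℝ).precompL (V d)) hc1 hcont1 hfi.locallyIntegrable z
  rw [cv, hD.fderiv, convolution_eq_swap, cv_swap]
  have hex' := hex.integrable_swap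
  rw [ContinuousLinearMap.integral_apply hex']
  simp only [ContinuousLinearMap.precompL_apply, ContinuousLinearMap.lsmul_apply, smul_eq_mul]
  -- integration by parts
  set G : V d → ℝ := fun w => φ.normed volume (z - w) with hG
  set G' : V d → ℝ := fun w => - fderiv ℝ (φ.normed volume) (z - w) v with hG'
  have hGd : ∀ w, HasLineDerivAt ℝ G (G' w) w v := by
    intro w
    have h1 : HasFDerivAt (φ.normed volume) (fderiv ℝ (φ.normed volume) (z - w)) (z - w) :=
      (hη.differentiable (by simp) _).hasFDerivAt
    have h2 : HasFDerivAt (fun w : V d => z - w) (-ContinuousLinearMap.id ℝ (V d)) w :=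
      (hasFDerivAt_id w).const_sub z
    have := (h1.comp w h2).hasLineDerivAt v
    simpa [hG', hG, Function.comp_def] using this
  have hsupp : tsupport G ⊆ Metric.closedBall z φ.rOut := by
    refine closure_minimal ?_ Metric.isClosed_closedBall
    intro w hw
    have : z - w ∈ Function.support (φ.normed volume) := hw
    rw [φ.support_normed_eq] at this
    simp only [Metric.mem_ball, dist_zero_right] at this
    rw [Metric.mem_closedBall, dist_comm, dist_eq_norm]; exact this.le
  have hGS : ∀ w, w ∉ S → G w = 0 := fun w hw => by
    by_contra h
    exact hw (hz (hsupp (subset_tsupport _ h)))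
  have hGS' : ∀ w, w ∉ S → G' w = 0 := fun w hw => by
    have h : w ∉ tsupport G := fun h => hw (hz (hsupp h))
    have h0 : HasLineDerivAt ℝ G 0 w v := by
      have : HasFDerivAt G (0 : V d →L[ℝ] ℝ) w := by
        refine (hasFDerivAt_const (0 : ℝ) w).congr_of_eventuallyEq ?_
        exact notMem_tsupport_iff_eventuallyEq.1 h
      simpa using this.hasLineDerivAt v
    exact (hGd w).unique h0
  have e1 : (fun w => fderiv ℝ (φ.normed volume) (z - w) v * S.indicator f w)
      = fun w => - (f w * G' w) := by
    ext w
    by_cases h : w ∈ S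
    · simp [h, hG']; ring
    · simp [h, hGS' w h]
  have e2 : (fun w => φ.normed volume (z - w) * S.indicator f' w)
      = fun w => f' w * G w := by
    ext w
    by_cases h : w ∈ S
    · simp [h, hG]; ring
    · simp [h, hGS w h]
  have i1 : Integrable (fun w => fderiv ℝ (φ.normed volume) (z - w) v * S.indicator f w) := by
    have := (ContinuousLinearMap.apply ℝ ℝ v).integrable_comp hex'
    simpa using this
  have bdG : ∃ C, ∀ w, ‖G w‖ ≤ C := by
    obtain ⟨C, hC⟩ := (φ.hasCompactSupport_normed (μ := volume)).exists_bound_of_continuous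
      φ.continuous_normed
    exact ⟨C, fun w => hC _⟩
  obtain ⟨C, hC⟩ := bdG
  have hGc : Continuous G := φ.continuous_normed.comp (continuous_const.sub continuous_id)
  have i2 : ∀ g : V d → ℝ, Integrable (S.indicator g) → Integrable (fun w => g w * G w) := by
    intro g hg
    refine (hg.mul_bdd (c := C) hGc.aestronglyMeasurable (Eventually.of_forall hC)).congr
      (Eventually.of_forall fun w => ?_)
    by_cases h : w ∈ S
    · simp [h]
    · simp [h, hGS w h]
  have := integral_bilinear_hasLineDerivAt_right_eq_neg_left_of_integrable (μ := (volume : Measure (V d)))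
    (f := f) (f' := f') (g := G) (g' := G') (v := v)
    (B := (ContinuousLinearMap.mul ℝ ℝ)) (i2 f' hfi')
    (by rw [e1] at i1; simpa using i1.neg) (i2 f hfi)
    (fun w hw => hd w (hsupp hw)) (fun w _ => hGd w)
  simp only [ContinuousLinearMap.mul_apply'] at this
  rw [e1, e2, integral_neg, this, neg_neg]

end PGE

namespace PGE
open Filter Topology
variable {d : ℕ}

/-! ## Regular functions -/

/-- the open cylinder -/
def Cy (d : ℕ) : Set (V d) := Set.Ioo (0 : ℝ) 1 ×ˢ Metric.ball (0 : E d) 1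
/-- the closed cylinder -/
def Cb (d : ℕ) : Set (V d) := Set.Icc (0 : ℝ) 1 ×ˢ Metric.closedBall (0 : E d) 1
/-- inner closed cylinders -/
def Qr (d : ℕ) (τ : ℝ) : Set (V d) := Set.Icc τ (1 - τ) ×ˢ Metric.closedBall (0 : E d) (1 - τ)

lemma isCompact_Cb : IsCompact (Cb d) := isCompact_Icc.prod (isCompact_closedBall _ _)
lemma isCompact_Qr (τ : ℝ) : IsCompact (Qr d τ) := isCompact_Icc.prod (isCompact_closedBall _ _)
lemma isOpen_Cy : IsOpen (Cy d) := isOpen_Ioo.prod Metric.isOpen_ball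
lemma mem_Cb {z : V d} : z ∈ Cb d ↔ (0 ≤ z.1 ∧ z.1 ≤ 1) ∧ ‖z.2‖ ≤ 1 := by simp [Cb, mem_prod]
lemma mem_Cy {z : V d} : z ∈ Cy d ↔ (0 < z.1 ∧ z.1 < 1) ∧ ‖z.2‖ < 1 := by simp [Cy, mem_prod]
lemma mem_Qr {τ : ℝ} {z : V d} : z ∈ Qr d τ ↔ (τ ≤ z.1 ∧ z.1 ≤ 1 - τ) ∧ ‖z.2‖ ≤ 1 - τ := by
  simp [Qr, mem_prod]
lemma Cy_subset_Cb : Cy d ⊆ Cb d := fun z hz => by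
  rw [mem_Cy] at hz; rw [mem_Cb]; exact ⟨⟨hz.1.1.le, hz.1.2.le⟩, hz.2.le⟩
lemma Qr_subset_Cy {τ : ℝ} (hτ : 0 < τ) : Qr d τ ⊆ Cy d := fun z hz => by
  rw [mem_Qr] at hz; rw [mem_Cy]; exact ⟨⟨by linarith, by linarith⟩, by linarith⟩
lemma Qr_closedBall {τ ε : ℝ} {z : V d} (hz : z ∈ Qr d τ) : Metric.closedBall z ε ⊆ Qr d (τ - ε) := by
  intro w hw
  rw [Metric.mem_closedBall, Prod.dist_eq, max_le_iff, Real.dist_eq, dist_eq_norm, abs_le] at hw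
  rw [mem_Qr] at hz ⊢
  refine ⟨⟨by linarith, by linarith⟩, ?_⟩
  have := norm_le_norm_add_norm_sub' w.2 z.2
  linarith

/-- exponent -/
abbrev pp (d : ℕ) : ℝ≥0∞ := ENNReal.ofReal ((d : ℝ) + 1)

structure Reg (φ φt : V d → ℝ) (dφ : V d → E d) (d2φ : V d → Matrix (Fin d) (Fin d) ℝ) : Prop where
  m0 : Measurable φ
  mt : Measurable φt
  mx : ∀ i, Measurable fun z => dφ z i
  mxx : ∀ i j, Measurable fun z => d2φ z i j
  cont : ContinuousOn φ (Cb d)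
  ht : ∀ z ∈ Cy d, HasLineDerivAt ℝ φ (φt z) z ((1 : ℝ), (0 : E d))
  hx : ∀ z ∈ Cy d, ∀ i, HasLineDerivAt ℝ φ (dφ z i) z ((0 : ℝ), bs i)
  hxx : ∀ z ∈ Cy d, ∀ i j, HasLineDerivAt ℝ (fun z => dφ z i) (d2φ z i j) z ((0 : ℝ), bs j)
  it : ∀ G : Set (V d), IsCompact G → G ⊆ Cy d → MemLp φt (pp d) (volume.restrict G)
  ix : ∀ G : Set (V d), IsCompact G → G ⊆ Cy d → ∀ i, MemLp (fun z => dφ z i) (pp d) (volume.restrict G)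
  ixx : ∀ G : Set (V d), IsCompact G → G ⊆ Cy d → ∀ i j,
    MemLp (fun z => d2φ z i j) (pp d) (volume.restrict G)

/-- affine functions of `x`, parametrized by height and slope -/
def ell (σ : V d) (x : E d) : ℝ := σ.1 + inner ℝ σ.2 x

lemma ell_continuous : Continuous fun q : V d × E d => ell q.1 q.2 := by
  unfold ell; fun_prop

/-! ## Contact points of smooth functions -/

lemma two_le_infty : (2 : WithTop ℕ∞) ≤ infty := by
  change ((2 : ℕ∞) : WithTop ℕ∞) ≤ ((⊤ : ℕ∞) : WithTop ℕ∞)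
  exact WithTop.coe_le_coe.2 le_top

lemma second_deriv_nonneg {q : ℝ → ℝ} (h : IsLocalMin q 0) (hc : ContDiff ℝ 2 q) :
    0 ≤ deriv (deriv q) 0 := by
  by_contra hneg
  push Not at hneg
  have hmax := isLocalMax_of_deriv_deriv_neg hneg h.deriv_eq_zero hc.continuous.continuousAt
  have he : q =ᶠ[𝓝 0] fun _ => q 0 := by
    filter_upwards [h, hmax] with x h1 h2 using le_antisymm h2 h1
  have h1 : deriv q =ᶠ[𝓝 0] fun _ => 0 := by
    have := he.deriv
    simpa using this
  have := h1.deriv_eq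
  simp at this
  linarith

lemma hess_symm {ψ : V d → ℝ} (h : ContDiff ℝ infty ψ) (z : V d) (i j : Fin d) :
    hess ψ z i j = fderiv ℝ (fderiv ℝ ψ) z (0, bs j) (0, bs i) := by
  have h1 : HasFDerivAt (fderiv ℝ ψ) (fderiv ℝ (fderiv ℝ ψ) z) z :=
    (((h.fderiv_right (m := infty) (by simp)).differentiable (by simp)) z).hasFDerivAt
  have := h1.clm_apply (hasFDerivAt_const ((0 : ℝ), bs i) z)
  simp only [hess, Matrix.of_apply]
  have e : pX ψ i = fun y => fderiv ℝ ψ y (0, bs i) := rfl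
  rw [e, this.fderiv]
  simp

lemma contact_smooth {ψ : V d → ℝ} (h : ContDiff ℝ infty ψ) {σ z : V d}
    (h0 : ψ z = ell σ z.2)
    (h1 : ∀ᶠ x in 𝓝 z.2, ell σ x ≤ ψ (z.1, x))
    (h2 : ∀ᶠ t in 𝓝[≥] z.1, ell σ z.2 ≤ ψ (t, z.2)) :
    leg ψ z = σ ∧ 0 ≤ pT ψ z ∧ (hess ψ z).PosSemidef := by
  have hψ : HasFDerivAt ψ (fderiv ℝ ψ z) z := (h.differentiable (by simp) z).hasFDerivAt
  -- line restriction
  have hline : ∀ ξ : E d, ∀ r : ℝ, HasDerivAt (fun r : ℝ => ψ (z.1, z.2 + r • ξ) - ell σ (z.2 + r • ξ))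
      (fderiv ℝ ψ (z.1, z.2 + r • ξ) (0, ξ) - inner ℝ σ.2 ξ) r := by
    intro ξ r
    have hl : HasDerivAt (fun r : ℝ => z.2 + r • ξ) ξ r := by
      simpa using ((hasDerivAt_id r).smul_const ξ).const_add z.2
    have hl2 : HasDerivAt (fun r : ℝ => ((z.1, z.2 + r • ξ) : V d)) (0, ξ) r :=
      (hasDerivAt_const r z.1).prodMk hl
    have a1 := (h.differentiable (by simp) (z.1, z.2 + r • ξ)).hasFDerivAt.comp_hasDerivAt r hl2
    have a2 : HasDerivAt (fun r : ℝ => ell σ (z.2 + r • ξ)) (inner ℝ σ.2 ξ) r := by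
      unfold ell
      have := ((hasDerivAt_const r σ.2).inner ℝ hl).const_add σ.1
      simpa using this
    exact a1.sub a2
  have hloc : ∀ ξ : E d, IsLocalMin (fun r : ℝ => ψ (z.1, z.2 + r • ξ) - ell σ (z.2 + r • ξ)) 0 := by
    intro ξ
    have hc : Tendsto (fun r : ℝ => z.2 + r • ξ) (𝓝 0) (𝓝 z.2) := by
      have : Continuous fun r : ℝ => z.2 + r • ξ := by fun_prop
      simpa using this.tendsto 0
    filter_upwards [hc.eventually h1] with r hr
    simp [h0]; linarith
  have hgr : ∀ ξ : E d, fderiv ℝ ψ z (0, ξ) = inner ℝ σ.2 ξ := by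
    intro ξ
    have := (hloc ξ).hasDerivAt_eq_zero (hline ξ 0)
    simp only [zero_smul, add_zero] at this
    linarith
  have hgrad : grad ψ z = σ.2 := by
    ext i
    simp [grad, pX, hgr, bs, EuclideanSpace.inner_single_right]
  refine ⟨?_, ?_, ?_⟩
  · refine Prod.ext ?_ hgrad
    simp only [leg, hgrad, h0, ell, real_inner_comm]; ring
  · obtain ⟨e, he, hh⟩ := (mem_nhdsGE_iff_exists_Icc_subset (a := z.1)).1 h2
    have hl2 : HasDerivAt (fun t : ℝ => ((t, z.2) : V d)) (1, 0) z.1 :=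
      (hasDerivAt_id z.1).prodMk (hasDerivAt_const z.1 z.2)
    have a1 : HasDerivAt (fun t : ℝ => ψ (t, z.2)) (fderiv ℝ ψ z (1, 0)) z.1 :=
      HasFDerivAt.comp_hasDerivAt z.1 (f := fun t : ℝ => ((t, z.2) : V d)) hψ hl2
    have hm : IsLocalMinOn (fun t : ℝ => ψ (t, z.2)) (Icc z.1 e) z.1 := by
      filter_upwards [self_mem_nhdsWithin] with t ht
      have := hh ht
      simp only [Set.mem_ofPred_eq] at this
      rw [← h0] at this
      exact this
    have := hm.hasFDerivWithinAt_nonneg (a1.hasFDerivAt.hasFDerivWithinAt) (y := e - z.1)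
      (sub_mem_posTangentConeAt_of_segment_subset (by rw [segment_eq_Icc (le_of_lt he)]))
    have he' : 0 < e - z.1 := by simpa using he
    simp at this
    unfold pT
    nlinarith
  · have hsym : IsSymmSndFDerivAt ℝ ψ z :=
      (h.contDiffAt).isSymmSndFDerivAt (by simp only [minSmoothness_of_isRCLikeNormedField]; exact two_le_infty)
    refine Matrix.PosSemidef.of_dotProduct_mulVec_nonneg ?_ ?_
    · ext i j
      simp only [Matrix.conjTranspose_apply, star_trivial, hess_symm h]
      exact hsym _ _
    · intro y
      set ξ : E d := WithLp.toLp 2 y with hξ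
      have hcd : ContDiff ℝ 2 (fun r : ℝ => ψ (z.1, z.2 + r • ξ) - ell σ (z.2 + r • ξ)) := by
        refine ContDiff.sub ((h.of_le two_le_infty).comp ?_) ?_
        · fun_prop
        · unfold ell; exact contDiff_const.add (contDiff_const.inner ℝ (by fun_prop))
      have hnn := second_deriv_nonneg (hloc ξ) hcd
      have hd1 : deriv (fun r : ℝ => ψ (z.1, z.2 + r • ξ) - ell σ (z.2 + r • ξ))
          = fun r => fderiv ℝ ψ (z.1, z.2 + r • ξ) (0, ξ) - inner ℝ σ.2 ξ :=
        funext fun r => (hline ξ r).deriv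
      have hf : HasFDerivAt (fderiv ℝ ψ) (fderiv ℝ (fderiv ℝ ψ) z) z :=
        (((h.fderiv_right (m := infty) (by simp)).differentiable (by simp)) z).hasFDerivAt
      have hl2 : HasDerivAt (fun r : ℝ => ((z.1, z.2 + r • ξ) : V d)) (0, ξ) 0 := by
        refine (hasDerivAt_const _ z.1).prodMk ?_
        simpa using ((hasDerivAt_id (0 : ℝ)).smul_const ξ).const_add z.2
      have hd2 : HasDerivAt (fun r : ℝ => fderiv ℝ ψ (z.1, z.2 + r • ξ) (0, ξ) - inner ℝ σ.2 ξ)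
          (fderiv ℝ (fderiv ℝ ψ) z (0, ξ) (0, ξ)) 0 := by
        have hf' : HasFDerivAt (fderiv ℝ ψ) (fderiv ℝ (fderiv ℝ ψ) z)
            ((fun r : ℝ => ((z.1, z.2 + r • ξ) : V d)) 0) := by simpa using hf
        have := hf'.comp_hasDerivAt (0 : ℝ) hl2
        have := (this.clm_apply (hasDerivAt_const (0 : ℝ) ((0 : ℝ), ξ))).sub_const (inner ℝ σ.2 ξ)
        simpa using this
      rw [hd1, hd2.deriv] at hnn
      have ex : fderiv ℝ (fderiv ℝ ψ) z (0, ξ) (0, ξ)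
          = ∑ i, ∑ j, y i * y j * fderiv ℝ (fderiv ℝ ψ) z (0, bs j) (0, bs i) := by
        rw [fderiv_split (fderiv ℝ (fderiv ℝ ψ) z (0, ξ)) 0 ξ]
        simp only [zero_mul, zero_add]
        refine Finset.sum_congr rfl fun i _ => ?_
        have := fderiv_split ((fderiv ℝ (fderiv ℝ ψ) z).flip (0, bs i)) 0 ξ
        simp only [ContinuousLinearMap.flip_apply, zero_mul, zero_add] at this
        rw [this, Finset.mul_sum]
        refine Finset.sum_congr rfl fun j _ => ?_
        simp [hξ]; ring
      rw [ex] at hnn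
      refine hnn.trans (le_of_eq ?_)
      simp only [dotProduct, Matrix.mulVec, star_trivial, hess_symm h, Finset.mul_sum]
      refine Finset.sum_congr rfl fun i _ => Finset.sum_congr rfl fun j _ => by ring

/-- existence of contact points for continuous functions on cylinders -/
lemma exists_contact {ψ : V d → ℝ} (hψ : Continuous ψ) {σ : V d} {s T r : ℝ} (hs : s ≤ T)
    (h1 : ∃ x, ‖x‖ ≤ r ∧ ψ (s, x) ≤ ell σ x)
    (h2 : ∀ t x, s ≤ t → t ≤ T → ‖x‖ = r → ell σ x < ψ (t, x))
    (h3 : ∀ x, ‖x‖ ≤ r → ell σ x < ψ (T, x)) :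
    ∃ z : V d, s ≤ z.1 ∧ z.1 < T ∧ ‖z.2‖ < r ∧ ψ z = ell σ z.2 ∧
      ∀ t x, z.1 ≤ t → t ≤ T → ‖x‖ ≤ r → ell σ x ≤ ψ (t, x) := by
  have hell : Continuous (ell σ) := ell_continuous.comp (by fun_prop : Continuous fun x => (σ, x))
  set A : Set (V d) := (Icc s T ×ˢ Metric.closedBall (0 : E d) r) ∩ {z | ψ z ≤ ell σ z.2} with hA
  have hAc : IsCompact A := (isCompact_Icc.prod (isCompact_closedBall _ _)).inter_right
    (isClosed_le hψ (hell.comp continuous_snd))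
  obtain ⟨x, hx, hx'⟩ := h1
  have hne : A.Nonempty := ⟨(s, x), ⟨⟨⟨le_rfl, hs⟩, by simpa using hx⟩, hx'⟩⟩
  obtain ⟨z, hz, hmax⟩ := hAc.exists_isMaxOn hne continuous_fst.continuousOn
  obtain ⟨⟨⟨hz1, hz2⟩, hz3⟩, hz4⟩ := hz
  simp only [Metric.mem_closedBall, dist_zero_right] at hz3
  simp only [Set.mem_ofPred_eq] at hz4
  have hzT : z.1 < T := by
    rcases hz2.lt_or_eq with h | h
    · exact h
    · have := h3 z.2 hz3
      rw [← h] at this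
      exact absurd this (not_lt.2 hz4)
  have hgt : ∀ t x, z.1 < t → t ≤ T → ‖x‖ ≤ r → ell σ x < ψ (t, x) := by
    intro t x ht htT hx
    by_contra hcon
    push Not at hcon
    have := hmax (a := (t, x)) ⟨⟨⟨hz1.trans ht.le, htT⟩, by simpa using hx⟩, hcon⟩
    simp only [Set.mem_ofPred_eq] at this
    linarith
  have hge : ∀ t x, z.1 ≤ t → t ≤ T → ‖x‖ ≤ r → ell σ x ≤ ψ (t, x) := by
    intro t x ht htT hx
    rcases ht.lt_or_eq with h | h
    · exact (hgt t x h htT hx).le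
    · subst h
      have hc : Tendsto (fun t => ψ (t, x)) (𝓝[>] z.1) (𝓝 (ψ (z.1, x))) :=
        (Continuous.tendsto (by fun_prop : Continuous fun t => ψ (t, x)) z.1).mono_left
          nhdsWithin_le_nhds
      refine ge_of_tendsto hc ?_
      filter_upwards [Ioc_mem_nhdsGT hzT] with t ht
      exact (hgt t x ht.1 ht.2 hx).le
  refine ⟨z, hz1, hzT, ?_, le_antisymm hz4 (hge z.1 z.2 le_rfl hz2 hz3), hge⟩
  rcases hz3.lt_or_eq with h | h
  · exact h
  · exact absurd (h2 z.1 z.2 hz1 hz2 h) (not_lt.2 hz4)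

end PGE

namespace PGE
open Filter Topology
variable {d : ℕ}

/-! ## Approximation of regular functions -/

/-- smooth approximants -/
def appr (τ : ℝ) (φ : V d → ℝ) (n : ℕ) : V d → ℝ := cv (bump n) ((Qr d (τ / 2)).indicator φ)

section
variable {φ φt : V d → ℝ} {dφ : V d → E d} {d2φ : V d → Matrix (Fin d) (Fin d) ℝ}

lemma measurableSet_Qr (τ : ℝ) : MeasurableSet (Qr d τ) := (isCompact_Qr τ).measurableSet

lemma Reg.int0 (h : Reg φ φt dφ d2φ) {τ : ℝ} (hτ : 0 < τ) : IntegrableOn φ (Qr d τ) :=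
  (h.cont.mono ((Qr_subset_Cy hτ).trans Cy_subset_Cb)).integrableOn_compact (isCompact_Qr τ)

lemma one_le_pp : 1 ≤ pp d := by simp [pp]

lemma integrableOn_of_memLp {f : V d → ℝ} {G : Set (V d)} (hG : IsCompact G)
    (h : MemLp f (pp d) (volume.restrict G)) : IntegrableOn f G := by
  have : IsFiniteMeasure (volume.restrict G) := ⟨by simpa using hG.measure_lt_top⟩
  exact h.integrable one_le_pp

lemma memLp_indicator {f : V d → ℝ} {G : Set (V d)} (hG : MeasurableSet G)
    (h : MemLp f (pp d) (volume.restrict G)) : MemLp (G.indicator f) (pp d) volume :=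
  (memLp_indicator_iff_restrict hG).2 h

lemma appr_contDiff (h : Reg φ φt dφ d2φ) {τ : ℝ} (hτ : 0 < τ) (n : ℕ) :
    ContDiff ℝ infty (appr τ φ n) :=
  cv_contDiff _ ((h.int0 (half_pos hτ)).integrable_indicator (measurableSet_Qr _)).locallyIntegrable

lemma appr_unif (h : Reg φ φt dφ d2φ) {τ : ℝ} (hτ : 0 < τ) {ε : ℝ} (hε : 0 < ε) :
    ∀ᶠ n in atTop, ∀ z ∈ Qr d τ, |appr τ φ n z - φ z| ≤ ε := by
  have hsub : Qr d (τ / 2) ⊆ Cb d := (Qr_subset_Cy (half_pos hτ)).trans Cy_subset_Cb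
  have huc := (isCompact_Qr (d := d) (τ / 2)).uniformContinuousOn_of_continuous (h.cont.mono hsub)
  obtain ⟨r, hr, hφr⟩ := Metric.uniformContinuousOn_iff.1 huc ε hε
  filter_upwards [tendsto_rOut.eventually (gt_mem_nhds hr),
    tendsto_rOut.eventually (gt_mem_nhds (half_pos hτ))] with n hn hn2 z hz
  have hz0 : z ∈ Qr d (τ / 2) := by
    have := Qr_closedBall (ε := τ / 2) hz (Metric.mem_closedBall_self (by positivity))
    rwa [_root_.sub_half] at this
  have e : φ z = (Qr d (τ / 2)).indicator φ z := by simp [hz0]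
  rw [e, ← Real.dist_eq]
  refine ContDiffBump.dist_normed_convolution_le
    (h.m0.indicator (measurableSet_Qr _)).aestronglyMeasurable ?_
  intro x hx
  have hx0 : x ∈ Qr d (τ / 2) := by
    have := Qr_closedBall (ε := τ / 2) hz
      (Metric.mem_closedBall.2 ((Metric.mem_ball.1 hx).le.trans hn2.le))
    rwa [_root_.sub_half] at this
  simp only [hz0, hx0, indicator_of_mem]
  exact (hφr x hx0 z hz0 ((Metric.mem_ball.1 hx).trans hn)).le

lemma appr_deriv (h : Reg φ φt dφ d2φ) {τ : ℝ} (hτ : 0 < τ) :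
    ∀ᶠ n in atTop, ∀ z ∈ Qr d τ,
      pT (appr τ φ n) z = cv (bump n) ((Qr d (τ / 2)).indicator φt) z ∧
      ∀ i j, hess (appr τ φ n) z i j
        = cv (bump n) ((Qr d (τ / 2)).indicator (fun z => d2φ z i j)) z := by
  have hQ := isCompact_Qr (d := d) (τ / 2)
  have hsub : Qr d (τ / 2) ⊆ Cy d := Qr_subset_Cy (half_pos hτ)
  have hm := measurableSet_Qr (d := d) (τ / 2)
  filter_upwards [tendsto_rOut.eventually (gt_mem_nhds (show 0 < τ / 4 by positivity))] with n hn z hz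
  have hball : ∀ z' ∈ Metric.closedBall z (τ / 4),
      Metric.closedBall z' (bump n : ContDiffBump (0 : V d)).rOut ⊆ Qr d (τ / 2) := by
    intro z' hz' w hw
    have h1 := Qr_closedBall (Qr_closedBall hz hz') (Metric.closedBall_subset_closedBall hn.le hw)
    have e : τ - τ / 4 - τ / 4 = τ / 2 := by ring
    rwa [e] at h1
  have hzz := Metric.mem_closedBall_self (x := z) (show 0 ≤ τ / 4 by positivity)
  refine ⟨?_, fun i j => ?_⟩
  · exact cv_deriv _ hm (h.int0 (half_pos hτ)) (integrableOn_of_memLp hQ (h.it _ hQ hsub)) _ z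
      (hball z hzz) (fun w hw => h.ht w (hsub (hball z hzz hw)))
  · have e : pX (appr τ φ n) i =ᶠ[𝓝 z] cv (bump n) ((Qr d (τ / 2)).indicator (fun z => dφ z i)) := by
      filter_upwards [Metric.closedBall_mem_nhds z (show 0 < τ / 4 by positivity)] with z' hz'
      exact cv_deriv _ hm (h.int0 (half_pos hτ)) (integrableOn_of_memLp hQ (h.ix _ hQ hsub i)) _ z'
        (hball z' hz') (fun w hw => h.hx w (hsub (hball z' hz' hw)) i)
    simp only [hess, Matrix.of_apply]
    rw [e.fderiv_eq]
    exact cv_deriv _ hm (integrableOn_of_memLp hQ (h.ix _ hQ hsub i))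
      (integrableOn_of_memLp hQ (h.ixx _ hQ hsub i j)) _ z
      (hball z hzz) (fun w hw => h.hxx w (hsub (hball z hzz hw)) i j)

lemma eLpNorm_comb {δ : ℝ} (hδ : 0 < δ) {a : V d → Matrix (Fin d) (Fin d) ℝ}
    (ha : ∀ z, Ell δ (a z)) (has : ∀ z, (a z).IsSymm) (ham : ∀ i j, Measurable fun z => a z i j)
    (μ : Measure (V d)) (f : V d → ℝ) (hf : Measurable f) (g : Fin d → Fin d → V d → ℝ)
    (hg : ∀ i j, Measurable (g i j)) :
    eLpNorm (fun z => f z + ∑ i, ∑ j, a z i j * g i j z) (pp d) μ ≤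
      eLpNorm f (pp d) μ + ∑ i, ∑ j, ENNReal.ofReal (2 * δ⁻¹) * eLpNorm (g i j) (pp d) μ := by
  have m1 : ∀ i j, Measurable (fun z => a z i j * g i j z) := fun i j => (ham i j).mul (hg i j)
  have m2 : ∀ i, Measurable (∑ j, fun z => a z i j * g i j z) := fun i =>
    by simpa only [Finset.sum_fn] using Finset.measurable_sum Finset.univ fun j _ => m1 i j
  have m3 : Measurable (∑ i, ∑ j, fun z => a z i j * g i j z) :=
    by simpa only [Finset.sum_fn, Finset.sum_apply] using Finset.measurable_sum Finset.univ fun i _ => m2 i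
  have e : (fun z => f z + ∑ i, ∑ j, a z i j * g i j z)
      = f + ∑ i, ∑ j, fun z => a z i j * g i j z := by
    ext z; simp [Finset.sum_apply]
  rw [e]
  refine (eLpNorm_add_le hf.aestronglyMeasurable m3.aestronglyMeasurable one_le_pp).trans ?_
  refine add_le_add le_rfl ?_
  refine (eLpNorm_sum_le (fun i _ => (m2 i).aestronglyMeasurable) one_le_pp).trans ?_
  refine Finset.sum_le_sum fun i _ => ?_
  refine (eLpNorm_sum_le (fun j _ => (m1 i j).aestronglyMeasurable) one_le_pp).trans ?_
  refine Finset.sum_le_sum fun j _ => ?_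
  refine eLpNorm_le_mul_eLpNorm_of_ae_le_mul (Eventually.of_forall fun z => ?_) _
  rw [norm_mul]
  exact mul_le_mul_of_nonneg_right (abs_entry_le hδ (has z) (ha z) i j) (norm_nonneg _)

lemma appr_Lp (h : Reg φ φt dφ d2φ) {δ : ℝ} (hδ : 0 < δ) {a : V d → Matrix (Fin d) (Fin d) ℝ}
    (ha : ∀ z, Ell δ (a z)) (has : ∀ z, (a z).IsSymm) (ham : ∀ i j, Measurable fun z => a z i j)
    {τ : ℝ} (hτ : 0 < τ) :
    Tendsto (fun n => eLpNorm (fun z => (pT (appr τ φ n) z + mdot (a z) (hess (appr τ φ n) z))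
      - (φt z + mdot (a z) (d2φ z))) (pp d) (volume.restrict (Qr d τ))) atTop (𝓝 0) := by
  have hQ := isCompact_Qr (d := d) (τ / 2)
  have hsub : Qr d (τ / 2) ⊆ Cy d := Qr_subset_Cy (half_pos hτ)
  have hm := measurableSet_Qr (d := d) (τ / 2)
  have hsub2 : Qr d τ ⊆ Qr d (τ / 2) := fun z hz => by
    have := Qr_closedBall (ε := τ / 2) hz (Metric.mem_closedBall_self (by positivity))
    rwa [_root_.sub_half] at this
  have hp1 : 1 ≤ (d : ℝ) + 1 := by simp
  have hvol : volume (Qr d τ) ≠ ⊤ := (isCompact_Qr τ).measure_lt_top.ne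
  have L : ∀ f : V d → ℝ, Measurable f → MemLp f (pp d) (volume.restrict (Qr d (τ / 2))) →
      Tendsto (fun n => eLpNorm (fun z => cv (bump n) ((Qr d (τ / 2)).indicator f) z
        - (Qr d (τ / 2)).indicator f z) (pp d) (volume.restrict (Qr d τ))) atTop (𝓝 0) := by
    intro f hf hfm
    exact cv_tendsto_Lp (hf.indicator hm) hp1
      ((integrableOn_of_memLp hQ hfm).integrable_indicator hm).locallyIntegrable
      (memLp_indicator hm hfm) hvol
  have Lt := L φt h.mt (h.it _ hQ hsub)
  have Lxx := fun i j => L (fun z => d2φ z i j) (h.mxx i j) (h.ixx _ hQ hsub i j)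
  have hC : ENNReal.ofReal (2 * δ⁻¹) ≠ ⊤ := ENNReal.ofReal_ne_top
  have hlim : Tendsto (fun n => eLpNorm (fun z => cv (bump n) ((Qr d (τ / 2)).indicator φt) z
        - (Qr d (τ / 2)).indicator φt z) (pp d) (volume.restrict (Qr d τ))
      + ∑ i, ∑ j, ENNReal.ofReal (2 * δ⁻¹) *
        eLpNorm (fun z => cv (bump n) ((Qr d (τ / 2)).indicator (fun z => d2φ z i j)) z
        - (Qr d (τ / 2)).indicator (fun z => d2φ z i j) z) (pp d) (volume.restrict (Qr d τ)))
      atTop (𝓝 0) := by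
    have := Lt.add (tendsto_finsetSum Finset.univ fun i _ => tendsto_finsetSum Finset.univ fun j _ =>
      ENNReal.Tendsto.const_mul (a := ENNReal.ofReal (2 * δ⁻¹)) (Lxx i j) (Or.inr hC))
    simpa using this
  refine tendsto_of_tendsto_of_tendsto_of_le_of_le' tendsto_const_nhds hlim
    (Eventually.of_forall fun _ => zero_le) ?_
  filter_upwards [appr_deriv h hτ] with n hn
  have e : (fun z => (pT (appr τ φ n) z + mdot (a z) (hess (appr τ φ n) z))
      - (φt z + mdot (a z) (d2φ z))) =ᵐ[volume.restrict (Qr d τ)]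
      (fun z => (cv (bump n) ((Qr d (τ / 2)).indicator φt) z - (Qr d (τ / 2)).indicator φt z)
      + ∑ i, ∑ j, a z i j * (cv (bump n) ((Qr d (τ / 2)).indicator (fun z => d2φ z i j)) z
        - (Qr d (τ / 2)).indicator (fun z => d2φ z i j) z)) := by
    filter_upwards [ae_restrict_mem (measurableSet_Qr τ)] with z hz
    obtain ⟨h1, h2⟩ := hn z hz
    simp only [h1, mdot, h2, indicator_of_mem (hsub2 hz), mul_sub,
      Finset.sum_sub_distrib]
    ring
  have hcm : ∀ f : V d → ℝ, Measurable f → MemLp f (pp d) (volume.restrict (Qr d (τ / 2))) →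
      Measurable (fun z => cv (bump n) ((Qr d (τ / 2)).indicator f) z
        - (Qr d (τ / 2)).indicator f z) := fun f hf hfm =>
    (cv_contDiff _ ((integrableOn_of_memLp hQ hfm).integrable_indicator hm).locallyIntegrable).continuous.measurable.sub
      (hf.indicator hm)
  have mt := hcm φt h.mt (h.it _ hQ hsub)
  rw [eLpNorm_congr_ae e]
  exact eLpNorm_comb hδ ha has ham _ _ mt _
    (fun i j => hcm (fun z => d2φ z i j) (h.mxx i j) (h.ixx _ hQ hsub i j))

end

end PGE

namespace PGE
open Filter Topology
variable {d : ℕ}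

/-! ## The area lemma -/

/-- `z` is a contact point of the affine function `σ` from below -/
def Contact (φ : V d → ℝ) (σ z : V d) : Prop :=
  z ∈ Cy d ∧ φ z = ell σ z.2 ∧ ∀ w ∈ Cb d, z.1 ≤ w.1 → ell σ w.2 ≤ φ w

structure Adm (φ : V d → ℝ) (τ R : ℝ) (σ : V d) (s : ℝ) : Prop where
  hR : ‖σ.2‖ ≤ R
  s0 : τ ≤ s
  s1 : s ≤ 1
  low : ∃ x, ‖x‖ ≤ 1 ∧ φ (s, x) ≤ ell σ x - τ
  lat : ∀ t x, s ≤ t → t ≤ 1 → ‖x‖ = 1 → ell σ x + τ ≤ φ (t, x)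
  top : ∀ x, ‖x‖ ≤ 1 → ell σ x + τ ≤ φ (1, x)

lemma ell_sub (σ : V d) (x y : E d) : |ell σ x - ell σ y| ≤ ‖σ.2‖ * ‖x - y‖ := by
  have : ell σ x - ell σ y = inner ℝ σ.2 (x - y) := by simp [ell, inner_sub_right]
  rw [this]; exact abs_real_inner_le_norm _ _

lemma layer {φ : V d → ℝ} (hc : ContinuousOn φ (Cb d)) {τ R : ℝ} (hτ : 0 < τ) :
    ∃ τ₁, 0 < τ₁ ∧ τ₁ ≤ τ ∧ τ₁ < 1 / 2 ∧ ∀ σ s, Adm φ τ R σ s → ∀ w ∈ Cb d, s ≤ w.1 →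
      (1 - τ₁ ≤ w.1 ∨ 1 - τ₁ ≤ ‖w.2‖) → ell σ w.2 + τ / 2 ≤ φ w := by
  have huc := isCompact_Cb.uniformContinuousOn_of_continuous hc
  obtain ⟨r, hr, hφr⟩ := Metric.uniformContinuousOn_iff.1 huc (τ / 4) (by positivity)
  have hR' : 0 < 4 * (|R| + 1) := by positivity
  refine ⟨min (min τ (r / 2)) (min (1 / 4) (τ / (4 * (|R| + 1)))), by positivity,
    (min_le_left _ _).trans (min_le_left _ _), ?_, ?_⟩
  · exact ((min_le_right _ _).trans (min_le_left _ _)).trans_lt (by norm_num)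
  set τ₁ := min (min τ (r / 2)) (min (1 / 4) (τ / (4 * (|R| + 1))))
  have t1 : τ₁ ≤ r / 2 := (min_le_left _ _).trans (min_le_right _ _)
  have t2 : τ₁ ≤ 1 / 4 := (min_le_right _ _).trans (min_le_left _ _)
  have t3 : τ₁ ≤ τ / (4 * (|R| + 1)) := (min_le_right _ _).trans (min_le_right _ _)
  have t0 : 0 < τ₁ := by positivity
  intro σ s h w hw hsw hor
  rw [mem_Cb] at hw
  rcases hor with h1 | h1
  · have hd : dist w (1, w.2) < r := by
      rw [Prod.dist_eq, max_lt_iff, Real.dist_eq, dist_self]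
      refine ⟨?_, hr⟩
      rw [abs_lt]; constructor <;> linarith
    have := hφr w (mem_Cb.2 hw) (1, w.2) (mem_Cb.2 ⟨⟨zero_le_one, le_rfl⟩, hw.2⟩) hd
    rw [Real.dist_eq, abs_lt] at this
    have := h.top w.2 hw.2
    linarith
  · have hn : 0 < ‖w.2‖ := by linarith
    set x' : E d := ‖w.2‖⁻¹ • w.2 with hx'
    have hx1 : ‖x'‖ = 1 := by rw [hx', norm_smul, norm_inv, norm_norm, inv_mul_cancel₀ hn.ne']
    have hxd : ‖w.2 - x'‖ ≤ τ₁ := by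
      have : w.2 - x' = (1 - ‖w.2‖⁻¹) • w.2 := by rw [hx', sub_smul, one_smul]
      rw [this, norm_smul, Real.norm_eq_abs]
      have h2 : 1 - ‖w.2‖⁻¹ ≤ 0 := by
        have := (one_le_inv₀ hn).2 hw.2; linarith
      rw [abs_of_nonpos h2, neg_sub, sub_mul, inv_mul_cancel₀ hn.ne']; linarith
    have hd : dist w (w.1, x') < r := by
      rw [Prod.dist_eq, max_lt_iff, dist_self, dist_eq_norm]
      exact ⟨hr, by simp only; linarith⟩
    have h3 := hφr w (mem_Cb.2 hw) (w.1, x') (mem_Cb.2 ⟨hw.1, hx1.le⟩) hd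
    rw [Real.dist_eq, abs_lt] at h3
    have h4 := h.lat w.1 x' hsw hw.1.2 hx1
    have h5 := ell_sub σ w.2 x'
    have h6 : ‖σ.2‖ * ‖w.2 - x'‖ ≤ τ / 4 := by
      calc _ ≤ (|R| + 1) * (τ / (4 * (|R| + 1))) := by
            refine mul_le_mul ?_ (hxd.trans t3) (norm_nonneg _) (by positivity)
            have := le_abs_self R
            linarith [h.hR]
        _ = τ / 4 := by field_simp
    have := (abs_le.1 (h5.trans h6))
    linarith

lemma limit_contact {φ : V d → ℝ} (hc : ContinuousOn φ (Cb d)) {τ₁ : ℝ} (h0 : 0 < τ₁)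
    {ψ : ℕ → V d → ℝ} {e : ℕ → ℝ} (he : Tendsto e atTop (𝓝 0))
    (hψ : ∀ k, ∀ z ∈ Qr d τ₁, |ψ k z - φ z| ≤ e k)
    {σs zs : ℕ → V d} {σ z : V d} (hσ : Tendsto σs atTop (𝓝 σ)) (hz : Tendsto zs atTop (𝓝 z))
    (hzQ : ∀ k, zs k ∈ Qr d τ₁)
    (hlay : ∀ k, ∀ w ∈ Cb d, (zs k).1 ≤ w.1 → (1 - τ₁ ≤ w.1 ∨ 1 - τ₁ ≤ ‖w.2‖) →
      ell (σs k) w.2 ≤ φ w)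
    (h1 : ∀ k, ψ k (zs k) = ell (σs k) (zs k).2)
    (h2 : ∀ k t x, (zs k).1 ≤ t → t ≤ 1 - τ₁ → ‖x‖ ≤ 1 - τ₁ → ell (σs k) x ≤ ψ k (t, x)) :
    Contact φ σ z := by
  have hsub : Qr d τ₁ ⊆ Cb d := (Qr_subset_Cy h0).trans Cy_subset_Cb
  have hzQ' : z ∈ Qr d τ₁ := (isCompact_Qr τ₁).isClosed.mem_of_tendsto hz (Eventually.of_forall hzQ)
  have hzC := Qr_subset_Cy h0 hzQ'
  refine ⟨hzC, ?_, ?_⟩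
  · have a1 : Tendsto (fun k => φ (zs k)) atTop (𝓝 (φ z)) :=
      ((hc z (hsub hzQ')).tendsto).comp (tendsto_nhdsWithin_iff.2
        ⟨hz, Eventually.of_forall fun k => hsub (hzQ k)⟩)
    have a2 : Tendsto (fun k => ψ k (zs k) - φ (zs k)) atTop (𝓝 0) :=
      squeeze_zero_norm (fun k => hψ k _ (hzQ k)) he
    have a3 : Tendsto (fun k => ψ k (zs k)) atTop (𝓝 (φ z)) := by
      have := a2.add a1
      simpa using this
    have a4 : Tendsto (fun k => ell (σs k) (zs k).2) atTop (𝓝 (ell σ z.2)) :=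
      (ell_continuous.tendsto (σ, z.2)).comp (hσ.prodMk_nhds ((continuous_snd.tendsto z).comp hz))
    simp only [h1] at a3
    exact tendsto_nhds_unique a3 a4
  have key : ∀ w ∈ Cb d, z.1 < w.1 → ell σ w.2 ≤ φ w := by
    intro w hw hlt
    have b1 : Tendsto (fun k => ell (σs k) w.2) atTop (𝓝 (ell σ w.2)) :=
      (ell_continuous.tendsto (σ, w.2)).comp (hσ.prodMk_nhds tendsto_const_nhds)
    have b2 : ∀ᶠ k in atTop, (zs k).1 < w.1 :=
      ((continuous_fst.tendsto z).comp hz).eventually (gt_mem_nhds hlt)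
    have b3 : Tendsto (fun k => φ w + e k) atTop (𝓝 (φ w)) := by
      simpa using he.const_add (φ w)
    by_cases hl : 1 - τ₁ ≤ w.1 ∨ 1 - τ₁ ≤ ‖w.2‖
    · refine le_of_tendsto b1 ?_
      filter_upwards [b2] with k hk using hlay k w hw hk.le hl
    · push Not at hl
      refine le_of_tendsto_of_tendsto b1 b3 ?_
      filter_upwards [b2] with k hk
      have c1 := h2 k w.1 w.2 hk.le hl.1.le hl.2.le
      have hwQ : w ∈ Qr d τ₁ := mem_Qr.2
        ⟨⟨(mem_Qr.1 hzQ').1.1.trans hlt.le, hl.1.le⟩, hl.2.le⟩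
      have c2 := (abs_le.1 (hψ k w hwQ)).2
      have : ψ k (w.1, w.2) = ψ k w := rfl
      linarith
  intro w hw hle
  rcases hle.lt_or_eq with h | h
  · exact key w hw h
  · have hw1 : w.1 < 1 := h ▸ (mem_Cy.1 hzC).1.2
    have hcon : Tendsto (fun t => φ (t, w.2)) (𝓝[>] w.1) (𝓝 (φ w)) := by
      have c1 : Tendsto (fun t : ℝ => ((t, w.2) : V d)) (𝓝[>] w.1) (𝓝[Cb d] w) := by
        refine tendsto_nhdsWithin_iff.2 ⟨?_, ?_⟩
        · exact (Continuous.tendsto (by fun_prop : Continuous fun t : ℝ => ((t, w.2) : V d)) w.1).mono_left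
            nhdsWithin_le_nhds
        · filter_upwards [Ioc_mem_nhdsGT hw1] with t ht
          rw [mem_Cb] at hw ⊢
          exact ⟨⟨hw.1.1.trans ht.1.le, ht.2⟩, hw.2⟩
      exact (hc w hw).tendsto.comp c1
    refine ge_of_tendsto hcon ?_
    filter_upwards [Ioc_mem_nhdsGT hw1] with t ht
    refine key (t, w.2) ?_ (h ▸ ht.1)
    rw [mem_Cb] at hw ⊢
    exact ⟨⟨hw.1.1.trans ht.1.le, ht.2⟩, hw.2⟩

section
variable {φ φt : V d → ℝ} {dφ : V d → E d} {d2φ : V d → Matrix (Fin d) (Fin d) ℝ}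

lemma appr_contact (h : Reg φ φt dφ d2φ) {τ R τ₁ : ℝ} (hτ : 0 < τ) (h0 : 0 < τ₁) (h01 : τ₁ ≤ τ)
    (hlay : ∀ σ s, Adm φ τ R σ s → ∀ w ∈ Cb d, s ≤ w.1 →
      (1 - τ₁ ≤ w.1 ∨ 1 - τ₁ ≤ ‖w.2‖) → ell σ w.2 + τ / 2 ≤ φ w)
    {K U : Set (V d)} (hK : IsCompact K) (hKA : ∀ σ ∈ K, ∃ s, Adm φ τ R σ s)
    (hU : IsOpen U) (hUc : ∀ σ ∈ K, ∀ z, Contact φ σ z → z ∈ U) :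
    ∀ᶠ n in atTop, K ⊆ leg (appr τ₁ φ n) '' {z ∈ U ∩ Qr d τ₁ | 0 ≤ pT (appr τ₁ φ n) z ∧
      (hess (appr τ₁ φ n) z).PosSemidef} := by
  set ψ := appr τ₁ φ with hψdef
  have hsm := fun n => appr_contDiff h h0 n
  -- the contact predicate
  let P : ℕ → V d → V d → Prop := fun n σ z => z ∈ Qr d τ₁ ∧ (∃ s ≤ z.1, Adm φ τ R σ s) ∧
    z.1 < 1 - τ₁ ∧ ‖z.2‖ < 1 - τ₁ ∧ ψ n z = ell σ z.2 ∧
      ∀ t x, z.1 ≤ t → t ≤ 1 - τ₁ → ‖x‖ ≤ 1 - τ₁ → ell σ x ≤ ψ n (t, x)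
  have hA : ∀ᶠ n in atTop, ∀ σ ∈ K, ∃ z, P n σ z := by
    filter_upwards [appr_unif h h0 (show 0 < τ / 4 by positivity)] with n hn σ hσ
    obtain ⟨s, hs⟩ := hKA σ hσ
    obtain ⟨x, hx1, hx2⟩ := hs.low
    have hs0 : 0 ≤ s := hτ.le.trans hs.s0
    have hnl : ¬ (1 - τ₁ ≤ s ∨ 1 - τ₁ ≤ ‖x‖) := by
      intro hh
      have := hlay σ s hs (s, x) (mem_Cb.2 ⟨⟨hs0, hs.s1⟩, hx1⟩) le_rfl hh
      simp only at this
      linarith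
    push Not at hnl
    have hin : ∀ t x, s ≤ t → t ≤ 1 - τ₁ → ‖x‖ ≤ 1 - τ₁ → (t, x) ∈ Qr d τ₁ := fun t x h1 h2 h3 =>
      mem_Qr.2 ⟨⟨by have := hs.s0; simp only; linarith, h2⟩, h3⟩
    have hb : ∀ t x, s ≤ t → t ≤ 1 - τ₁ → ‖x‖ ≤ 1 - τ₁ → (1 - τ₁ ≤ t ∨ 1 - τ₁ ≤ ‖x‖) →
        ell σ x < ψ n (t, x) := by
      intro t x h1 h2 h3 h4
      have c1 := hlay σ s hs (t, x) (mem_Cb.2 ⟨⟨by simp only; linarith, by simp only; linarith⟩,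
        by simp only; linarith⟩) h1 h4
      have c2 := abs_le.1 (hn (t, x) (hin t x h1 h2 h3))
      simp only at c1
      linarith
    obtain ⟨z, z1, z2, z3, z4, z5⟩ := exists_contact (hsm n).continuous (σ := σ) (s := s)
      (T := 1 - τ₁) (r := 1 - τ₁) hnl.1.le
      ⟨x, hnl.2.le, by
        have c2 := abs_le.1 (hn (s, x) (hin s x le_rfl hnl.1.le hnl.2.le))
        linarith⟩
      (fun t x h1 h2 h3 => hb t x h1 h2 h3.le (Or.inr h3.ge))
      (fun x h3 => hb (1 - τ₁) x hnl.1.le le_rfl h3 (Or.inl le_rfl))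
    exact ⟨z, hin z.1 z.2 z1 z2.le z3.le, ⟨s, z1, hs⟩, z2, z3, z4, z5⟩
  have hB : ∀ᶠ n in atTop, ∀ σ ∈ K, ∀ z, P n σ z → z ∈ U := by
    by_contra hcon
    -- good subsequence
    have hfr : ∃ᶠ n in atTop, ∃ σ ∈ K, ∃ z, P n σ z ∧ z ∉ U := by
      rw [Filter.not_eventually] at hcon
      refine hcon.mono fun n hn => ?_
      push Not at hn
      exact hn
    have hstep : ∀ k : ℕ, ∃ n, (∀ z ∈ Qr d τ₁, |ψ n z - φ z| ≤ 1 / ((k : ℝ) + 1)) ∧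
        ∃ σ ∈ K, ∃ z, P n σ z ∧ z ∉ U := by
      intro k
      obtain ⟨n, h1, h2⟩ := (hfr.and_eventually
        (appr_unif h h0 (show 0 < 1 / ((k : ℝ) + 1) by positivity))).exists
      exact ⟨n, h2, h1⟩
    choose n hn σs hσK zs hP hzU using hstep
    have hcomp : IsCompact (K ×ˢ Qr d τ₁) := hK.prod (isCompact_Qr τ₁)
    obtain ⟨⟨σ, z⟩, hmem, θ, hθ, hlim⟩ := hcomp.tendsto_subseq (x := fun k => (σs k, zs k))
      (fun k => ⟨hσK k, (hP k).1⟩)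
    have hσl : Tendsto (fun k => σs (θ k)) atTop (𝓝 σ) := (continuous_fst.tendsto (σ, z)).comp hlim
    have hzl : Tendsto (fun k => zs (θ k)) atTop (𝓝 z) := (continuous_snd.tendsto (σ, z)).comp hlim
    have hct : Contact φ σ z := by
      refine limit_contact h.cont h0 (ψ := fun k => ψ (n (θ k))) (e := fun k => 1 / ((θ k : ℝ) + 1))
        (tendsto_one_div_add_atTop_nhds_zero_nat.comp hθ.tendsto_atTop)
        (fun k => hn (θ k)) hσl hzl (fun k => (hP _).1) ?_ (fun k => (hP _).2.2.2.2.1)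
        (fun k => (hP _).2.2.2.2.2)
      intro k w hw hle hor
      obtain ⟨s, hsz, hs⟩ := (hP (θ k)).2.1
      have := hlay _ s hs w hw (hsz.trans hle) hor
      linarith
    have hzU' : z ∈ Uᶜ := hU.isClosed_compl.mem_of_tendsto hzl (Eventually.of_forall fun k => hzU _)
    exact hzU' (hUc σ hmem.1 z hct)
  filter_upwards [hA, hB] with n h1 h2 σ hσ
  obtain ⟨z, hz⟩ := h1 σ hσ
  have hzU := h2 σ hσ z hz
  obtain ⟨z1, -, z2, z3, z4, z5⟩ := hz
  have := contact_smooth (hsm n) z4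
    (by
      have : ∀ᶠ x in 𝓝 z.2, ‖x‖ < 1 - τ₁ := continuous_norm.continuousAt.eventually (gt_mem_nhds z3)
      filter_upwards [this] with x hx using z5 z.1 x le_rfl z2.le hx.le)
    (by
      filter_upwards [Icc_mem_nhdsGE z2] with t ht using z5 t z.2 ht.1 ht.2 z3.le)
  exact ⟨z, ⟨⟨hzU, z1⟩, this.2⟩, this.1⟩

theorem area_lemma (h : Reg φ φt dφ d2φ) {δ : ℝ} (hδ : 0 < δ) {a : V d → Matrix (Fin d) (Fin d) ℝ}
    (ha : ∀ z, Ell δ (a z)) (has : ∀ z, (a z).IsSymm) (ham : ∀ i j, Measurable fun z => a z i j)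
    {τ R : ℝ} (hτ : 0 < τ) {S G : Set (V d)} (hS : MeasurableSet S) (hG : MeasurableSet G)
    (hadm : ∀ σ ∈ S, ∃ s, Adm φ τ R σ s) (hcon : ∀ σ ∈ S, ∀ z, Contact φ σ z → z ∈ G) :
    volume S ≤ ENNReal.ofReal (δ⁻¹ ^ d) *
      ∫⁻ z in G, ENNReal.ofReal (φt z + mdot (a z) (d2φ z)) ^ (d + 1) := by
  obtain ⟨τ₁, h0, h01, -, hlay⟩ := layer (R := R) h.cont hτ
  set g : V d → ℝ := fun z => φt z + mdot (a z) (d2φ z) with hg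
  have hgm : Measurable g := h.mt.add (by
    unfold mdot
    exact Finset.measurable_sum _ fun i _ => Finset.measurable_sum _
      fun j _ => (ham i j).mul (h.mxx i j))
  set C := ENNReal.ofReal (δ⁻¹ ^ d) with hC
  have hCt : C ≠ ⊤ := ENNReal.ofReal_ne_top
  set f : V d → ℝ≥0∞ := fun z => ENNReal.ofReal (g z) ^ (d + 1) with hf
  have hfm : Measurable f := hgm.ennreal_ofReal.pow_const _
  have hQm := measurableSet_Qr (d := d) τ₁
  have hQC := Qr_subset_Cy (d := d) h0
  set p : ℝ := (d : ℝ) + 1 with hp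
  have hp0 : 0 < p := by positivity
  have hp1 : 1 ≤ p := by simp [hp]
  have hpow : ∀ x : ℝ≥0∞, x ^ (d + 1) = x ^ p := fun x => by
    rw [← ENNReal.rpow_natCast]; push_cast; rfl
  -- finiteness
  have hgL : MemLp g (pp d) (volume.restrict (Qr d τ₁)) := by
    refine ⟨hgm.aestronglyMeasurable, ?_⟩
    refine (eLpNorm_comb hδ ha has ham _ φt h.mt (fun i j z => d2φ z i j) h.mxx).trans_lt ?_
    refine ENNReal.add_lt_top.2 ⟨(h.it _ (isCompact_Qr τ₁) hQC).2, ?_⟩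
    refine ENNReal.sum_lt_top.2 fun i _ => ENNReal.sum_lt_top.2 fun j _ => ?_
    exact ENNReal.mul_lt_top ENNReal.ofReal_lt_top (h.ixx _ (isCompact_Qr τ₁) hQC i j).2
  have hfin : ∫⁻ z in Qr d τ₁, f z ≠ ⊤ := by
    have h1 := hgL.2
    rw [eLpNorm_key hp0] at h1
    have h2 : ∫⁻ z in Qr d τ₁, ‖g z‖ₑ ^ p ≠ ⊤ := by
      intro hh
      rw [hh, ENNReal.top_rpow_of_pos (by positivity)] at h1
      exact absurd h1 (lt_irrefl _)
    refine ne_top_of_le_ne_top h2 (lintegral_mono fun z => ?_)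
    simp only [hf, hpow]
    gcongr
    exact Real.ofReal_le_enorm _
  set ν : Measure (V d) := (volume.restrict (Qr d τ₁)).withDensity f with hν
  have hνf : IsFiniteMeasure ν := isFiniteMeasure_withDensity hfin
  -- reduce to compact sets
  rw [hS.measure_eq_iSup_isCompact]
  refine iSup₂_le fun K hKS => iSup_le fun hK => ?_
  -- open sets
  have main : ∀ U : Set (V d), IsOpen U → G ⊆ U → volume K ≤ C * ν U := by
    intro U hU hGU
    have hev := appr_contact h hτ h0 h01 hlay hK (fun σ hσ => hadm σ (hKS hσ)) hU
      (fun σ hσ z hz => hGU (hcon σ (hKS hσ) z hz))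
    have hUQ : MeasurableSet (U ∩ Qr d τ₁) := hU.measurableSet.inter hQm
    have hνU : ν U = ∫⁻ z in U ∩ Qr d τ₁, f z := by
      rw [hν, withDensity_apply _ hU.measurableSet, Measure.restrict_restrict hU.measurableSet]
    have hlim := appr_Lp h hδ ha has ham h0
    have hstep : ∀ᶠ n in atTop, volume K ^ (1 / p) ≤ C ^ (1 / p) * ((ν U) ^ (1 / p) +
        eLpNorm (fun z => (pT (appr τ₁ φ n) z + mdot (a z) (hess (appr τ₁ φ n) z))
        - (φt z + mdot (a z) (d2φ z))) (pp d) (volume.restrict (Qr d τ₁))) := by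
      filter_upwards [hev] with n hn
      set gn : V d → ℝ := fun z => pT (appr τ₁ φ n) z + mdot (a z) (hess (appr τ₁ φ n) z) with hgn
      have hsm := appr_contDiff h h0 n
      have hgnm : Measurable gn := (pT_contDiff hsm).continuous.measurable.add (by
        unfold mdot
        exact Finset.measurable_sum _ fun i _ => Finset.measurable_sum _
          fun j _ => (ham i j).mul (hess_continuous hsm i j).measurable)
      have h1 := (measure_mono hn).trans (area_smooth hδ ha hsm hUQ)
      rw [lintegral_const_mul _ (hgnm.ennreal_ofReal.pow_const _)] at h1
      have h2 : (∫⁻ z in U ∩ Qr d τ₁, ENNReal.ofReal (gn z) ^ (d + 1)) ^ (1 / p) ≤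
          (ν U) ^ (1 / p) + eLpNorm (fun z => gn z - g z) (pp d) (volume.restrict (Qr d τ₁)) := by
        calc _ ≤ (∫⁻ z in U ∩ Qr d τ₁, ((fun z => ENNReal.ofReal (g z))
              + fun z => ‖gn z - g z‖ₑ) z ^ p) ^ (1 / p) := by
              refine ENNReal.rpow_le_rpow (lintegral_mono fun z => ?_) (by positivity)
              rw [hpow]
              refine ENNReal.rpow_le_rpow ?_ hp0.le
              simp only [Pi.add_apply]
              calc ENNReal.ofReal (gn z) = ENNReal.ofReal (g z + (gn z - g z)) := by ring_nf
                _ ≤ ENNReal.ofReal (g z) + ENNReal.ofReal (gn z - g z) := ENNReal.ofReal_add_le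
                _ ≤ _ := by gcongr; exact Real.ofReal_le_enorm _
          _ ≤ (∫⁻ z in U ∩ Qr d τ₁, ENNReal.ofReal (g z) ^ p) ^ (1 / p)
              + (∫⁻ z in U ∩ Qr d τ₁, ‖gn z - g z‖ₑ ^ p) ^ (1 / p) :=
              ENNReal.lintegral_Lp_add_le hgm.ennreal_ofReal.aemeasurable
                (hgnm.sub hgm).enorm.aemeasurable hp1
          _ ≤ _ := by
              rw [hνU, eLpNorm_key hp0]
              refine add_le_add (le_of_eq ?_) (ENNReal.rpow_le_rpow
                (lintegral_mono_set inter_subset_right) (by positivity))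
              simp only [hf, hpow]
      calc volume K ^ (1 / p) ≤ (C * ∫⁻ z in U ∩ Qr d τ₁, ENNReal.ofReal (gn z) ^ (d + 1)) ^ (1 / p) :=
            ENNReal.rpow_le_rpow h1 (by positivity)
        _ = C ^ (1 / p) * (∫⁻ z in U ∩ Qr d τ₁, ENNReal.ofReal (gn z) ^ (d + 1)) ^ (1 / p) :=
            ENNReal.mul_rpow_of_nonneg _ _ (by positivity)
        _ ≤ _ := by gcongr
    have hl2 : Tendsto (fun n => C ^ (1 / p) * ((ν U) ^ (1 / p) +
        eLpNorm (fun z => (pT (appr τ₁ φ n) z + mdot (a z) (hess (appr τ₁ φ n) z))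
        - (φt z + mdot (a z) (d2φ z))) (pp d) (volume.restrict (Qr d τ₁)))) atTop
        (𝓝 (C ^ (1 / p) * ((ν U) ^ (1 / p) + 0))) :=
      ENNReal.Tendsto.const_mul (tendsto_const_nhds.add hlim)
        (Or.inr (ENNReal.rpow_ne_top_of_nonneg (by positivity) hCt))
    have h3 := ge_of_tendsto hl2 hstep
    rw [add_zero, ← ENNReal.mul_rpow_of_nonneg _ _ (by positivity : 0 ≤ 1 / p)] at h3
    exact (ENNReal.rpow_le_rpow_iff (by positivity)).1 h3
  have hνG : ν G ≤ ∫⁻ z in G, f z := by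
    rw [hν, withDensity_apply _ hG, Measure.restrict_restrict hG]
    exact lintegral_mono_set inter_subset_left
  have h4 : volume K ≤ C * ν G := by
    have hinf := G.measure_eq_iInf_isOpen ν
    rw [hinf, ENNReal.mul_iInf_of_ne ?_ hCt]
    · refine le_iInf fun U => ?_
      rw [ENNReal.mul_iInf_of_ne ?_ hCt]
      · refine le_iInf fun hGU => ?_
        rw [ENNReal.mul_iInf_of_ne ?_ hCt]
        · exact le_iInf fun hU => main U hU hGU
        · simp [hC]; positivity
      · simp [hC]; positivity
    · simp [hC]; positivity
  exact h4.trans (by gcongr)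

end
end PGE

namespace PGE
open Filter Topology
variable {d : ℕ}

/-! ## Consequences of the area lemma -/

section
variable {φ φt : V d → ℝ} {dφ : V d → E d} {d2φ : V d → Matrix (Fin d) (Fin d) ℝ}

lemma touch_du (h : Reg φ φt dφ d2φ) {σ z : V d} (hz : z ∈ Cy d) (h0 : φ z = ell σ z.2)
    (h1 : ∀ x, ‖x‖ ≤ 1 → ell σ x ≤ φ (z.1, x)) : dφ z = σ.2 := by
  ext i
  have hl := h.hx z hz i
  unfold HasLineDerivAt at hl
  have a2 : HasDerivAt (fun r : ℝ => ell σ (z.2 + r • bs i)) (σ.2 i) 0 := by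
    unfold ell
    have hl : HasDerivAt (fun r : ℝ => z.2 + r • bs i) (bs i) 0 := by
      simpa using ((hasDerivAt_id (0 : ℝ)).smul_const (bs i)).const_add z.2
    have := ((hasDerivAt_const (0 : ℝ) σ.2).inner ℝ hl).const_add σ.1
    simpa [bs, EuclideanSpace.inner_single_right] using this
  have a3 := hl.sub a2
  have hmin : IsLocalMin ((fun t : ℝ => φ (z + t • ((0 : ℝ), bs i)))
      - fun r : ℝ => ell σ (z.2 + r • bs i)) 0 := by
    have hc : Tendsto (fun r : ℝ => ‖z.2 + r • bs i‖) (𝓝 0) (𝓝 ‖z.2‖) := by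
      have : Continuous fun r : ℝ => ‖z.2 + r • bs i‖ := by fun_prop
      simpa using this.tendsto 0
    filter_upwards [hc.eventually (gt_mem_nhds (mem_Cy.1 hz).2)] with r hr
    have e : z + r • ((0 : ℝ), bs i) = (z.1, z.2 + r • bs i) := by ext <;> simp
    simp only [Pi.sub_apply, e, zero_smul, add_zero]
    have := h1 _ hr.le
    linarith
  have := hmin.hasDerivAt_eq_zero a3
  linarith

lemma contact_du (h : Reg φ φt dφ d2φ) {σ z : V d} (hc : Contact φ σ z) : dφ z = σ.2 := by
  refine touch_du h hc.1 hc.2.1 fun x hx => hc.2.2 (z.1, x) ?_ le_rfl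
  have := mem_Cy.1 hc.1
  exact mem_Cb.2 ⟨⟨this.1.1.le, this.1.2.le⟩, hx⟩

lemma add_pow_le' (x y : ℝ≥0∞) (n : ℕ) : (x + y) ^ n ≤ 2 ^ n * (x ^ n + y ^ n) := by
  have h1 : x + y ≤ 2 * max x y := by
    rw [two_mul]; exact add_le_add (le_max_left _ _) (le_max_right _ _)
  calc (x + y) ^ n ≤ (2 * max x y) ^ n := by gcongr
    _ = 2 ^ n * (max x y) ^ n := by rw [mul_pow]
    _ ≤ _ := by
      gcongr
      rcases le_total x y with h | h
      · rw [max_eq_right h]; exact le_add_self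
      · rw [max_eq_left h]; exact le_self_add

theorem area_int (h : Reg φ φt dφ d2φ) {δ : ℝ} (hδ : 0 < δ) {a : V d → Matrix (Fin d) (Fin d) ℝ}
    (ha : ∀ z, Ell δ (a z)) (has : ∀ z, (a z).IsSymm) (ham : ∀ i j, Measurable fun z => a z i j)
    {τ R : ℝ} (hτ : 0 < τ) {S G : Set (V d)} (hS : MeasurableSet S) (hG : MeasurableSet G)
    (hadm : ∀ σ ∈ S, ∃ s, Adm φ τ R σ s) (hcon : ∀ σ ∈ S, ∀ z, Contact φ σ z → z ∈ G)
    (hGC : G ⊆ Cy d) {f : V d → ℝ} (hf : Measurable f) {F κ B : ℝ} (hκ : 0 ≤ κ)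
    (hF : ∫⁻ z in Cy d, ENNReal.ofReal |f z| ^ (d + 1) ≤ ENNReal.ofReal F ^ (d + 1))
    (hle : ∀ z ∈ G, φt z + mdot (a z) (d2φ z) ≤ κ * |f z| + B) :
    volume S ≤ ENNReal.ofReal (δ⁻¹ ^ d * 2 ^ (d + 1)) *
      (ENNReal.ofReal (κ * F) ^ (d + 1) + ENNReal.ofReal B ^ (d + 1) * volume G) := by
  refine (area_lemma h hδ ha has ham hτ hS hG hadm hcon).trans ?_
  rw [ENNReal.ofReal_mul (by positivity), mul_assoc]
  gcongr
  have hm1 : Measurable fun z => ENNReal.ofReal |f z| ^ (d + 1) :=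
    (hf.abs.ennreal_ofReal).pow_const _
  calc ∫⁻ z in G, ENNReal.ofReal (φt z + mdot (a z) (d2φ z)) ^ (d + 1)
      ≤ ∫⁻ z in G, 2 ^ (d + 1) * (ENNReal.ofReal κ ^ (d + 1) * ENNReal.ofReal |f z| ^ (d + 1)
          + ENNReal.ofReal B ^ (d + 1)) := by
        refine setLIntegral_mono' hG fun z hz => ?_
        rw [← mul_pow, ← ENNReal.ofReal_mul hκ]
        refine le_trans ?_ (add_pow_le' _ _ _)
        gcongr
        exact (ENNReal.ofReal_le_ofReal (hle z hz)).trans ENNReal.ofReal_add_le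
    _ = 2 ^ (d + 1) * (ENNReal.ofReal κ ^ (d + 1) * (∫⁻ z in G, ENNReal.ofReal |f z| ^ (d + 1))
          + ENNReal.ofReal B ^ (d + 1) * volume G) := by
        rw [lintegral_const_mul _ (by fun_prop), lintegral_add_right _ measurable_const,
          lintegral_const_mul _ hm1]
        simp
    _ ≤ _ := by
        rw [ENNReal.ofReal_pow (by norm_num), ENNReal.ofReal_ofNat, ENNReal.ofReal_mul hκ, mul_pow]
        gcongr
        exact (lintegral_mono_set hGC).trans hF

lemma vol_prod_ball (s : Set ℝ) (x : E d) {r : ℝ} (hr : 0 < r) :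
    volume (s ×ˢ Metric.ball x r : Set (V d)) =
      volume s * (ENNReal.ofReal (r ^ d) * volume (Metric.ball (0 : E d) 1)) := by
  have : (volume : Measure (V d)) = (volume : Measure ℝ).prod (volume : Measure (E d)) := rfl
  rw [this, Measure.prod_prod, Measure.addHaar_ball_of_pos _ _ hr]
  simp

/-- volume of the unit ball -/
def om (d : ℕ) : ℝ := (volume (Metric.ball (0 : E d) 1)).toReal
lemma om_pos : 0 < om d := ENNReal.toReal_pos
  (Metric.measure_ball_pos _ _ one_pos).ne' measure_ball_lt_top.ne
lemma ofReal_om : ENNReal.ofReal (om d) = volume (Metric.ball (0 : E d) 1) :=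
  ENNReal.ofReal_toReal measure_ball_lt_top.ne
lemma vol_Cy : volume (Cy d) = ENNReal.ofReal (om d) := by
  rw [Cy, vol_prod_ball _ _ one_pos, ofReal_om]; simp

/-- the operator -/
def Lop (a : V d → Matrix (Fin d) (Fin d) ℝ) (b : V d → E d) (c : V d → ℝ)
    (u ut : V d → ℝ) (du : V d → E d) (d2u : V d → Matrix (Fin d) (Fin d) ℝ) (z : V d) : ℝ :=
  ut z + mdot (a z) (d2u z) + inner ℝ (b z) (du z) - c z * u z

structure Coef (δ K : ℝ) (a : V d → Matrix (Fin d) (Fin d) ℝ) (b : V d → E d) (c : V d → ℝ) : Prop where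
  ha : ∀ z, Ell δ (a z)
  has : ∀ z, (a z).IsSymm
  ham : ∀ i j, Measurable fun z => a z i j
  hbm : ∀ i, Measurable fun z => b z i
  hcm : Measurable c
  hbc : ∀ z, ‖b z‖ + c z ≤ K
  hc0 : ∀ z, 0 ≤ c z

lemma measurable_E {g : V d → E d} (h : ∀ i, Measurable fun z => g z i) : Measurable g := by
  have : g = fun z => WithLp.toLp 2 (fun i => g z i) := rfl
  rw [this]
  exact (WithLp.measurable_toLp 2 _).comp (measurable_pi_lambda _ h)

lemma Lop_measurable (h : Reg φ φt dφ d2φ) {δ K : ℝ} {a : V d → Matrix (Fin d) (Fin d) ℝ}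
    {b : V d → E d} {c : V d → ℝ} (hC : Coef δ K a b c) : Measurable (Lop a b c φ φt dφ d2φ) := by
  have h1 : Measurable fun z => mdot (a z) (d2φ z) := by
    unfold mdot
    exact Finset.measurable_sum _ fun i _ => Finset.measurable_sum _
      fun j _ => (hC.ham i j).mul (h.mxx i j)
  have h2 : Measurable fun z => inner ℝ (b z) (dφ z) :=
    (measurable_E hC.hbm).inner (measurable_E h.mx)
  exact ((h.mt.add h1).add h2).sub (hC.hcm.mul h.m0)

/-- linear combinations with `|x|^2/2 + t` -/
lemma Reg.lin (h : Reg φ φt dφ d2φ) (k l : ℝ) :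
    Reg (fun z => k * φ z + l * (‖z.2‖ ^ 2 / 2 + z.1)) (fun z => k * φt z + l)
      (fun z => k • dφ z + l • z.2) (fun z => k • d2φ z + l • (1 : Matrix (Fin d) (Fin d) ℝ)) := by
  have hfin : ∀ G : Set (V d), IsCompact G → IsFiniteMeasure (volume.restrict G) := fun G hG =>
    ⟨by simpa using hG.measure_lt_top⟩
  refine ⟨?_, ?_, ?_, ?_, ?_, ?_, ?_, ?_, ?_, ?_, ?_⟩
  · exact (h.m0.const_mul k).add (Continuous.measurable (by fun_prop))
  · exact (h.mt.const_mul k).add_const l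
  · intro i
    have : Measurable fun z : V d => l * z.2 i := Continuous.measurable (by fun_prop)
    exact ((h.mx i).const_mul k).add this
  · intro i j
    simpa using ((h.mxx i j).const_mul k).add_const (l * (1 : Matrix (Fin d) (Fin d) ℝ) i j)
  · exact (continuousOn_const.mul h.cont).add (Continuous.continuousOn (by fun_prop))
  · intro z hz
    have h1 := (h.ht z hz)
    have h2 : HasLineDerivAt ℝ (fun z : V d => ‖z.2‖ ^ 2 / 2 + z.1) 1 z ((1 : ℝ), (0 : E d)) := by
      unfold HasLineDerivAt
      simpa using ((hasDerivAt_id (0 : ℝ)).const_add z.1).const_add (‖z.2‖ ^ 2 / 2)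
    unfold HasLineDerivAt at *
    have h3 := h2.const_mul l
    rw [mul_one] at h3
    exact (h1.const_mul k).add h3
  · intro z hz i
    have h1 := (h.hx z hz i)
    have h2 : HasLineDerivAt ℝ (fun z : V d => ‖z.2‖ ^ 2 / 2 + z.1) (z.2 i) z ((0 : ℝ), bs i) := by
      unfold HasLineDerivAt
      have e : HasDerivAt (fun t : ℝ => z.2 + t • bs i) (bs i) 0 := by
        simpa using ((hasDerivAt_id (0 : ℝ)).smul_const (bs i)).const_add z.2
      have := (e.norm_sq.div_const 2).add_const z.1
      simpa [bs, EuclideanSpace.inner_single_right] using this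
    unfold HasLineDerivAt at *
    exact (h1.const_mul k).add (h2.const_mul l)
  · intro z hz i j
    have h1 := (h.hxx z hz i j)
    have h2 : HasLineDerivAt ℝ (fun z : V d => z.2 i) ((1 : Matrix (Fin d) (Fin d) ℝ) i j) z
        ((0 : ℝ), bs j) := by
      unfold HasLineDerivAt
      have := ((hasDerivAt_id (0 : ℝ)).mul_const (bs j i)).const_add (z.2 i)
      have e : (bs j : E d) i = (1 : Matrix (Fin d) (Fin d) ℝ) i j := by
        simp [bs, Matrix.one_apply]
      rw [e] at this
      simpa [← e] using this
    unfold HasLineDerivAt at *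
    exact (h1.const_mul k).add (h2.const_mul l)
  · intro G hG hGC
    have := hfin G hG
    exact ((h.it G hG hGC).const_mul k).add (memLp_const l)
  · intro G hG hGC i
    have := hfin G hG
    have h2 : MemLp (fun z : V d => l * z.2 i) (pp d) (volume.restrict G) := by
      refine MemLp.of_bound (C := |l|) (Continuous.aestronglyMeasurable (by fun_prop)) ?_
      filter_upwards [ae_restrict_mem hG.measurableSet] with z hz
      have h3 := (mem_Cy.1 (hGC hz)).2
      have h4 := PiLp.norm_apply_le z.2 i
      rw [norm_mul, Real.norm_eq_abs]
      exact mul_le_of_le_one_right (abs_nonneg _) (h4.trans h3.le)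
    exact ((h.ix G hG hGC i).const_mul k).add h2
  · intro G hG hGC i j
    have := hfin G hG
    exact ((h.ixx G hG hGC i j).const_mul k).add
      (memLp_const (l * (1 : Matrix (Fin d) (Fin d) ℝ) i j))

end
end PGE

namespace PGE
open Filter Topology
variable {d : ℕ}

/-! ## The sup bound (Aleksandrov-Bakelman-Pucci-Krylov-Tso) -/

lemma abs_inner_le {σ x : E d} {r : ℝ} (h : ‖σ‖ ≤ r) (hx : ‖x‖ ≤ 1) : |inner ℝ σ x| ≤ r := by
  refine (abs_real_inner_le_norm σ x).trans ?_
  have := norm_nonneg σ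
  have := norm_nonneg x
  nlinarith

section
variable {u ut : V d → ℝ} {du : V d → E d} {d2u : V d → Matrix (Fin d) (Fin d) ℝ}
  {δ K : ℝ} {a : V d → Matrix (Fin d) (Fin d) ℝ} {b : V d → E d} {c : V d → ℝ}

lemma abp_pos (hδ0 : 0 < δ) (hK : 0 ≤ K) (hC : Coef δ K a b c)
    (h : Reg u ut du d2u) {F : ℝ} (hF0 : 0 ≤ F)
    (hF : ∫⁻ z in Cy d, ENNReal.ofReal |Lop a b c u ut du d2u z| ^ (d + 1) ≤ ENNReal.ofReal F ^ (d + 1))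
    {M0 : ℝ} (hM0 : 0 ≤ M0) (hlat : ∀ z ∈ Cb d, ‖z.2‖ = 1 → -M0 ≤ u z)
    (htop : ∀ z ∈ Cb d, z.1 = 1 → -M0 ≤ u z) {z0 : V d} (hz0 : z0 ∈ Cb d) (hz1 : 0 < z0.1)
    {m ρ : ℝ} (hm : m = -M0 - u z0) (hm0 : 0 < m) (hρ0 : 0 < ρ) (hρ : ρ ≤ 1 / 8) :
    m / 4 * ((ρ * m) ^ d * om d) ≤ δ⁻¹ ^ d * 2 ^ (d + 1) * (F ^ (d + 1) + (K * (ρ * m)) ^ (d + 1) * om d) := by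
  have hρm : ρ * m ≤ m / 8 := by nlinarith
  have hρm0 : 0 < ρ * m := by positivity
  set τ := min (m / 8) z0.1 with hτ
  have hτ0 : 0 < τ := lt_min (by positivity) hz1
  have hτ1 : τ ≤ m / 8 := min_le_left _ _
  set S : Set (V d) := Set.Ioo (-M0 - 3 * m / 4) (-M0 - m / 2) ×ˢ Metric.ball (0 : E d) (ρ * m) with hS
  set G : Set (V d) := {z | z ∈ Cy d ∧ u z ≤ 0 ∧ ‖du z‖ ≤ ρ * m} with hG
  have hmS : MeasurableSet S := measurableSet_Ioo.prod Metric.isOpen_ball.measurableSet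
  have hmG : MeasurableSet G :=
    isOpen_Cy.measurableSet.inter ((measurableSet_le h.m0 measurable_const).inter
      (measurableSet_le (measurable_E h.mx).norm measurable_const))
  have hSm : ∀ σ ∈ S, (-M0 - 3 * m / 4 < σ.1 ∧ σ.1 < -M0 - m / 2) ∧ ‖σ.2‖ ≤ ρ * m := by
    intro σ hσ
    have h2 := hσ.2
    rw [mem_ball_zero_iff] at h2
    exact ⟨hσ.1, h2.le⟩
  have hell : ∀ σ ∈ S, ∀ x : E d, ‖x‖ ≤ 1 → |ell σ x - σ.1| ≤ m / 8 := by
    intro σ hσ x hx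
    have := abs_inner_le (hSm σ hσ).2 hx
    simp only [ell, add_sub_cancel_left]
    exact this.trans hρm
  have key := area_int (τ := τ) (R := ρ * m) (S := S) (G := G) h hδ0 hC.ha hC.has hC.ham hτ0 hmS hmG
    ?_ ?_ (fun z hz => hz.1) (Lop_measurable h hC) (F := F) (κ := 1) (B := K * (ρ * m)) zero_le_one hF ?_
  · have hv : volume S = ENNReal.ofReal (m / 4 * ((ρ * m) ^ d * om d)) := by
      rw [hS, vol_prod_ball _ _ hρm0, ← ofReal_om, Real.volume_Ioo,
        ENNReal.ofReal_mul (by positivity), ENNReal.ofReal_mul (by positivity)]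
      congr 2; ring
    have hvG : volume G ≤ ENNReal.ofReal (om d) := by
      rw [← vol_Cy]; exact measure_mono fun z hz => hz.1
    rw [hv] at key
    have k2 : ENNReal.ofReal (m / 4 * ((ρ * m) ^ d * om d)) ≤
        ENNReal.ofReal (δ⁻¹ ^ d * 2 ^ (d + 1) * (F ^ (d + 1) + (K * (ρ * m)) ^ (d + 1) * om d)) := by
      refine key.trans ?_
      have := om_pos (d := d)
      rw [ENNReal.ofReal_mul (q := _ + _) (by positivity), ENNReal.ofReal_add (by positivity) (by positivity),
        ENNReal.ofReal_mul (q := om d) (by positivity), one_mul, ENNReal.ofReal_pow hF0,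
        ENNReal.ofReal_pow (by positivity : 0 ≤ K * (ρ * m))]
      gcongr
    have := om_pos (d := d)
    exact (ENNReal.ofReal_le_ofReal_iff (by positivity)).1 k2
  · intro σ hσ
    have h1 := hSm σ hσ
    have h2 := hell σ hσ
    rw [mem_Cb] at hz0
    refine ⟨z0.1, h1.2, min_le_right _ _, hz0.1.2, ⟨z0.2, hz0.2, ?_⟩, ?_, ?_⟩
    · have := abs_le.1 (h2 z0.2 hz0.2)
      have e : u (z0.1, z0.2) = u z0 := rfl
      linarith
    · intro t x ht ht1 hx
      have := abs_le.1 (h2 x hx.le)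
      have := hlat (t, x) (mem_Cb.2 ⟨⟨hz1.le.trans ht, ht1⟩, hx.le⟩) hx
      linarith
    · intro x hx
      have := abs_le.1 (h2 x hx)
      have := htop (1, x) (mem_Cb.2 ⟨⟨zero_le_one, le_rfl⟩, hx⟩) rfl
      linarith
  · intro σ hσ z hz
    have h1 := hSm σ hσ
    refine ⟨hz.1, ?_, ?_⟩
    · rw [hz.2.1]
      have := abs_le.1 (hell σ hσ z.2 (mem_Cy.1 hz.1).2.le)
      linarith
    · rw [contact_du h hz]; exact h1.2
  · intro z hz
    have h1 : ut z + mdot (a z) (d2u z) = Lop a b c u ut du d2u z - inner ℝ (b z) (du z) + c z * u z := by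
      simp only [Lop]; ring
    rw [h1]
    have h2 := le_abs_self (Lop a b c u ut du d2u z)
    have h3 : |inner ℝ (b z) (du z)| ≤ K * (ρ * m) := by
      refine (abs_real_inner_le_norm _ _).trans ?_
      have := hC.hbc z
      have := hC.hc0 z
      exact mul_le_mul (by linarith) hz.2.2 (norm_nonneg _) hK
    have h4 := (abs_le.1 h3).1
    have h5 : c z * u z ≤ 0 := mul_nonpos_of_nonneg_of_nonpos (hC.hc0 z) hz.2.1
    linarith
end

/-- the constant in the sup bound -/
theorem abp_low (d : ℕ) {δ K : ℝ} (hδ0 : 0 < δ) (hδ1 : δ < 1) (hK : 0 ≤ K) : ∃ N : ℝ, 1 ≤ N ∧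
    ∀ (a : V d → Matrix (Fin d) (Fin d) ℝ) (b : V d → E d) (c : V d → ℝ)
      (u ut : V d → ℝ) (du : V d → E d) (d2u : V d → Matrix (Fin d) (Fin d) ℝ),
      Coef δ K a b c → Reg u ut du d2u → ∀ F : ℝ, 0 ≤ F →
      ∫⁻ z in Cy d, ENNReal.ofReal |Lop a b c u ut du d2u z| ^ (d + 1) ≤ ENNReal.ofReal F ^ (d + 1) →
      ∀ M0 : ℝ, 0 ≤ M0 → (∀ z ∈ Cb d, ‖z.2‖ = 1 → -M0 ≤ u z) →
      (∀ z ∈ Cb d, z.1 = 1 → -M0 ≤ u z) → ∀ z ∈ Cb d, -M0 - N * F ≤ u z := by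
  set A : ℝ := δ⁻¹ ^ d * 2 ^ (d + 1) with hA
  have hA1 : 1 ≤ A := by
    have h1 : 1 ≤ δ⁻¹ ^ d := one_le_pow₀ ((one_le_inv₀ hδ0).2 hδ1.le)
    have h2 : (1 : ℝ) ≤ 2 ^ (d + 1) := one_le_pow₀ (by norm_num)
    nlinarith
  set ρ : ℝ := 1 / (8 * A * (K ^ (d + 1) + 1)) with hρ
  have hK1 : 0 ≤ K ^ (d + 1) := by positivity
  have hρ0 : 0 < ρ := by positivity
  have hρ1 : ρ ≤ 1 / 8 := by
    apply one_div_le_one_div_of_le (by norm_num)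
    nlinarith [mul_nonneg (by linarith : (0:ℝ) ≤ A - 1) hK1]
  have ho := om_pos (d := d)
  set N : ℝ := 1 + 8 * A / (ρ ^ d * om d) with hN
  have hN1 : 1 ≤ N := by have : 0 ≤ 8 * A / (ρ ^ d * om d) := by positivity
                         linarith
  refine ⟨N, hN1, ?_⟩
  intro a b c u ut du d2u hC h F hF0 hF M0 hM0 hlat htop
  have step : ∀ z ∈ Cb d, 0 < z.1 → -M0 - N * F ≤ u z := by
    intro z hz hz1
    by_contra hcon
    push Not at hcon
    have hNF : 0 ≤ N * F := by positivity
    set m := -M0 - u z with hm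
    have hmN : N * F < m := by linarith
    have hm0 : 0 < m := by linarith
    have key := abp_pos hδ0 hK hC h hF0 hF hM0 hlat htop hz hz1 hm hm0 hρ0 hρ1
    rw [← hA] at key
    have e1 : A * (K * (ρ * m)) ^ (d + 1) * om d ≤ m / 8 * ((ρ * m) ^ d * om d) := by
      have e2 : A * (K * (ρ * m)) ^ (d + 1) * om d = (A * K ^ (d + 1) * ρ) * m * ((ρ * m) ^ d * om d) := by
        rw [mul_pow K, pow_succ (ρ * m)]; ring
      have e3 : A * K ^ (d + 1) * ρ ≤ 1 / 8 := by
        rw [hρ, mul_one_div, div_le_div_iff₀ (by positivity) (by norm_num)]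
        nlinarith
      rw [e2]
      have : 0 ≤ m * ((ρ * m) ^ d * om d) := by positivity
      nlinarith
    have e4 : m / 8 * ((ρ * m) ^ d * om d) ≤ A * F ^ (d + 1) := by nlinarith
    have e5 : m ^ (d + 1) ≤ 8 * A / (ρ ^ d * om d) * F ^ (d + 1) := by
      rw [div_mul_eq_mul_div, le_div_iff₀ (by positivity)]
      rw [mul_pow] at e4
      rw [pow_succ]
      linarith
    have e6 : 8 * A / (ρ ^ d * om d) ≤ N ^ (d + 1) := by
      have : N ≤ N ^ (d + 1) := le_self_pow₀ hN1 (by omega)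
      linarith
    have e7 : m ^ (d + 1) ≤ (N * F) ^ (d + 1) := by
      rw [mul_pow]
      exact e5.trans (mul_le_mul_of_nonneg_right e6 (by positivity))
    have := pow_lt_pow_left₀ hmN hNF (by omega : d + 1 ≠ 0)
    linarith
  intro z hz
  rcases (mem_Cb.1 hz).1.1.lt_or_eq with h1 | h1
  · exact step z hz h1
  · have hz' := mem_Cb.1 hz
    set w : ℕ → V d := fun n => (1 / ((n : ℝ) + 1), z.2) with hw
    have hwC : ∀ n, w n ∈ Cb d := fun n => by
      refine mem_Cb.2 ⟨⟨by positivity, ?_⟩, hz'.2⟩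
      simp only [hw]
      rw [div_le_one (by positivity)]
      have : (0 : ℝ) ≤ n := by positivity
      linarith
    have ht : Tendsto w atTop (𝓝 z) := by
      have : z = (0, z.2) := by ext1 <;> simp [← h1]
      rw [this]
      exact (tendsto_one_div_add_atTop_nhds_zero_nat).prodMk_nhds tendsto_const_nhds
    have ht2 : Tendsto (fun n => u (w n)) atTop (𝓝 (u z)) :=
      (h.cont z hz).tendsto.comp (tendsto_nhdsWithin_iff.2 ⟨ht, Eventually.of_forall hwC⟩)
    exact ge_of_tendsto' ht2 fun n => step _ (hwC n) (by simp only [hw]; positivity)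

lemma Reg.neg {u ut : V d → ℝ} {du : V d → E d} {d2u : V d → Matrix (Fin d) (Fin d) ℝ}
    (h : Reg u ut du d2u) (k : ℝ) : Reg (fun z => k * u z) (fun z => k * ut z)
      (fun z => k • du z) (fun z => k • d2u z) := by
  simpa using h.lin k 0

lemma Lop_smul (k : ℝ) (a : V d → Matrix (Fin d) (Fin d) ℝ) (b : V d → E d) (c : V d → ℝ)
      (u ut : V d → ℝ) (du : V d → E d) (d2u : V d → Matrix (Fin d) (Fin d) ℝ) (z : V d) :
    Lop a b c (fun z => k * u z) (fun z => k * ut z) (fun z => k • du z) (fun z => k • d2u z) z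
      = k * Lop a b c u ut du d2u z := by
  have h1 : mdot (a z) (k • d2u z) = k * mdot (a z) (d2u z) := by
    simp only [mdot, Finset.mul_sum, Matrix.smul_apply, smul_eq_mul]
    refine Finset.sum_congr rfl fun i _ => Finset.sum_congr rfl fun j _ => by ring
  simp only [Lop, h1, inner_smul_right]
  ring

theorem abp (d : ℕ) {δ K : ℝ} (hδ0 : 0 < δ) (hδ1 : δ < 1) (hK : 0 ≤ K) : ∃ N : ℝ, 1 ≤ N ∧
    ∀ (a : V d → Matrix (Fin d) (Fin d) ℝ) (b : V d → E d) (c : V d → ℝ)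
      (u ut : V d → ℝ) (du : V d → E d) (d2u : V d → Matrix (Fin d) (Fin d) ℝ),
      Coef δ K a b c → Reg u ut du d2u → ∀ F : ℝ, 0 ≤ F →
      ∫⁻ z in Cy d, ENNReal.ofReal |Lop a b c u ut du d2u z| ^ (d + 1) ≤ ENNReal.ofReal F ^ (d + 1) →
      ∀ M0 : ℝ, 0 ≤ M0 → (∀ z ∈ Cb d, ‖z.2‖ = 1 → |u z| ≤ M0) →
      (∀ z ∈ Cb d, z.1 = 1 → |u z| ≤ M0) → ∀ z ∈ Cb d, |u z| ≤ M0 + N * F := by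
  obtain ⟨N, hN1, hN⟩ := abp_low d hδ0 hδ1 hK
  refine ⟨N, hN1, ?_⟩
  intro a b c u ut du d2u hC h F hF0 hF M0 hM0 hlat htop z hz
  have h1 := hN a b c u ut du d2u hC h F hF0 hF M0 hM0 (fun z hz hz1 => (abs_le.1 (hlat z hz hz1)).1)
    (fun z hz hz1 => (abs_le.1 (htop z hz hz1)).1) z hz
  have h2 := hN a b c _ _ _ _ hC (h.neg (-1)) F hF0 (by simp only [Lop_smul]; simpa only [neg_one_mul, abs_neg] using hF) M0 hM0
    (fun z hz hz1 => by linarith [(abs_le.1 (hlat z hz hz1)).2])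
    (fun z hz hz1 => by linarith [(abs_le.1 (htop z hz hz1)).2]) z hz
  rw [abs_le]
  constructor <;> linarith
end PGE

namespace PGE
open Filter Topology
variable {d : ℕ}

/-! ## The monotone lower transform -/

/-- the part of the closed cylinder above time `t` -/
def Cz (d : ℕ) (t : ℝ) : Set (V d) := {z | z ∈ Cb d ∧ min t 1 ≤ z.1}

/-- minimum of `φ - p.x` over the part of the cylinder above time `t` -/
def mm (φ : V d → ℝ) (t : ℝ) (p : E d) : ℝ := sInf ((fun z => φ z - inner ℝ p z.2) '' Cz d t)

def Opt (φ : V d → ℝ) (t : ℝ) (x p : E d) : Prop :=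
  ∀ p', mm φ t p' + inner ℝ x p' ≤ mm φ t p + inner ℝ x p

lemma top_mem_Cz (t : ℝ) {x : E d} (hx : ‖x‖ ≤ 1) : ((1 : ℝ), x) ∈ Cz d t :=
  ⟨mem_Cb.2 ⟨⟨zero_le_one, le_rfl⟩, hx⟩, min_le_right _ _⟩

section
variable {φ : V d → ℝ}

lemma mm_bdd (hφ : ContinuousOn φ (Cb d)) (t : ℝ) (p : E d) : BddBelow ((fun z => φ z - inner ℝ p z.2) '' Cz d t) := by
  have : ContinuousOn (fun z : V d => φ z - inner ℝ p z.2) (Cb d) :=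
    hφ.sub (Continuous.continuousOn (by fun_prop))
  exact (isCompact_Cb.bddBelow_image this).mono (image_mono fun z hz => hz.1)

lemma mm_le (hφ : ContinuousOn φ (Cb d)) {t : ℝ} {p : E d} {z : V d} (hz : z ∈ Cz d t) : mm φ t p ≤ φ z - inner ℝ p z.2 :=
  csInf_le (mm_bdd hφ t p) ⟨z, hz, rfl⟩

lemma le_mm {t : ℝ} {p : E d} {b : ℝ} (h : ∀ z ∈ Cz d t, b ≤ φ z - inner ℝ p z.2) : b ≤ mm φ t p := by
  refine le_csInf ⟨_, _, top_mem_Cz t (x := 0) (by simp), rfl⟩ ?_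
  rintro _ ⟨z, hz, rfl⟩
  exact h z hz

lemma mm_mono (hφ : ContinuousOn φ (Cb d)) {t t' : ℝ} (h : t ≤ t') (p : E d) : mm φ t p ≤ mm φ t' p :=
  le_mm fun _ hz => mm_le hφ ⟨hz.1, (min_le_min_right 1 h).trans hz.2⟩

lemma mm_lip (hφ : ContinuousOn φ (Cb d)) (t : ℝ) (p p' : E d) : mm φ t p ≤ mm φ t p' + ‖p - p'‖ := by
  have : mm φ t p - ‖p - p'‖ ≤ mm φ t p' := by
    refine le_mm fun z hz => ?_
    have h1 := mm_le (p := p) hφ hz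
    have h2 := abs_inner_le (le_refl ‖p - p'‖) (mem_Cb.1 hz.1).2
    rw [inner_sub_left] at h2
    have := abs_le.1 h2
    linarith
  linarith

lemma mm_concave (hφ : ContinuousOn φ (Cb d)) (t : ℝ) (p v : E d) {l : ℝ} (h0 : 0 ≤ l) (h1 : l ≤ 1) :
    (1 - l) * mm φ t p + l * mm φ t (p + v) ≤ mm φ t (p + l • v) := by
  refine le_mm fun z hz => ?_
  have e1 := mm_le (p := p) hφ hz
  have e2 := mm_le (p := p + v) hφ hz
  rw [inner_add_left] at e2
  rw [inner_add_left, real_inner_smul_left]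
  nlinarith [mul_le_mul_of_nonneg_left e1 (by linarith : 0 ≤ 1 - l), mul_le_mul_of_nonneg_left e2 h0]

lemma mm_upper (hφ : ContinuousOn φ (Cb d)) : ∃ C : ℝ, ∀ t p, mm φ t p ≤ C - ‖p‖ := by
  obtain ⟨C, hC⟩ := isCompact_Cb.bddAbove_image hφ
  refine ⟨C, fun t p => ?_⟩
  have hx : ‖(‖p‖)⁻¹ • p‖ ≤ 1 := by
    rw [norm_smul, norm_inv, norm_norm]
    exact inv_mul_le_one
  have h1 := mm_le (p := p) hφ (top_mem_Cz t hx)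
  have h2 := hC ⟨_, (top_mem_Cz t hx).1, rfl⟩
  rw [real_inner_smul_right, real_inner_self_eq_norm_sq] at h1
  have h3 : (‖p‖)⁻¹ * ‖p‖ ^ 2 = ‖p‖ := by
    rcases eq_or_ne ‖p‖ 0 with h | h
    · rw [h]; simp
    · field_simp
  rw [h3] at h1
  linarith

lemma mm_unif (hφ : ContinuousOn φ (Cb d)) {ε : ℝ} (hε : 0 < ε) : ∃ η > 0, ∀ t t' p, |t - t'| < η → mm φ t' p ≤ mm φ t p + ε := by
  have hu := isCompact_Cb.uniformContinuousOn_of_continuous hφ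
  obtain ⟨η, hη, h⟩ := Metric.uniformContinuousOn_iff.1 hu ε hε
  refine ⟨η, hη, fun t t' p htt => ?_⟩
  suffices mm φ t' p - ε ≤ mm φ t p by linarith
  refine le_mm fun z hz => ?_
  have hz1 := mem_Cb.1 hz.1
  set w : V d := (max z.1 (min t' 1), z.2) with hw
  have hwC : w ∈ Cz d t' := by
    refine ⟨mem_Cb.2 ⟨⟨hz1.1.1.trans (le_max_left _ _), max_le hz1.1.2 (min_le_right _ _)⟩, hz1.2⟩, le_max_right _ _⟩
  have hd : dist w z < η := by
    rw [Prod.dist_eq, hw]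
    simp only [dist_self]
    rw [max_eq_left dist_nonneg, Real.dist_eq, abs_of_nonneg (by simp)]
    have h1 := hz.2
    rw [abs_lt] at htt
    rcases le_total z.1 (min t' 1) with h2 | h2
    · rw [max_eq_right h2]
      rcases le_total t 1 with h3 | h3
      · rw [min_eq_left h3] at h1
        have := min_le_left t' 1
        linarith
      · rw [min_eq_right h3] at h1
        have := min_le_right t' 1
        linarith
    · rw [max_eq_left h2]; linarith
  have h4 := h w hwC.1 z hz.1 hd
  rw [Real.dist_eq, abs_lt] at h4
  have h5 := mm_le (p := p) hφ hwC
  have : w.2 = z.2 := rfl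
  rw [this] at h5
  linarith

lemma mm_cont (hφ : ContinuousOn φ (Cb d)) : Continuous fun q : V d => mm φ q.1 q.2 := by
  rw [Metric.continuous_iff]
  intro q ε hε
  obtain ⟨η, hη, h⟩ := mm_unif hφ (half_pos hε)
  refine ⟨min η (ε / 4), lt_min hη (by linarith), fun a ha => ?_⟩
  rw [Prod.dist_eq, max_lt_iff, lt_min_iff, lt_min_iff, Real.dist_eq, dist_eq_norm] at ha
  have h1 := h a.1 q.1 a.2 ha.1.1
  have h2 := h q.1 a.1 a.2 (by rw [abs_sub_comm]; exact ha.1.1)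
  have h3 := mm_lip hφ q.1 a.2 q.2
  have h4 := mm_lip hφ q.1 q.2 a.2
  rw [norm_sub_rev] at h4
  rw [Real.dist_eq, abs_lt]
  constructor <;> linarith

lemma mm_cont' (hφ : ContinuousOn φ (Cb d)) (t : ℝ) : Continuous fun p : E d => mm φ t p := by
  refine (LipschitzWith.of_le_add fun p p' => ?_).continuous
  rw [dist_eq_norm]
  exact mm_lip hφ t p p'

lemma prox_exists (hφ : ContinuousOn φ (Cb d)) (t : ℝ) (Q : E d) : ∃ x, Opt φ t x (Q - x) := by
  have hc : Continuous fun p : E d => mm φ t p - ‖p - Q‖ ^ 2 / 2 := by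
    have := mm_cont' hφ t
    fun_prop
  obtain ⟨p, hp, hmax⟩ := (isCompact_closedBall Q 2).exists_isMaxOn ⟨Q, by simp⟩ hc.continuousOn
  have hall : ∀ p', mm φ t p' - ‖p' - Q‖ ^ 2 / 2 ≤ mm φ t p - ‖p - Q‖ ^ 2 / 2 := by
    intro p'
    by_cases h : p' ∈ Metric.closedBall Q 2
    · exact hmax h
    · rw [mem_closedBall_iff_norm, not_le] at h
      have h1 : mm φ t Q - ‖Q - Q‖ ^ 2 / 2 ≤ mm φ t p - ‖p - Q‖ ^ 2 / 2 := hmax (by simp : Q ∈ Metric.closedBall Q 2)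
      have h2 := mm_lip hφ t p' Q
      simp at h1
      nlinarith
  refine ⟨Q - p, fun p' => ?_⟩
  rw [_root_.sub_sub_cancel]
  set v := p' - p with hv
  have hp' : p' = p + v := by rw [hv]; abel
  have key : ∀ l : ℝ, 0 < l → l ≤ 1 → mm φ t p' - mm φ t p - inner ℝ (p - Q) v ≤ l * (‖v‖ ^ 2 / 2) := by
    intro l h0 h1
    have e1 := mm_concave hφ t p v h0.le h1
    have e2 := hall (p + l • v)
    have e3 : ‖p + l • v - Q‖ ^ 2 = ‖p - Q‖ ^ 2 + 2 * (l * inner ℝ (p - Q) v) + l ^ 2 * ‖v‖ ^ 2 := by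
      have : p + l • v - Q = (p - Q) + l • v := by abel
      rw [this, norm_add_sq_real, real_inner_smul_right, norm_smul, mul_pow, Real.norm_eq_abs, sq_abs]
    rw [e3] at e2
    rw [← hp'] at e1
    have : l * (mm φ t p' - mm φ t p - inner ℝ (p - Q) v) ≤ l * (l * (‖v‖ ^ 2 / 2)) := by nlinarith
    exact le_of_mul_le_mul_left this h0
  have lim : mm φ t p' - mm φ t p - inner ℝ (p - Q) v ≤ 0 := by
    by_contra hcon
    push Not at hcon
    set D := mm φ t p' - mm φ t p - inner ℝ (p - Q) v
    have hn : 0 ≤ ‖v‖ ^ 2 / 2 := by positivity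
    have := key (min 1 (D / (2 * (‖v‖ ^ 2 / 2 + 1)))) (by positivity) (min_le_left _ _)
    have h2 : min 1 (D / (2 * (‖v‖ ^ 2 / 2 + 1))) * (‖v‖ ^ 2 / 2) ≤ D / 2 := by
      calc _ ≤ D / (2 * (‖v‖ ^ 2 / 2 + 1)) * (‖v‖ ^ 2 / 2) := by gcongr; exact min_le_right _ _
        _ ≤ D / (2 * (‖v‖ ^ 2 / 2 + 1)) * (‖v‖ ^ 2 / 2 + 1) := by gcongr; linarith
        _ = D / 2 := by field_simp
    linarith
  have e : inner ℝ (p - Q) v = inner ℝ (Q - p) p - inner ℝ (Q - p) p' := by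
    rw [hv, ← inner_sub_right, ← neg_sub Q p, inner_neg_left, ← inner_neg_right, neg_sub]
  linarith

lemma opt_exists (hφ : ContinuousOn φ (Cb d)) (t : ℝ) {x : E d} (hx : ‖x‖ < 1) : ∃ p, Opt φ t x p := by
  obtain ⟨C, hC⟩ := mm_upper hφ
  have hc : Continuous fun p : E d => mm φ t p + inner ℝ x p := by
    have := mm_cont' hφ t
    fun_prop
  set R := (C - mm φ t 0) / (1 - ‖x‖) with hR
  have h0 := hC t 0
  rw [norm_zero, sub_zero] at h0
  have hR0 : 0 ≤ R := div_nonneg (by linarith) (by linarith)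
  obtain ⟨p, hp, hmax⟩ := (isCompact_closedBall (0 : E d) R).exists_isMaxOn ⟨0, by simpa using hR0⟩ hc.continuousOn
  refine ⟨p, fun p' => ?_⟩
  by_cases h : p' ∈ Metric.closedBall (0 : E d) R
  · exact hmax h
  · rw [mem_closedBall_zero_iff, not_le, hR, div_lt_iff₀ (by linarith)] at h
    have h1 : mm φ t 0 + inner ℝ x (0 : E d) ≤ mm φ t p + inner ℝ x p :=
      hmax (by simpa using hR0 : (0 : E d) ∈ Metric.closedBall (0 : E d) R)
    rw [inner_zero_right, add_zero] at h1
    have h2 := hC t p'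
    have h3 := real_inner_le_norm x p'
    nlinarith

lemma opt_mono {t t' ε : ℝ} {x x' p p' : E d} (h : Opt φ t x p) (h' : Opt φ t' x' p')
    (h1 : mm φ t' p' ≤ mm φ t p' + ε) (h2 : mm φ t p ≤ mm φ t' p + ε) :
    ‖x - x'‖ ^ 2 ≤ ‖x - x'‖ * ‖(x + p) - (x' + p')‖ + 2 * ε := by
  have e1 := h p'
  have e2 := h' p
  have e3 := real_inner_le_norm (x - x') ((x + p) - (x' + p'))
  have e4 : inner ℝ (x - x') ((x + p) - (x' + p')) = ‖x - x'‖ ^ 2 + (inner ℝ x p - inner ℝ x p' - inner ℝ x' p + inner ℝ x' p') := by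
    have : (x + p) - (x' + p') = (x - x') + (p - p') := by abel
    rw [this, inner_add_right, real_inner_self_eq_norm_sq, inner_sub_left, inner_sub_right, inner_sub_right]
    ring
  linarith

end
end PGE

namespace PGE
open Filter Topology
variable {d : ℕ}

/-! ## The proximal map and its measure properties -/

section
variable {φ : V d → ℝ}

def XX (hφ : ContinuousOn φ (Cb d)) (z : V d) : E d := (prox_exists hφ z.1 ((2 : ℝ) • z.2)).choose

lemma XX_spec (hφ : ContinuousOn φ (Cb d)) (z : V d) :
    Opt φ z.1 (XX hφ z) ((2 : ℝ) • z.2 - XX hφ z) :=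
  (prox_exists hφ z.1 ((2 : ℝ) • z.2)).choose_spec

lemma XX_est (hφ : ContinuousOn φ (Cb d)) {z z' : V d} {ε : ℝ}
    (h : ∀ p, mm φ z.1 p ≤ mm φ z'.1 p + ε) (h' : ∀ p, mm φ z'.1 p ≤ mm φ z.1 p + ε) :
    ‖XX hφ z - XX hφ z'‖ ^ 2 ≤ ‖XX hφ z - XX hφ z'‖ * (2 * ‖z.2 - z'.2‖) + 2 * ε := by
  have := opt_mono (XX_spec hφ z) (XX_spec hφ z') (h' _) (h _)
  rwa [add_sub_cancel, add_sub_cancel, ← smul_sub, norm_smul, Real.norm_ofNat] at this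

lemma XX_lip (hφ : ContinuousOn φ (Cb d)) (t : ℝ) (P P' : E d) :
    ‖XX hφ (t, P) - XX hφ (t, P')‖ ≤ 2 * ‖P - P'‖ := by
  have := XX_est hφ (z := (t, P)) (z' := (t, P')) (ε := 0) (by simp) (by simp)
  simp only [mul_zero, add_zero, sq] at this
  rcases (norm_nonneg (XX hφ (t, P) - XX hφ (t, P'))).eq_or_lt with h | h
  · rw [← h]; positivity
  · exact le_of_mul_le_mul_left this h

lemma XX_unique (hφ : ContinuousOn φ (Cb d)) {t : ℝ} {x p : E d} (h : Opt φ t x p) :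
    XX hφ (t, (1 / 2 : ℝ) • (x + p)) = x := by
  have h1 := XX_spec hφ (t, (1 / 2 : ℝ) • (x + p))
  have := opt_mono (ε := 0) h1 h (by simp) (by simp)
  have e : (2 : ℝ) • ((1 / 2 : ℝ) • (x + p)) = x + p := by rw [smul_smul]; norm_num
  simp only [e, add_sub_cancel, sub_self, norm_zero, mul_zero, add_zero] at this
  have h3 : ‖XX hφ (t, (1 / 2 : ℝ) • (x + p)) - x‖ = 0 := by
    have := norm_nonneg (XX hφ (t, (1 / 2 : ℝ) • (x + p)) - x)
    nlinarith
  exact sub_eq_zero.1 (norm_eq_zero.1 h3)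

lemma XX_cont (hφ : ContinuousOn φ (Cb d)) : Continuous (XX hφ) := by
  rw [Metric.continuous_iff]
  intro q e he
  obtain ⟨η, hη, h⟩ := mm_unif hφ (ε := e ^ 2 / 8) (by positivity)
  refine ⟨min η (e / 4), lt_min hη (by linarith), fun a ha => ?_⟩
  rw [Prod.dist_eq, max_lt_iff, lt_min_iff, lt_min_iff, Real.dist_eq, dist_eq_norm] at ha
  have := XX_est hφ (z := a) (z' := q) (ε := e ^ 2 / 8)
    (fun p => h q.1 a.1 p (by rw [abs_sub_comm]; exact ha.1.1)) (fun p => h a.1 q.1 p ha.1.1)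
  rw [dist_eq_norm]
  by_contra hcon
  push Not at hcon
  have h2 := ha.2.2
  have h3 := norm_nonneg (a.2 - q.2)
  nlinarith

def HH (hφ : ContinuousOn φ (Cb d)) (z : V d) : ℝ :=
  (z.1 + mm φ z.1 ((2 : ℝ) • z.2 - XX hφ z) - ‖XX hφ z‖ ^ 2 / 2) / 2

lemma HH_cont (hφ : ContinuousOn φ (Cb d)) : Continuous (HH hφ) := by
  have h1 := XX_cont hφ
  have h2 : Continuous fun z : V d => ((z.1, (2 : ℝ) • z.2 - XX hφ z) : V d) := by fun_prop
  have h3 := Continuous.comp (mm_cont hφ) h2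
  simp only [Function.comp_def] at h3
  unfold HH
  fun_prop

lemma HH_mono (hφ : ContinuousOn φ (Cb d)) {t t' : ℝ} (h : t ≤ t') (P : E d) :
    (t' - t) / 2 ≤ HH hφ (t', P) - HH hφ (t, P) := by
  unfold HH
  have h1 := XX_spec hφ (t', P) ((2 : ℝ) • P - XX hφ (t, P))
  have h2 := mm_mono hφ h ((2 : ℝ) • P - XX hφ (t, P))
  simp only [inner_sub_right, real_inner_self_eq_norm_sq] at h1
  have h3 : 0 ≤ ‖XX hφ (t', P) - XX hφ (t, P)‖ ^ 2 := by positivity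
  rw [norm_sub_sq_real] at h3
  simp only at h1 ⊢
  linarith

lemma vol_lip {g : E d → E d} {k : NNReal} (h : LipschitzWith k g) (s : Set (E d)) :
    volume (g '' s) ≤ (k : ℝ≥0∞) ^ d * volume s := by
  have e := Measure.isAddLeftInvariant_eq_smul (volume : Measure (EuclideanSpace ℝ (Fin d))) (Measure.hausdorffMeasure (d : ℝ))
  have h1 := h.hausdorffMeasure_image_le (d := (d : ℝ)) (by positivity) s
  rw [e, Measure.smul_apply, Measure.smul_apply, ENNReal.smul_def, ENNReal.smul_def, smul_eq_mul, smul_eq_mul]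
  rw [ENNReal.rpow_natCast] at h1
  calc _ ≤ _ := mul_le_mul_right h1 _
    _ = _ := by ring

lemma vol_expand {g : ℝ → ℝ} (h : ∀ t t', t ≤ t' → (t' - t) / 2 ≤ g t' - g t) (s : Set ℝ) :
    volume s ≤ 2 * volume (g '' s) := by
  have ha : AntilipschitzWith 2 g := by
    refine AntilipschitzWith.of_le_mul_dist fun t t' => ?_
    rw [Real.dist_eq, Real.dist_eq]
    rcases le_total t t' with h1 | h1
    · have := h t t' h1
      rw [abs_of_nonpos (by linarith), abs_of_nonpos (by linarith)]
      norm_num; linarith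
    · have := h t' t h1
      rw [abs_of_nonneg (by linarith), abs_of_nonneg (by linarith)]
      norm_num; linarith
  have := ha.le_hausdorffMeasure_image (d := 1) zero_le_one s
  rw [hausdorffMeasure_real] at this
  simpa using this

/-- the set of supporting affine functions generated by `S` -/
def Sup (hφ : ContinuousOn φ (Cb d)) (S : Set (V d)) : Set (V d) :=
  (fun z : V d => (HH hφ z, z.2)) '' ((fun z : V d => (z.1, XX hφ z)) ⁻¹' S)

lemma Sup_meas (hφ : ContinuousOn φ (Cb d)) {S : Set (V d)} (hS : MeasurableSet S) :
    MeasurableSet (Sup hφ S) := by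
  have h1 := XX_cont hφ
  have h2 := HH_cont hφ
  refine MeasurableSet.image_of_continuousOn_injOn ?_ ?_ ?_
  · exact (by fun_prop : Continuous fun z : V d => (z.1, XX hφ z)).measurable hS
  · exact Continuous.continuousOn (by fun_prop)
  · rintro ⟨t, P⟩ - ⟨t', P'⟩ - h
    simp only [Prod.mk.injEq] at h
    obtain ⟨h3, rfl⟩ := h
    rcases le_total t t' with h4 | h4
    · have := HH_mono hφ h4 P
      have : t = t' := by linarith
      rw [this]
    · have := HH_mono hφ h4 P
      have : t = t' := by linarith
      rw [this]

lemma Sup_vol (hφ : ContinuousOn φ (Cb d)) {S : Set (V d)} (hS : MeasurableSet S)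
    (hS1 : ∀ z ∈ S, ‖z.2‖ < 1) : volume S ≤ 2 ^ (d + 1) * volume (Sup hφ S) := by
  have h1 := XX_cont hφ
  set T : Set (V d) := (fun z : V d => (z.1, XX hφ z)) ⁻¹' S with hT
  have hTm : MeasurableSet T := (by fun_prop : Continuous fun z : V d => (z.1, XX hφ z)).measurable hS
  have e : (volume : Measure (V d)) = (volume : Measure ℝ).prod (volume : Measure (E d)) := rfl
  have a1 : volume S ≤ 2 ^ d * volume T := by
    rw [e, Measure.prod_apply hS, Measure.prod_apply hTm, ← lintegral_const_mul _ (measurable_measure_prodMk_left hTm)]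
    refine lintegral_mono fun t => ?_
    have hl : LipschitzWith 2 fun P => XX hφ (t, P) := by
      refine LipschitzWith.of_dist_le_mul fun P P' => ?_
      rw [dist_eq_norm, dist_eq_norm]
      exact XX_lip hφ t P P'
    have hsub : Prod.mk t ⁻¹' S ⊆ (fun P => XX hφ (t, P)) '' (Prod.mk t ⁻¹' T) := by
      intro x hx
      obtain ⟨p, hp⟩ := opt_exists hφ t (hS1 _ hx)
      refine ⟨(1 / 2 : ℝ) • (x + p), ?_, XX_unique hφ hp⟩
      simp only [hT, mem_preimage, XX_unique hφ hp]
      exact hx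
    exact (measure_mono hsub).trans (by simpa using vol_lip hl (Prod.mk t ⁻¹' T))
  have a2 : volume T ≤ 2 * volume (Sup hφ S) := by
    rw [e, Measure.prod_apply_symm hTm, Measure.prod_apply_symm (Sup_meas hφ hS),
      ← lintegral_const_mul _ (measurable_measure_prodMk_right (Sup_meas hφ hS))]
    refine lintegral_mono fun P => ?_
    refine (vol_expand (g := fun t => HH hφ (t, P)) (fun t t' h => HH_mono hφ h P) _).trans ?_
    gcongr
    rintro _ ⟨t, ht, rfl⟩
    exact ⟨(t, P), ht, rfl⟩
  calc volume S ≤ 2 ^ d * volume T := a1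
    _ ≤ 2 ^ d * (2 * volume (Sup hφ S)) := by gcongr
    _ = _ := by rw [pow_succ]; ring

end
end PGE

namespace PGE
open Filter Topology
variable {d : ℕ}

/-! ## Pointwise facts for the iteration -/

def f0 (z : V d) : ℝ := ‖z.2‖ ^ 2 / 2 + z.1
/-- perturbation of the paraboloid -/
def ph (u : V d → ℝ) (k : ℝ) (z : V d) : ℝ := k * u z + 1 * (‖z.2‖ ^ 2 / 2 + z.1)
def dph (du : V d → E d) (k : ℝ) (z : V d) : E d := k • du z + (1 : ℝ) • z.2
/-- points of contact from below -/
def AA (u : V d → ℝ) (du : V d → E d) (k : ℝ) : Set (V d) :=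
  {z | z ∈ Cy d ∧ ph u k z ≤ mm (ph u k) z.1 (dph du k z) + inner ℝ (dph du k z) z.2}

lemma norm_sq_expand (x y : E d) : ‖y‖ ^ 2 = ‖x‖ ^ 2 + 2 * inner ℝ x (y - x) + ‖y - x‖ ^ 2 := by
  have := norm_add_sq_real x (y - x)
  rwa [add_sub_cancel] at this

section
variable {u ut : V d → ℝ} {du : V d → E d} {d2u : V d → Matrix (Fin d) (Fin d) ℝ}

lemma ph_half (k : ℝ) (z : V d) : ph u (k / 2) z = (f0 z + ph u k z) / 2 := by
  unfold ph f0; ring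

lemma dph_half (k : ℝ) (z : V d) : dph du (k / 2) z = (1 / 2 : ℝ) • (z.2 + dph du k z) := by
  unfold dph
  ext i
  simp
  ring

lemma ph_cont (h : Reg u ut du d2u) (k : ℝ) : ContinuousOn (ph u k) (Cb d) := (h.lin k 1).cont

lemma ph_close (hu : ∀ z ∈ Cb d, |u z| ≤ 1) {k : ℝ} (hk : 0 ≤ k) {z : V d} (hz : z ∈ Cb d) :
    f0 z - k ≤ ph u k z ∧ ph u k z ≤ f0 z + k := by
  have := abs_le.1 (hu z hz)
  unfold ph f0
  constructor <;> nlinarith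

lemma mem_Cz {z w : V d} (hz : z ∈ Cy d) : w ∈ Cz d z.1 ↔ w ∈ Cb d ∧ z.1 ≤ w.1 := by
  unfold Cz
  rw [Set.mem_ofPred_eq, min_eq_left (mem_Cy.1 hz).1.2.le]

lemma AA_touch (h : Reg u ut du d2u) {k : ℝ} {z : V d} (hz : z ∈ AA u du k) {w : V d} (hw : w ∈ Cb d)
    (hzw : z.1 ≤ w.1) : ph u k z + inner ℝ (dph du k z) (w.2 - z.2) ≤ ph u k w := by
  have h1 := mm_le (p := dph du k z) (ph_cont h k) ((mem_Cz hz.1).2 ⟨hw, hzw⟩)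
  have h2 := hz.2
  rw [inner_sub_right]
  linarith

lemma AA_of_touch (h : Reg u ut du d2u) {k : ℝ} {z : V d} (hz : z ∈ Cy d) {p : E d}
    (ht : ∀ w ∈ Cb d, z.1 ≤ w.1 → ph u k z + inner ℝ p (w.2 - z.2) ≤ ph u k w) :
    z ∈ AA u du k ∧ dph du k z = p := by
  have hz' := mem_Cy.1 hz
  have e : dph du k z = p := by
    refine touch_du (σ := (ph u k z - inner ℝ p z.2, p)) (h.lin k 1) hz ?_ ?_
    · simp [ell, ph]
    · intro x hx
      have := ht (z.1, x) (mem_Cb.2 ⟨⟨hz'.1.1.le, hz'.1.2.le⟩, hx⟩) le_rfl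
      rw [inner_sub_right] at this
      change ph u k z - inner ℝ p z.2 + inner ℝ p x ≤ ph u k (z.1, x)
      simp only at this
      linarith
  refine ⟨⟨hz, ?_⟩, e⟩
  rw [e]
  have : ph u k z - inner ℝ p z.2 ≤ mm (ph u k) z.1 p := by
    refine le_mm fun w hw => ?_
    rw [mem_Cz hz] at hw
    have := ht w hw.1 hw.2
    rw [inner_sub_right] at this
    linarith
  linarith

lemma lift_touch {k c : ℝ} {z : V d} {p : E d} {w : V d} (ht : c + inner ℝ p (w.2 - z.2) ≤ ph u k w) :
    (f0 z + c) / 2 + inner ℝ ((1 / 2 : ℝ) • (z.2 + p)) (w.2 - z.2) + ‖w.2 - z.2‖ ^ 2 / 4 + (w.1 - z.1) / 2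
      ≤ ph u (k / 2) w := by
  rw [ph_half, real_inner_smul_left, inner_add_left]
  have := norm_sq_expand z.2 w.2
  unfold f0
  linarith

lemma AA_mono (h : Reg u ut du d2u) (k : ℝ) : AA u du k ⊆ AA u du (k / 2) := by
  intro z hz
  refine (AA_of_touch h hz.1 (p := (1 / 2 : ℝ) • (z.2 + dph du k z)) fun w hw hzw => ?_).1
  have := lift_touch (AA_touch h hz hw hzw)
  rw [ph_half k z]
  have : 0 ≤ ‖w.2 - z.2‖ ^ 2 := by positivity
  linarith

lemma AA_meas (h : Reg u ut du d2u) (k : ℝ) : MeasurableSet (AA u du k) := by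
  have hr := h.lin k 1
  have h1 : Measurable (dph du k) := measurable_E hr.mx
  have h2 : Measurable fun z : V d => ((z.1, dph du k z) : V d) := measurable_fst.prodMk h1
  have h3 := (mm_cont (ph_cont h k)).measurable.comp h2
  simp only [Function.comp_def] at h3
  have h4 : Measurable fun z : V d => inner ℝ (dph du k z) z.2 := h1.inner measurable_snd
  have h5 : Measurable (ph u k) := hr.m0
  exact isOpen_Cy.measurableSet.inter (measurableSet_le h5 (h3.add h4))

lemma slope_bound (hu : ∀ z ∈ Cb d, |u z| ≤ 1) {q c : ℝ} (hq : 0 < q) {z : V d} (hz : z ∈ Cb d)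
    (hx : ‖z.2‖ + 2 * q ≤ 1) {p : E d} (hc : f0 z - q ^ 2 ≤ c)
    (ht : ∀ x, ‖x‖ ≤ 1 → c + inner ℝ p (x - z.2) ≤ ph u (q ^ 2) (z.1, x)) : ‖p - z.2‖ ≤ 2 * q := by
  rcases (norm_nonneg (p - z.2)).eq_or_lt with h0 | h0
  · rw [← h0]; positivity
  set n := ‖p - z.2‖ with hn
  set v : E d := (2 * q / n) • (p - z.2) with hv
  have hvn : ‖v‖ = 2 * q := by
    rw [hv, norm_smul, ← hn, Real.norm_of_nonneg (by positivity)]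
    field_simp
  have hxv : ‖z.2 + v‖ ≤ 1 := (norm_add_le _ _).trans (by rw [hvn]; exact hx)
  have h1 := ht _ hxv
  have h2 := (ph_close hu (by positivity : 0 ≤ q ^ 2)
    (mem_Cb.2 ⟨(mem_Cb.1 hz).1, hxv⟩ : ((z.1, z.2 + v) : V d) ∈ Cb d)).2
  have h3 := norm_sq_expand z.2 (z.2 + v)
  rw [add_sub_cancel_left, hvn] at h3
  rw [add_sub_cancel_left] at h1
  have h4 : inner ℝ p v - inner ℝ z.2 v = 2 * q * n := by
    rw [← inner_sub_left, hv, real_inner_smul_right, real_inner_self_eq_norm_sq, ← hn]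
    field_simp
  unfold f0 at *
  simp only at h2
  have : 2 * q * n ≤ 2 * q * (2 * q) := by nlinarith
  exact le_of_mul_le_mul_left this (by positivity)

lemma AA_grad (h : Reg u ut du d2u) (hu : ∀ z ∈ Cb d, |u z| ≤ 1) {q : ℝ} (hq : 0 < q) {z : V d}
    (hz : z ∈ AA u du (q ^ 2)) (hx : ‖z.2‖ + 2 * q ≤ 1) : ‖du z‖ ≤ 2 / q := by
  have hzC := Cy_subset_Cb hz.1
  have h1 := slope_bound hu hq hzC hx (p := dph du (q ^ 2) z)
    (ph_close hu (by positivity : 0 ≤ q ^ 2) hzC).1 fun x hx =>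
      AA_touch h hz (w := (z.1, x)) (mem_Cb.2 ⟨(mem_Cb.1 hzC).1, hx⟩) le_rfl
  unfold dph at h1
  rw [one_smul, add_sub_cancel_right, norm_smul, Real.norm_of_nonneg (by positivity)] at h1
  rw [le_div_iff₀ hq]
  nlinarith

/-- inner cylinder -/
def QQ (d : ℕ) (q : ℝ) : Set (V d) := Set.Ioo (3 * q ^ 2) (1 - q ^ 2) ×ˢ Metric.ball (0 : E d) (1 - 5 * q)

lemma mem_QQ {q : ℝ} {z : V d} : z ∈ QQ d q ↔ (3 * q ^ 2 < z.1 ∧ z.1 < 1 - q ^ 2) ∧ ‖z.2‖ < 1 - 5 * q := by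
  simp [QQ, mem_prod]

lemma QQ_Cy {q : ℝ} (hq : 0 ≤ q) {z : V d} (hz : z ∈ QQ d q) : z ∈ Cy d := by
  rw [mem_QQ] at hz
  rw [mem_Cy]
  have : 0 ≤ q ^ 2 := by positivity
  exact ⟨⟨by linarith, by linarith⟩, by linarith⟩

/-- data attached to a supporting affine function -/
structure Dat (u : V d → ℝ) (k : ℝ) (σ z : V d) (p : E d) (w : ℝ) : Prop where
  opt : ∀ p', mm (ph u k) z.1 p' + inner ℝ p' z.2 ≤ w
  touch : ∀ y ∈ Cb d, z.1 ≤ y.1 → w + inner ℝ p (y.2 - z.2) ≤ ph u k y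
  slope : σ.2 = (1 / 2 : ℝ) • (z.2 + p)
  val : ∀ x, ell σ x = (f0 z + w) / 2 + inner ℝ σ.2 (x - z.2)

lemma Sup_data (h : Reg u ut du d2u) {k : ℝ} {S : Set (V d)} (hS : S ⊆ Cy d) {σ : V d}
    (hσ : σ ∈ Sup (ph_cont h k) S) : ∃ z ∈ S, ∃ p w, Dat u k σ z p w := by
  obtain ⟨⟨t, P⟩, h1, rfl⟩ := hσ
  set x := XX (ph_cont h k) (t, P) with hx
  have hz : ((t, x) : V d) ∈ S := h1
  have hopt := XX_spec (ph_cont h k) (t, P)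
  rw [← hx] at hopt
  simp only at hopt
  set p := (2 : ℝ) • P - x with hp
  have hP : P = (1 / 2 : ℝ) • (x + p) := by
    rw [hp, add_sub_cancel, smul_smul]; norm_num
  refine ⟨(t, x), hz, p, mm (ph u k) t p + inner ℝ p x, ?_, ?_, ?_, ?_⟩
  · intro p'
    have := hopt p'
    rw [real_inner_comm, real_inner_comm p x] at this
    simpa [real_inner_comm] using this
  · intro y hy hty
    have := mm_le (p := p) (ph_cont h k) ((mem_Cz (hS hz)).2 ⟨hy, hty⟩)
    rw [inner_sub_right]
    simp only at this ⊢
    linarith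
  · exact hP
  · intro x'
    simp only [ell, HH, f0]
    rw [← hx, ← hp, inner_sub_right]
    have : inner ℝ P x = (‖x‖ ^ 2 + inner ℝ p x) / 2 := by
      conv_lhs => rw [hP]
      rw [real_inner_smul_left, inner_add_left, real_inner_self_eq_norm_sq]; ring
    rw [this]
    ring

end
end PGE

namespace PGE
open Filter Topology
variable {d : ℕ}

section
variable {u ut : V d → ℝ} {du : V d → E d} {d2u : V d → Matrix (Fin d) (Fin d) ℝ}

lemma Dat.low {k : ℝ} {σ z : V d} {p : E d} {w : ℝ} (hD : Dat u k σ z p w) (hk : 0 ≤ k)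
    (hu : ∀ z ∈ Cb d, |u z| ≤ 1) (hz : z ∈ Cy d) : f0 z - k ≤ w := by
  have h1 := hD.opt z.2
  have h2 : z.1 - ‖z.2‖ ^ 2 / 2 - k ≤ mm (ph u k) z.1 z.2 := by
    refine le_mm fun y hy => ?_
    rw [mem_Cz hz] at hy
    have h3 := (ph_close hu hk hy.1).1
    have h4 := norm_sq_expand z.2 y.2
    rw [inner_sub_right, real_inner_self_eq_norm_sq] at h4
    have : 0 ≤ ‖y.2 - z.2‖ ^ 2 := by positivity
    unfold f0 at h3
    linarith [hy.2]
  rw [real_inner_self_eq_norm_sq] at h1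
  unfold f0
  linarith

lemma Dat.up {k : ℝ} {σ z : V d} {p : E d} {w : ℝ} (hD : Dat u k σ z p w) (hz : z ∈ Cy d) :
    w ≤ ph u k z := by
  have := hD.touch z (Cy_subset_Cb hz) le_rfl
  simpa using this

lemma Dat.slope_le {q : ℝ} {σ z : V d} {p : E d} {w : ℝ} (hD : Dat u (q ^ 2) σ z p w)
    (hu : ∀ z ∈ Cb d, |u z| ≤ 1) (hq : 0 < q) (hz : z ∈ QQ d q) : ‖p - z.2‖ ≤ 2 * q := by
  have hzC := QQ_Cy hq.le hz
  have hzB := Cy_subset_Cb hzC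
  have := (mem_QQ.1 hz).2
  exact slope_bound hu hq hzB (by linarith) (hD.low (by positivity) hu hzC) fun x hx =>
    hD.touch (z.1, x) (mem_Cb.2 ⟨(mem_Cb.1 hzB).1, hx⟩) le_rfl

lemma Dat.slope_eq {k : ℝ} {σ z : V d} {p : E d} {w : ℝ} (hD : Dat u k σ z p w) :
    σ.2 = z.2 + (1 / 2 : ℝ) • (p - z.2) := by
  rw [hD.slope]
  ext i
  simp
  ring

lemma Dat.slope_two {q : ℝ} {σ z : V d} {p : E d} {w : ℝ} (hD : Dat u (q ^ 2) σ z p w)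
    (hu : ∀ z ∈ Cb d, |u z| ≤ 1) (hq : 0 < q) (hz : z ∈ QQ d q) : ‖σ.2‖ ≤ 2 := by
  rw [hD.slope_eq]
  have h1 := hD.slope_le hu hq hz
  have h2 := (mem_QQ.1 hz).2
  have h3 := norm_nonneg z.2
  refine (norm_add_le _ _).trans ?_
  rw [norm_smul, Real.norm_of_nonneg (by norm_num)]
  linarith

lemma Dat.adm {q : ℝ} {σ z : V d} {p : E d} {w : ℝ} (hD : Dat u (q ^ 2) σ z p w)
    (hu : ∀ z ∈ Cb d, |u z| ≤ 1) (hq : 0 < q) (hz : z ∈ QQ d q) :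
    Adm (ph u (q ^ 2 / 2)) (q ^ 2 / 2) 2 σ (z.1 - 2 * q ^ 2) := by
  have hzC := QQ_Cy hq.le hz
  have hzB := Cy_subset_Cb hzC
  have hzC' := mem_Cy.1 hzC
  have hz' := mem_QQ.1 hz
  have hq2 : 0 < q ^ 2 := by positivity
  have hlow := hD.low hq2.le hu hzC
  have hup := hD.up hzC
  have hup2 := (ph_close hu hq2.le hzB).2
  refine ⟨hD.slope_two hu hq hz, by linarith, by linarith, ⟨z.2, hzC'.2.le, ?_⟩, ?_, ?_⟩
  · have hyB : ((z.1 - 2 * q ^ 2, z.2) : V d) ∈ Cb d :=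
      mem_Cb.2 ⟨⟨by simp only; linarith, by simp only; linarith⟩, hzC'.2.le⟩
    have h1 := (ph_close hu (half_pos hq2).le hyB).2
    rw [hD.val]
    simp only [sub_self, inner_zero_right, add_zero]
    simp only [f0] at h1 hlow ⊢
    linarith
  · intro t x ht ht1 hx
    have hyB : ((t, x) : V d) ∈ Cb d :=
      mem_Cb.2 ⟨⟨by simp only; linarith, by simp only; linarith⟩, hx.le⟩
    have h1 := (ph_close hu (half_pos hq2).le hyB).1
    rw [hD.val, hD.slope_eq, inner_add_left, real_inner_smul_left]
    have h2 := norm_sq_expand z.2 x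
    have h3 := real_inner_le_norm (p - z.2) (x - z.2)
    have h4 := hD.slope_le hu hq hz
    have h5 : 5 * q ≤ ‖x - z.2‖ := by
      have := norm_sub_norm_le x z.2
      linarith
    have h6 : ‖p - z.2‖ * ‖x - z.2‖ ≤ 2 * q * ‖x - z.2‖ := by gcongr
    simp only [f0] at h1 hlow hup2 ⊢
    nlinarith
  · intro x hx
    have hyB : ((1, x) : V d) ∈ Cb d := mem_Cb.2 ⟨⟨zero_le_one, le_rfl⟩, hx⟩
    have h1 := lift_touch (hD.touch _ hyB hzC'.1.2.le)
    rw [hD.val, hD.slope]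
    have : 0 ≤ ‖x - z.2‖ ^ 2 := by positivity
    simp only at h1
    linarith

lemma Dat.contact {q : ℝ} {σ z : V d} {p : E d} {w : ℝ} (hD : Dat u (q ^ 2) σ z p w)
    (h : Reg u ut du d2u) (hu : ∀ z ∈ Cb d, |u z| ≤ 1) (hq : 0 < q) (hz : z ∈ QQ d q)
    (hzA : z ∉ AA u du (q ^ 2)) {y : V d} (hy : Contact (ph u (q ^ 2 / 2)) σ y) :
    y ∈ AA u du (q ^ 2 / 2) ∧ y ∉ AA u du (q ^ 2) ∧ ‖(q ^ 2 / 2) • du y‖ ≤ 3 := by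
  have hzC := QQ_Cy hq.le hz
  have hyB := Cy_subset_Cb hy.1
  have hyA : y ∈ AA u du (q ^ 2 / 2) ∧ dph du (q ^ 2 / 2) y = σ.2 := by
    refine AA_of_touch h hy.1 fun w hw hyw => ?_
    have h1 := hy.2.2 w hw hyw
    rw [hy.2.1]
    unfold ell at *
    rw [inner_sub_right]
    linarith
  have hty : y.1 < z.1 := by
    by_contra hcon
    push Not at hcon
    have h1 := lift_touch (hD.touch y hyB hcon)
    rw [hy.2.1, hD.val, hD.slope] at h1
    have h0 : 0 ≤ ‖y.2 - z.2‖ ^ 2 := by positivity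
    have h2 : ‖y.2 - z.2‖ ^ 2 = 0 := by linarith
    have h3 : y.2 = z.2 := by
      have := pow_eq_zero_iff (two_ne_zero) |>.1 h2
      exact sub_eq_zero.1 (norm_eq_zero.1 this)
    have h4 : y = z := Prod.ext (by linarith) h3
    rw [h4] at hy
    have h5 := hy.2.1
    rw [hD.val, ph_half] at h5
    simp only [sub_self, inner_zero_right, add_zero] at h5
    have h6 : ph u (q ^ 2) z = w := by linarith
    refine hzA (AA_of_touch h hzC (p := p) fun y' hy' hty' => ?_).1
    rw [h6]
    exact hD.touch y' hy' hty'
  refine ⟨hyA.1, fun hyA1 => ?_, ?_⟩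
  · set p1 := dph du (q ^ 2) y with hp1
    have hP : σ.2 = (1 / 2 : ℝ) • (y.2 + p1) := by rw [← hyA.2, dph_half]
    have h1 := hD.opt p1
    have h2 := mm_mono (ph_cont h (q ^ 2)) hty.le p1
    have h3 := hyA1.2
    have h4 := hy.2.1
    have h5 := hD.val z.2
    rw [sub_self, inner_zero_right, add_zero] at h5
    have h6 : ell σ z.2 = ell σ y.2 + inner ℝ σ.2 (z.2 - y.2) := by
      unfold ell; rw [inner_sub_right]; ring
    rw [hP, real_inner_smul_left, inner_add_left] at h6
    rw [ph_half] at h4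
    have h7 := norm_sq_expand y.2 z.2
    have h8 : 0 ≤ ‖z.2 - y.2‖ ^ 2 := by positivity
    rw [inner_sub_right p1] at h6
    unfold f0 at *
    rw [← hp1] at h3
    linarith
  · have e : (q ^ 2 / 2) • du y = σ.2 - y.2 := by
      rw [← hyA.2]; unfold dph; simp
    rw [e]
    have h1 := hD.slope_two hu hq hz
    have h2 := (mem_Cb.1 hyB).2
    exact (norm_sub_le _ _).trans (by linarith)

theorem iter_vol {δ K : ℝ} {a : V d → Matrix (Fin d) (Fin d) ℝ} {b : V d → E d} {c : V d → ℝ}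
    (hδ0 : 0 < δ) (hK : 0 ≤ K) (hC : Coef δ K a b c)
    (h : Reg u ut du d2u)
    (hF : ∫⁻ z in Cy d, ENNReal.ofReal |Lop a b c u ut du d2u z| ^ (d + 1) ≤ 1)
    (hu : ∀ z ∈ Cb d, |u z| ≤ 1) {q : ℝ} (hq : 0 < q) (hq1 : q ≤ 1) :
    volume (QQ d q \ AA u du (q ^ 2)) ≤ ENNReal.ofReal (2 ^ (d + 1) * (δ⁻¹ ^ d * 2 ^ (d + 1))) *
      (ENNReal.ofReal q + ENNReal.ofReal ((4 * K + 1 + d * δ⁻¹) ^ (d + 1)) *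
        volume (AA u du (q ^ 2 / 2) \ AA u du (q ^ 2))) := by
  set S : Set (V d) := QQ d q \ AA u du (q ^ 2) with hSdef
  set G : Set (V d) := {y | y ∈ AA u du (q ^ 2 / 2) \ AA u du (q ^ 2) ∧ ‖(q ^ 2 / 2) • du y‖ ≤ 3} with hG
  have hS : MeasurableSet S := by
    refine MeasurableSet.diff ?_ (AA_meas h _)
    exact measurableSet_Ioo.prod Metric.isOpen_ball.measurableSet
  have hSC : S ⊆ Cy d := fun z hz => QQ_Cy hq.le hz.1
  have hGm : MeasurableSet G := by
    have m1 : Measurable du := measurable_E h.mx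
    have m2 : Measurable fun y => ‖(q ^ 2 / 2) • du y‖ := by
      simp_rw [norm_smul]
      exact m1.norm.const_mul _
    have m3 : MeasurableSet {y | ‖(q ^ 2 / 2) • du y‖ ≤ 3} := measurableSet_le m2 measurable_const
    have m4 : MeasurableSet (AA u du (q ^ 2 / 2) \ AA u du (q ^ 2)) := (AA_meas h _).diff (AA_meas h _)
    exact m4.inter m3
  have hq2 : 0 < q ^ 2 := by positivity
  have hsv := Sup_vol (ph_cont h (q ^ 2)) hS fun z hz => (mem_Cy.1 (hSC hz)).2
  have key := area_int (τ := q ^ 2 / 2) (R := 2) (S := Sup (ph_cont h (q ^ 2)) S) (G := G)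
    (h.lin (q ^ 2 / 2) 1) hδ0 hC.ha hC.has hC.ham (half_pos hq2)
    (Sup_meas _ hS) hGm ?_ ?_ (fun z hz => hz.1.1.1) (Lop_measurable h hC) (F := 1) (κ := q ^ 2 / 2)
    (B := 4 * K + 1 + d * δ⁻¹) (half_pos hq2).le (by simpa using hF) ?_
  · have hB : 0 ≤ 4 * K + 1 + d * δ⁻¹ := by positivity
    refine hsv.trans ((mul_le_mul_right key _).trans ?_)
    rw [← mul_assoc]
    have e2 : (2 : ℝ≥0∞) ^ (d + 1) = ENNReal.ofReal (2 ^ (d + 1)) := by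
      rw [ENNReal.ofReal_pow (by norm_num), ENNReal.ofReal_ofNat]
    rw [e2, ← ENNReal.ofReal_mul (by positivity), ENNReal.ofReal_pow hB]
    gcongr
    · rw [← ENNReal.ofReal_pow (by positivity)]
      apply ENNReal.ofReal_le_ofReal
      have h1 : q ^ 2 / 2 * 1 ≤ q := by nlinarith
      have h2 : q ^ 2 / 2 * 1 ≤ 1 := by linarith
      have h3 : (q ^ 2 / 2 * 1) ^ (d + 1) ≤ q ^ 2 / 2 * 1 := by
        rw [pow_succ]
        exact mul_le_of_le_one_left (by positivity) (pow_le_one₀ (by positivity) h2)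
      linarith
    · exact fun z hz => hz.1
  · intro σ hσ
    obtain ⟨z, hz, p, w, hD⟩ := Sup_data h hSC hσ
    exact ⟨_, hD.adm hu hq hz.1⟩
  · intro σ hσ y hy
    obtain ⟨z, hz, p, w, hD⟩ := Sup_data h hSC hσ
    have := hD.contact h hu hq hz.1 hz.2 hy
    exact ⟨⟨this.1, this.2.1⟩, this.2.2⟩
  · intro z hz
    have hzB := Cy_subset_Cb hz.1.1.1
    have e1 : mdot (a z) ((q ^ 2 / 2) • d2u z + (1 : ℝ) • (1 : Matrix (Fin d) (Fin d) ℝ)) =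
        (q ^ 2 / 2) * mdot (a z) (d2u z) + mdot (a z) 1 := by
      simp only [mdot, Finset.mul_sum, ← Finset.sum_add_distrib, Matrix.add_apply, Matrix.smul_apply, smul_eq_mul]
      refine Finset.sum_congr rfl fun i _ => Finset.sum_congr rfl fun j _ => by ring
    have e2 := mdot_one_le (hC.ha z)
    have e3 : ut z + mdot (a z) (d2u z) = Lop a b c u ut du d2u z - inner ℝ (b z) (du z) + c z * u z := by
      simp only [Lop]; ring
    have e4 := le_abs_self (Lop a b c u ut du d2u z)
    have hb : ‖b z‖ ≤ K := by linarith [hC.hbc z, hC.hc0 z]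
    have hc : c z ≤ K := by linarith [hC.hbc z, norm_nonneg (b z)]
    have e5 : |inner ℝ (b z) ((q ^ 2 / 2) • du z)| ≤ K * 3 := by
      refine (abs_real_inner_le_norm _ _).trans ?_
      exact mul_le_mul hb hz.2 (norm_nonneg _) hK
    rw [real_inner_smul_right] at e5
    have e6 : c z * u z ≤ K := by
      have h1 := abs_le.1 (hu z hzB)
      have h2 := hC.hc0 z
      nlinarith
    have e7 := (abs_le.1 e5).1
    rw [e1]
    have e8 : q ^ 2 / 2 * (c z * u z) ≤ K := by
      have h1 : q ^ 2 / 2 * (c z * u z) ≤ q ^ 2 / 2 * K := by gcongr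
      have h2 : q ^ 2 ≤ 1 := by nlinarith
      nlinarith
    have e9 : q ^ 2 / 2 * ut z + 1 + (q ^ 2 / 2 * mdot (a z) (d2u z) + mdot (a z) 1) =
       q ^ 2 / 2 * (ut z + mdot (a z) (d2u z)) + 1 + mdot (a z) 1 := by ring
    rw [e9, e3]
    nlinarith

end
end PGE

namespace PGE
open Filter Topology
variable {d : ℕ}

/-! ## Decay of measures -/

lemma vol_layer {q : ℝ} (hq : 0 < q) :
    volume (Cy d \ QQ d q) ≤ ENNReal.ofReal ((9 + 5 * d) * om d * q) := by
  have ho := om_pos (d := d)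
  by_cases h5 : 5 * q < 1
  · have hsub : QQ d q ⊆ Cy d := fun z hz => QQ_Cy hq.le hz
    have hm : MeasurableSet (QQ d q) := measurableSet_Ioo.prod Metric.isOpen_ball.measurableSet
    have h4 : 0 ≤ 1 - 4 * q ^ 2 := by nlinarith
    have hv : volume (QQ d q) = ENNReal.ofReal ((1 - 4 * q ^ 2) * ((1 - 5 * q) ^ d * om d)) := by
      rw [QQ, vol_prod_ball _ _ (by linarith), ← ofReal_om, Real.volume_Ioo,
        ENNReal.ofReal_mul h4, ENNReal.ofReal_mul (pow_nonneg (by linarith) d)]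
      congr 2; ring
    rw [measure_sdiff hsub hm.nullMeasurableSet (by rw [hv]; exact ENNReal.ofReal_ne_top), hv, vol_Cy,
      ← ENNReal.ofReal_sub _ (mul_nonneg h4 (mul_nonneg (pow_nonneg (by linarith) d) ho.le))]
    apply ENNReal.ofReal_le_ofReal
    have hB := one_add_mul_le_pow (a := -(5 * q)) (by linarith) d
    have hB1 : (1 - 5 * q) ^ d ≤ 1 := pow_le_one₀ (by linarith) (by linarith)
    rw [← sub_eq_add_neg] at hB
    have e : (1 - 4 * q ^ 2) * ((1 - 5 * q) ^ d * om d) = ((1 - 4 * q ^ 2) * (1 - 5 * q) ^ d) * om d := by ring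
    have h6 : 1 - (9 + 5 * d) * q ≤ (1 - 4 * q ^ 2) * (1 - 5 * q) ^ d := by nlinarith
    rw [e]
    nlinarith
  · refine (measure_mono sdiff_subset).trans ?_
    rw [vol_Cy]
    apply ENNReal.ofReal_le_ofReal
    have : 1 ≤ (9 + 5 * d) * q := by
      have : (0 : ℝ) ≤ d * q := by positivity
      nlinarith
    nlinarith

section
variable {u ut : V d → ℝ} {du : V d → E d} {d2u : V d → Matrix (Fin d) (Fin d) ℝ}

/-- measure of the bad set -/
def bad (u : V d → ℝ) (du : V d → E d) (k : ℝ) : ℝ := (volume (Cy d \ AA u du k)).toReal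

lemma bad_fin (u : V d → ℝ) (du : V d → E d) (k : ℝ) : volume (Cy d \ AA u du k) ≠ ⊤ := by
  refine ne_top_of_le_ne_top ?_ (measure_mono sdiff_subset)
  rw [vol_Cy]; exact ENNReal.ofReal_ne_top

lemma bad_le (u : V d → ℝ) (du : V d → E d) (k : ℝ) : bad u du k ≤ om d := by
  refine ENNReal.toReal_le_of_le_ofReal om_pos.le ?_
  rw [← vol_Cy]
  exact measure_mono sdiff_subset

lemma iter_step {δ K : ℝ} {a : V d → Matrix (Fin d) (Fin d) ℝ} {b : V d → E d} {c : V d → ℝ}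
    (hδ0 : 0 < δ) (hK : 0 ≤ K) (hC : Coef δ K a b c)
    (h : Reg u ut du d2u)
    (hF : ∫⁻ z in Cy d, ENNReal.ofReal |Lop a b c u ut du d2u z| ^ (d + 1) ≤ 1)
    (hu : ∀ z ∈ Cb d, |u z| ≤ 1) {q : ℝ} (hq : 0 < q) (hq1 : q ≤ 1) :
    bad u du (q ^ 2) ≤ (9 + 5 * d) * om d * q + (2 ^ (d + 1) * (δ⁻¹ ^ d * 2 ^ (d + 1))) *
      (q + (4 * K + 1 + d * δ⁻¹) ^ (d + 1) * (bad u du (q ^ 2) - bad u du (q ^ 2 / 2))) := by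
  have key := iter_vol hδ0 hK hC h hF hu hq hq1
  have ho := om_pos (d := d)
  set A := (2 : ℝ) ^ (d + 1) * (δ⁻¹ ^ d * 2 ^ (d + 1)) with hA
  set B := (4 * K + 1 + d * δ⁻¹) ^ (d + 1) with hB
  have hA0 : 0 ≤ A := by positivity
  have hB0 : 0 ≤ B := by positivity
  have hsub : Cy d \ AA u du (q ^ 2 / 2) ⊆ Cy d \ AA u du (q ^ 2) :=
    fun z hz => ⟨hz.1, fun hz2 => hz.2 (AA_mono h _ hz2)⟩
  have hle : bad u du (q ^ 2 / 2) ≤ bad u du (q ^ 2) :=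
    ENNReal.toReal_mono (bad_fin _ _ _) (measure_mono hsub)
  have hdiff : volume (AA u du (q ^ 2 / 2) \ AA u du (q ^ 2)) =
      ENNReal.ofReal (bad u du (q ^ 2) - bad u du (q ^ 2 / 2)) := by
    have e : AA u du (q ^ 2 / 2) \ AA u du (q ^ 2) =
        (Cy d \ AA u du (q ^ 2)) \ (Cy d \ AA u du (q ^ 2 / 2)) := by
      ext z
      simp only [Set.mem_sdiff]
      constructor
      · rintro ⟨h1, h2⟩
        exact ⟨⟨h1.1, h2⟩, fun h3 => h3.2 h1⟩
      · rintro ⟨⟨h1, h2⟩, h3⟩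
        exact ⟨by_contra fun h4 => h3 ⟨h1, h4⟩, h2⟩
    have hm : MeasurableSet (Cy d \ AA u du (q ^ 2 / 2)) := isOpen_Cy.measurableSet.diff (AA_meas h _)
    rw [e, measure_sdiff hsub hm.nullMeasurableSet (bad_fin _ _ _)]
    unfold bad
    rw [ENNReal.ofReal_sub _ ENNReal.toReal_nonneg, ENNReal.ofReal_toReal (bad_fin _ _ _), ENNReal.ofReal_toReal (bad_fin _ _ _)]
  rw [hdiff, ← ENNReal.ofReal_mul hB0, ← ENNReal.ofReal_add hq.le (mul_nonneg hB0 (by linarith)),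
    ← ENNReal.ofReal_mul hA0] at key
  have hcov : volume (Cy d \ AA u du (q ^ 2)) ≤ volume (Cy d \ QQ d q) + volume (QQ d q \ AA u du (q ^ 2)) := by
    refine (measure_mono ?_).trans (measure_union_le _ _)
    intro z hz
    by_cases h1 : z ∈ QQ d q
    · exact Or.inr ⟨h1, hz.2⟩
    · exact Or.inl ⟨hz.1, h1⟩
  have hd0 : 0 ≤ bad u du (q ^ 2) - bad u du (q ^ 2 / 2) := by linarith
  refine ENNReal.toReal_le_of_le_ofReal (by positivity) ?_
  rw [ENNReal.ofReal_add (by positivity) (by positivity)]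
  exact hcov.trans (add_le_add (vol_layer hq) key)

end

lemma seq_decay {μ : ℕ → ℝ} {θ r C m0 l : ℝ} (hθ : 0 ≤ θ) (hl : θ < l) (hr0 : 0 ≤ r) (hr : r ≤ l) (hC : 0 ≤ C)
    (hm : 0 ≤ m0) (h0 : μ 0 ≤ m0) (hs : ∀ k, μ (k + 1) ≤ θ * μ k + C * r ^ k) (k : ℕ) :
    μ k ≤ (m0 + C / (l - θ)) * l ^ k := by
  have hlθ : 0 < l - θ := by linarith
  induction k with
  | zero =>
    have : 0 ≤ C / (l - θ) := by positivity
    simp; linarith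
  | succ k ih =>
    refine (hs k).trans ?_
    have h1 : C * r ^ k ≤ C * l ^ k := by gcongr
    have h2 : C = C / (l - θ) * (l - θ) := by field_simp
    have h3 : 0 ≤ l ^ k := pow_nonneg (by linarith) k
    rw [pow_succ]
    have h4 : θ * μ k ≤ θ * ((m0 + C / (l - θ)) * l ^ k) := by gcongr
    have h5 : C ≤ (m0 + C / (l - θ)) * (l - θ) := by
      rw [add_mul, ← h2]
      have : 0 ≤ m0 * (l - θ) := by positivity
      linarith
    nlinarith

lemma exists_gamma {l : ℝ} (hl0 : 0 < l) (hl : l < 1) : ∃ γ : ℝ, 0 < γ ∧ γ ≤ 1 ∧ (2 : ℝ) ^ γ * l < 1 := by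
  have hc : Tendsto (fun γ : ℝ => (2 : ℝ) ^ γ * l) (𝓝[>] 0) (𝓝 ((2 : ℝ) ^ (0 : ℝ) * l)) := by
    have : Continuous fun γ : ℝ => (2 : ℝ) ^ γ * l :=
      (Real.continuous_const_rpow (by norm_num)).mul continuous_const
    exact (this.tendsto 0).mono_left nhdsWithin_le_nhds
  rw [Real.rpow_zero, one_mul] at hc
  have h1 := hc.eventually (gt_mem_nhds hl)
  have h2 : ∀ᶠ γ : ℝ in 𝓝[>] 0, γ ∈ Set.Ioc (0 : ℝ) 1 := Ioc_mem_nhdsGT one_pos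
  obtain ⟨γ, hγ⟩ := (h1.and h2).exists
  exact ⟨γ, hγ.2.1, hγ.2.2, hγ.1⟩

/-- normalized measure decay -/
theorem decay (d : ℕ) {δ K : ℝ} (hδ0 : 0 < δ) (hδ1 : δ < 1) (hK : 0 ≤ K) :
    ∃ l C : ℝ, 0 < l ∧ l < 1 ∧ 0 < C ∧
    ∀ (a : V d → Matrix (Fin d) (Fin d) ℝ) (b : V d → E d) (c : V d → ℝ)
      (u ut : V d → ℝ) (du : V d → E d) (d2u : V d → Matrix (Fin d) (Fin d) ℝ),
      Coef δ K a b c → Reg u ut du d2u →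
      ∫⁻ z in Cy d, ENNReal.ofReal |Lop a b c u ut du d2u z| ^ (d + 1) ≤ 1 →
      (∀ z ∈ Cb d, |u z| ≤ 1) → ∀ k : ℕ,
      volume {z | z ∈ Cy d ∧ 3 * 2 ^ k ≤ ‖du z‖} ≤ ENNReal.ofReal (C * l ^ k) := by
  have ho := om_pos (d := d)
  set A := (2 : ℝ) ^ (d + 1) * (δ⁻¹ ^ d * 2 ^ (d + 1)) with hA
  set B := (4 * K + 1 + d * δ⁻¹) ^ (d + 1) with hB
  have hA1 : 1 ≤ A := by
    have h1 : 1 ≤ δ⁻¹ ^ d := one_le_pow₀ ((one_le_inv₀ hδ0).2 hδ1.le)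
    have h2 : (1 : ℝ) ≤ 2 ^ (d + 1) := one_le_pow₀ (by norm_num)
    exact one_le_mul_of_one_le_of_one_le h2 (one_le_mul_of_one_le_of_one_le h1 h2)
  have hB1 : 1 ≤ B := by
    refine one_le_pow₀ ?_
    have : 0 ≤ d * δ⁻¹ := by positivity
    linarith
  have hAB : 1 ≤ A * B := one_le_mul_of_one_le_of_one_le hA1 hB1
  set C3 := (9 + 5 * d) * om d with hC3
  have hC30 : 0 ≤ C3 := by positivity
  set θ := 1 - 1 / (A * B) with hθ
  have hAB0 : 0 < A * B := by linarith
  have hθ0 : 0 ≤ θ := by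
    have : 1 / (A * B) ≤ 1 := by rw [div_le_one hAB0]; exact hAB
    linarith
  have hθ1 : θ < 1 := by
    have : 0 < 1 / (A * B) := by positivity
    linarith
  set r := Real.sqrt (1 / 2) with hr
  have hr2 : r ^ 2 = 1 / 2 := Real.sq_sqrt (by norm_num)
  have hr0 : 0 < r := Real.sqrt_pos.2 (by norm_num)
  have hr1 : r < 1 := by nlinarith
  have hr3 : 1 ≤ 2 * r := by nlinarith
  set l := max ((1 + θ) / 2) r with hl
  have hl0 : 0 < l := lt_max_of_lt_right hr0
  have hl1 : l < 1 := max_lt (by linarith) hr1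
  have hlθ : θ < l := lt_of_lt_of_le (by linarith) (le_max_left _ _)
  have hlr : r ≤ l := le_max_right _ _
  set C := om d + (C3 + A) / (l - θ) with hC
  have hCpos : 0 < C := by
    have : 0 ≤ (C3 + A) / (l - θ) := div_nonneg (by linarith) (by linarith)
    linarith
  refine ⟨l, C + C3, hl0, hl1, by linarith, ?_⟩
  intro a b c u ut du d2u hco h hF hu k
  have hqk : ∀ k : ℕ, 0 < r ^ k ∧ r ^ k ≤ 1 := fun k => ⟨by positivity, pow_le_one₀ hr0.le hr1.le⟩
  have hdec := seq_decay (μ := fun k => bad u du ((r ^ k) ^ 2)) (m0 := om d) (C := C3 + A) hθ0 hlθ hr0.le hlr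
    (by linarith) ho.le (bad_le _ _ _) ?_ k
  · have hsub : {z | z ∈ Cy d ∧ 3 * 2 ^ k ≤ ‖du z‖} ⊆ (Cy d \ AA u du ((r ^ k) ^ 2)) ∪ (Cy d \ QQ d (r ^ k)) := by
      rintro z ⟨hz1, hz2⟩
      by_cases hA' : z ∈ AA u du ((r ^ k) ^ 2)
      · right
        refine ⟨hz1, fun hQ => ?_⟩
        have h1 := (mem_QQ.1 hQ).2
        have h2 := AA_grad h hu (hqk k).1 hA' (by linarith [(hqk k).1])
        have h3 : 1 ≤ 2 ^ k * r ^ k := by rw [← mul_pow]; exact one_le_pow₀ hr3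
        rw [le_div_iff₀ (hqk k).1] at h2
        have h4 : 3 * 2 ^ k * r ^ k ≤ ‖du z‖ * r ^ k := by gcongr
        linarith
      · exact Or.inl ⟨hz1, hA'⟩
    refine (measure_mono hsub).trans ((measure_union_le _ _).trans ?_)
    rw [add_mul, ENNReal.ofReal_add (by positivity) (by positivity)]
    refine add_le_add ?_ ?_
    · rw [← ENNReal.ofReal_toReal (bad_fin _ _ _)]
      exact ENNReal.ofReal_le_ofReal hdec
    · refine (vol_layer (hqk k).1).trans (ENNReal.ofReal_le_ofReal ?_)
      rw [← hC3]
      gcongr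
  · intro k
    have hs := iter_step hδ0 hK hco h hF hu (hqk k).1 (hqk k).2
    rw [← hA, ← hB, ← hC3] at hs
    have e : (r ^ (k + 1)) ^ 2 = (r ^ k) ^ 2 / 2 := by
      rw [pow_succ r k, mul_pow, hr2]; ring
    simp only [e]
    set x := bad u du ((r ^ k) ^ 2)
    set y := bad u du ((r ^ k) ^ 2 / 2)
    have h1 : A * B * y ≤ (A * B - 1) * x + (C3 + A) * r ^ k := by nlinarith
    have h2 : y ≤ ((A * B - 1) * x + (C3 + A) * r ^ k) / (A * B) := by
      rw [le_div_iff₀ hAB0]; linarith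
    refine h2.trans ?_
    rw [add_div]
    refine add_le_add (le_of_eq ?_) ?_
    · rw [hθ]; field_simp
    · exact div_le_self (mul_nonneg (by linarith) (hqk k).1.le) hAB

end PGE

namespace PGE
open Filter Topology
variable {d : ℕ}

/-! ## Integration of the distribution function -/

lemma pointwise_bound {γ x : ℝ} (hγ0 : 0 < γ) (hγ1 : γ ≤ 1) (hx : 0 ≤ x) :
    ENNReal.ofReal x ^ γ ≤ ENNReal.ofReal 3 ∨
    ∃ k : ℕ, 3 * 2 ^ k ≤ x ∧ ENNReal.ofReal x ^ γ ≤ ENNReal.ofReal (6 * (2 ^ γ) ^ k) := by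
  rw [ENNReal.ofReal_rpow_of_nonneg hx hγ0.le]
  by_cases h3 : x < 3
  · left
    refine ENNReal.ofReal_le_ofReal ?_
    calc x ^ γ ≤ 3 ^ γ := Real.rpow_le_rpow hx h3.le hγ0.le
      _ ≤ 3 ^ (1 : ℝ) := Real.rpow_le_rpow_of_exponent_le (by norm_num) hγ1
      _ = 3 := by norm_num
  · right
    push Not at h3
    obtain ⟨k, hk1, hk2⟩ := exists_nat_pow_near (x := x / 3) (y := (2 : ℝ)) (by linarith) (by norm_num)
    refine ⟨k, by linarith, ENNReal.ofReal_le_ofReal ?_⟩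
    have h6 : x ≤ 6 * 2 ^ k := by rw [pow_succ] at hk2; linarith
    calc x ^ γ ≤ (6 * 2 ^ k) ^ γ := Real.rpow_le_rpow hx h6 hγ0.le
      _ = 6 ^ γ * (2 ^ γ) ^ k := by
        rw [Real.mul_rpow (by norm_num) (by positivity), ← Real.rpow_natCast, ← Real.rpow_natCast,
          ← Real.rpow_mul (by norm_num), ← Real.rpow_mul (by norm_num), mul_comm γ]
      _ ≤ 6 * (2 ^ γ) ^ k := by
        refine mul_le_mul_of_nonneg_right ?_ (by positivity)
        calc (6 : ℝ) ^ γ ≤ 6 ^ (1 : ℝ) := Real.rpow_le_rpow_of_exponent_le (by norm_num) hγ1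
          _ = 6 := by norm_num

theorem normalized (d : ℕ) {δ K : ℝ} (hδ0 : 0 < δ) (hδ1 : δ < 1) (hK : 0 ≤ K) :
    ∃ γ N : ℝ, 0 < γ ∧ γ ≤ 1 ∧ 0 < N ∧
    ∀ (a : V d → Matrix (Fin d) (Fin d) ℝ) (b : V d → E d) (c : V d → ℝ)
      (u ut : V d → ℝ) (du : V d → E d) (d2u : V d → Matrix (Fin d) (Fin d) ℝ),
      Coef δ K a b c → Reg u ut du d2u →
      ∫⁻ z in Cy d, ENNReal.ofReal |Lop a b c u ut du d2u z| ^ (d + 1) ≤ 1 →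
      (∀ z ∈ Cb d, |u z| ≤ 1) →
      ∫⁻ z in Cy d, ENNReal.ofReal ‖du z‖ ^ γ ≤ ENNReal.ofReal N := by
  have ho := om_pos (d := d)
  obtain ⟨l, C, hl0, hl1, hC, hdec⟩ := decay d hδ0 hδ1 hK
  obtain ⟨γ, hγ0, hγ1, hγl⟩ := exists_gamma hl0 hl1
  have h2γ : 0 < (2 : ℝ) ^ γ := by positivity
  have hρ0 : 0 ≤ (2 : ℝ) ^ γ * l := by positivity
  have hgap : 0 < 1 - (2 : ℝ) ^ γ * l := by linarith
  refine ⟨γ, 3 * om d + 6 * C * (1 - (2 : ℝ) ^ γ * l)⁻¹, hγ0, hγ1, by positivity, ?_⟩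
  intro a b c u ut du d2u hco h hF hu
  have hk := hdec a b c u ut du d2u hco h hF hu
  have hdum : Measurable du := measurable_E h.mx
  set S : ℕ → Set (V d) := fun k => {z | z ∈ Cy d ∧ 3 * 2 ^ k ≤ ‖du z‖} with hS
  have hSm : ∀ k, MeasurableSet (S k) := fun k =>
    isOpen_Cy.measurableSet.inter (measurableSet_le measurable_const hdum.norm)
  calc ∫⁻ z in Cy d, ENNReal.ofReal ‖du z‖ ^ γ
      ≤ ∫⁻ z in Cy d, (ENNReal.ofReal 3 +
          ∑' k : ℕ, (S k).indicator (fun _ => ENNReal.ofReal (6 * (2 ^ γ) ^ k)) z) := by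
        refine setLIntegral_mono' isOpen_Cy.measurableSet fun z hz => ?_
        rcases pointwise_bound hγ0 hγ1 (norm_nonneg (du z)) with h1 | ⟨k, h1, h2⟩
        · exact h1.trans le_self_add
        · refine (h2.trans ?_).trans le_add_self
          have h3 := ENNReal.le_tsum (f := fun k : ℕ =>
            (S k).indicator (fun _ => ENNReal.ofReal (6 * (2 ^ γ) ^ k)) z) k
          have h4 : z ∈ S k := ⟨hz, h1⟩
          simp only [Set.indicator_of_mem h4] at h3
          exact h3
    _ = ENNReal.ofReal (3 * om d) + ∑' k : ℕ, ∫⁻ z in Cy d,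
          (S k).indicator (fun _ => ENNReal.ofReal (6 * (2 ^ γ) ^ k)) z := by
        rw [lintegral_add_left measurable_const, setLIntegral_const, vol_Cy, ← ENNReal.ofReal_mul (by norm_num),
          lintegral_tsum fun k => (measurable_const.indicator (hSm k)).aemeasurable]
    _ ≤ ENNReal.ofReal (3 * om d) + ∑' k : ℕ, ENNReal.ofReal (6 * C * ((2 ^ γ) * l) ^ k) := by
        refine add_le_add le_rfl (ENNReal.tsum_le_tsum fun k => ?_)
        rw [lintegral_indicator_const (hSm k)]
        calc _ ≤ ENNReal.ofReal (6 * (2 ^ γ) ^ k) * ENNReal.ofReal (C * l ^ k) := by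
              refine mul_le_mul_right ((Measure.restrict_apply_le _ _).trans (hk k)) _
          _ = _ := by
              rw [← ENNReal.ofReal_mul (by positivity), mul_pow]; congr 1; ring
    _ = _ := by
        rw [← ENNReal.ofReal_tsum_of_nonneg (fun k => by positivity)
          ((summable_geometric_of_lt_one hρ0 hγl).mul_left _), tsum_mul_left,
          tsum_geometric_of_lt_one hρ0 hγl, ENNReal.ofReal_add (by positivity) (by positivity)]

theorem scaled (d : ℕ) {δ K : ℝ} (hδ0 : 0 < δ) (hδ1 : δ < 1) (hK : 0 ≤ K) :
    ∃ γ N : ℝ, 0 < γ ∧ γ ≤ 1 ∧ 0 < N ∧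
    ∀ (a : V d → Matrix (Fin d) (Fin d) ℝ) (b : V d → E d) (c : V d → ℝ)
      (u ut : V d → ℝ) (du : V d → E d) (d2u : V d → Matrix (Fin d) (Fin d) ℝ),
      Coef δ K a b c → Reg u ut du d2u → ∀ F : ℝ, 0 ≤ F →
      ∫⁻ z in Cy d, ENNReal.ofReal |Lop a b c u ut du d2u z| ^ (d + 1) ≤ ENNReal.ofReal F ^ (d + 1) →
      ∀ M0 : ℝ, 0 ≤ M0 → (∀ z ∈ Cb d, ‖z.2‖ = 1 → |u z| ≤ M0) →
      (∀ z ∈ Cb d, z.1 = 1 → |u z| ≤ M0) →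
      ∫⁻ z in Cy d, ENNReal.ofReal ‖du z‖ ^ γ ≤ ENNReal.ofReal (N * F ^ γ + N * M0 ^ γ) := by
  obtain ⟨N1, hN1, habp⟩ := abp d hδ0 hδ1 hK
  obtain ⟨γ, N0, hγ0, hγ1, hN0, hnorm⟩ := normalized d hδ0 hδ1 hK
  have hN1' : 0 < N1 := by linarith
  refine ⟨γ, N0 * N1 ^ γ, hγ0, hγ1, by positivity, ?_⟩
  intro a b c u ut du d2u hco h F hF0 hF M0 hM0 hlat htop
  have hu := habp a b c u ut du d2u hco h F hF0 hF M0 hM0 hlat htop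
  have main : ∀ ε : ℝ, 0 < ε → ∫⁻ z in Cy d, ENNReal.ofReal ‖du z‖ ^ γ ≤
      ENNReal.ofReal (N0 * (N1 * (F + M0 + ε)) ^ γ) := by
    intro ε hε
    set s := N1 * (F + M0 + ε) with hs
    have hs0 : 0 < s := by positivity
    have hFs : F ≤ s := by nlinarith
    have hk0 : 0 ≤ s⁻¹ := by positivity
    have h1 := hnorm a b c _ _ _ _ hco (h.neg s⁻¹) ?_ ?_
    · have e : ∀ z : V d, ENNReal.ofReal ‖du z‖ ^ γ = ENNReal.ofReal (s ^ γ) * ENNReal.ofReal ‖s⁻¹ • du z‖ ^ γ := by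
        intro z
        rw [← ENNReal.ofReal_rpow_of_nonneg hs0.le hγ0.le, ← ENNReal.mul_rpow_of_nonneg _ _ hγ0.le,
          ← ENNReal.ofReal_mul hs0.le, norm_smul, Real.norm_of_nonneg hk0, mul_inv_cancel_left₀ hs0.ne']
      calc ∫⁻ z in Cy d, ENNReal.ofReal ‖du z‖ ^ γ
          = ∫⁻ z in Cy d, ENNReal.ofReal (s ^ γ) * ENNReal.ofReal ‖s⁻¹ • du z‖ ^ γ := by
            simp only [← e]
        _ = ENNReal.ofReal (s ^ γ) * ∫⁻ z in Cy d, ENNReal.ofReal ‖s⁻¹ • du z‖ ^ γ :=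
            lintegral_const_mul' _ _ ENNReal.ofReal_ne_top
        _ ≤ ENNReal.ofReal (s ^ γ) * ENNReal.ofReal N0 := mul_le_mul_right h1 _
        _ = _ := by rw [← ENNReal.ofReal_mul (by positivity), mul_comm]
    · simp only [Lop_smul, abs_mul, abs_of_nonneg hk0, ENNReal.ofReal_mul hk0, mul_pow]
      rw [lintegral_const_mul' _ _ (ENNReal.pow_ne_top ENNReal.ofReal_ne_top)]
      refine (mul_le_mul_right hF _).trans ?_
      rw [← mul_pow, ← ENNReal.ofReal_mul hk0]
      refine pow_le_one₀ zero_le ?_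
      rw [ENNReal.ofReal_le_one, inv_mul_le_iff₀ hs0]
      linarith
    · intro z hz
      rw [abs_mul, abs_of_nonneg hk0, inv_mul_le_iff₀ hs0]
      have := hu z hz
      nlinarith
  have hcont : Continuous fun ε : ℝ => ENNReal.ofReal (N0 * (N1 * (F + M0 + ε)) ^ γ) := by
    refine ENNReal.continuous_ofReal.comp (continuous_const.mul ?_)
    exact (Real.continuous_rpow_const hγ0.le).comp (by fun_prop)
  have hlim := (hcont.tendsto 0).mono_left (nhdsWithin_le_nhds (s := Set.Ioi 0))
  have h0 := ge_of_tendsto hlim (eventually_nhdsWithin_of_forall fun ε hε => main ε hε)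
  refine h0.trans (ENNReal.ofReal_le_ofReal ?_)
  rw [add_zero, Real.mul_rpow hN1'.le (by positivity), ← mul_assoc, ← mul_add]
  exact mul_le_mul_of_nonneg_left (Real.rpow_add_le_add_rpow hF0 hM0 hγ0.le hγ1) (by positivity)

/-! ## Translation of the hypotheses -/

lemma memLp_of_dom {G : Set (V d)} {g : V d → ℝ} {H : V d → ℝ} (hg : Measurable g)
    (hi : IntegrableOn H G volume) (hle : ∀ z, |g z| ^ ((d : ℝ) + 1) ≤ H z) :
    MemLp g (pp d) (volume.restrict G) := by
  have hp : (0 : ℝ) < (d : ℝ) + 1 := by positivity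
  have hintg : Integrable (fun z => ‖g z‖ ^ (pp d).toReal) (volume.restrict G) := by
    have e : (pp d).toReal = (d : ℝ) + 1 := ENNReal.toReal_ofReal hp.le
    rw [e]
    refine hi.mono' ((hg.norm.pow_const _).aestronglyMeasurable) (Eventually.of_forall fun z => ?_)
    rw [Real.norm_of_nonneg (by positivity), Real.norm_eq_abs]
    exact hle z
  refine (integrable_norm_rpow_iff hg.aestronglyMeasurable ?_ ?_).1 hintg
  · simp [pp, hp]
  · simp [pp]

lemma abs_le_frob (m : Matrix (Fin d) (Fin d) ℝ) (i j : Fin d) : |m i j| ≤ frobNorm m := by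
  unfold frobNorm
  refine Real.abs_le_sqrt ?_
  refine le_trans ?_ (Finset.single_le_sum (f := fun i => ∑ j, (m i j) ^ 2)
    (fun i _ => Finset.sum_nonneg fun j _ => sq_nonneg _) (Finset.mem_univ i))
  exact Finset.single_le_sum (f := fun j => (m i j) ^ 2) (fun j _ => sq_nonneg _) (Finset.mem_univ j)

lemma closure_Cy : closure (Cy d) = Cb d := by
  rw [Cy, closure_prod_eq, closure_Ioo (by norm_num), closure_ball _ (by norm_num), Cb]

lemma Reg_of {u ut : V d → ℝ} {du : V d → E d} {d2u : V d → Matrix (Fin d) (Fin d) ℝ}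
    (h1 : Measurable u) (h2 : Measurable ut) (h3 : ∀ i, Measurable fun z => du z i)
    (h4 : ∀ i j, Measurable fun z => d2u z i j) (h5 : ContinuousOn u (closure (Cy d)))
    (h6 : ∀ z ∈ Cy d, HasDerivAt (fun s => u (s, z.2)) (ut z) z.1)
    (h7 : ∀ z ∈ Cy d, ∀ i,
      HasDerivAt (fun s : ℝ => u (z.1, z.2 + s • EuclideanSpace.single i (1 : ℝ))) (du z i) 0)
    (h8 : ∀ z ∈ Cy d, ∀ i j,
      HasDerivAt (fun s : ℝ => du (z.1, z.2 + s • EuclideanSpace.single j (1 : ℝ)) i) (d2u z i j) 0)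
    (h9 : ∀ G : Set (V d), IsCompact G → G ⊆ Cy d →
      IntegrableOn (fun z => |ut z| ^ ((d : ℝ) + 1) + ‖du z‖ ^ ((d : ℝ) + 1) +
            frobNorm (d2u z) ^ ((d : ℝ) + 1)) G volume) : Reg u ut du d2u where
  m0 := h1
  mt := h2
  mx := h3
  mxx := h4
  cont := closure_Cy (d := d) ▸ h5
  ht := fun z hz => by
    have e := h6 z hz
    unfold HasLineDerivAt
    have e2 : HasDerivAt (fun t : ℝ => z.1 + t) 1 0 := (hasDerivAt_id' (0 : ℝ)).const_add _
    have e3 : HasDerivAt (fun s => u (s, z.2)) (ut z) (z.1 + 0) := by rw [add_zero]; exact e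
    have e4 := HasDerivAt.comp (0 : ℝ) e3 e2
    rw [mul_one] at e4
    refine e4.congr_of_eventuallyEq (Eventually.of_forall fun t => ?_)
    simp only [Function.comp_def]
    congr 1
    refine Prod.ext ?_ ?_ <;> simp
  hx := fun z hz i => by
    unfold HasLineDerivAt
    refine (h7 z hz i).congr_of_eventuallyEq (Eventually.of_forall fun t => ?_)
    simp only
    congr 1
    refine Prod.ext ?_ ?_ <;> simp [bs]
  hxx := fun z hz i j => by
    unfold HasLineDerivAt
    refine (h8 z hz i j).congr_of_eventuallyEq (Eventually.of_forall fun t => ?_)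
    simp only
    have : z + t • ((0 : ℝ), (bs j : E d)) = (z.1, z.2 + t • EuclideanSpace.single j (1 : ℝ)) := by
      refine Prod.ext ?_ ?_ <;> simp [bs]
    rw [this]
  it := fun G hG hGs => memLp_of_dom h2 (h9 G hG hGs) fun z => by
    have a1 : 0 ≤ ‖du z‖ ^ ((d : ℝ) + 1) := by positivity
    have a2 : 0 ≤ frobNorm (d2u z) ^ ((d : ℝ) + 1) := Real.rpow_nonneg (Real.sqrt_nonneg _) _
    linarith
  ix := fun G hG hGs i => memLp_of_dom (h3 i) (h9 G hG hGs) fun z => by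
    have a1 : 0 ≤ |ut z| ^ ((d : ℝ) + 1) := by positivity
    have a2 : 0 ≤ frobNorm (d2u z) ^ ((d : ℝ) + 1) := Real.rpow_nonneg (Real.sqrt_nonneg _) _
    have a3 : |du z i| ^ ((d : ℝ) + 1) ≤ ‖du z‖ ^ ((d : ℝ) + 1) := by
      refine Real.rpow_le_rpow (abs_nonneg _) ?_ (by positivity)
      exact PiLp.norm_apply_le (du z) i
    linarith
  ixx := fun G hG hGs i j => memLp_of_dom (h4 i j) (h9 G hG hGs) fun z => by
    have a1 : 0 ≤ |ut z| ^ ((d : ℝ) + 1) := by positivity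
    have a2 : 0 ≤ ‖du z‖ ^ ((d : ℝ) + 1) := by positivity
    have a3 : |d2u z i j| ^ ((d : ℝ) + 1) ≤ frobNorm (d2u z) ^ ((d : ℝ) + 1) :=
      Real.rpow_le_rpow (abs_nonneg _) (abs_le_frob _ i j) (by positivity)
    linarith

lemma le_bsup {u : V d → ℝ} (hc : ContinuousOn u (Cb d)) {S : Set (V d)} (hS : S ⊆ Cb d) :
    0 ≤ (⨆ z ∈ S, |u z|) ∧ ∀ z ∈ S, |u z| ≤ ⨆ z ∈ S, |u z| := by
  refine ⟨Real.iSup_nonneg fun z => Real.iSup_nonneg fun _ => abs_nonneg _, fun z hz => ?_⟩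
  obtain ⟨B, hB⟩ := isCompact_Cb.exists_bound_of_continuousOn hc
  have hbdd : BddAbove (Set.range fun z => ⨆ (_ : z ∈ S), |u z|) := by
    refine ⟨max B 0, ?_⟩
    rintro _ ⟨w, rfl⟩
    refine Real.iSup_le (fun hw => (hB w (hS hw)).trans (le_max_left _ _)) (le_max_right _ _)
  have h1 := le_ciSup hbdd z
  simp only [hz, ciSup_unique] at h1
  exact h1

end PGE

/-- **Theorem 2.3.** Let `u ∈ C(C̄₁) ∩ W^{1,2}_{d+1,loc}(C₁)`, `C₁ = (0,1) × B₁`.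
Then there are constants `γ ∈ (0,1]` and `N`, depending only on `δ`, `K`, `d`,
such that for any `L ∈ 𝔏_{δ,K}` one has
`∫_{C₁} |Du|^γ ≤ N (∫_{C₁} |Lu|^{d+1})^{γ/(d+1)} + N sup_{∂'C₁} |u|^γ`,
where `∂'C₁ = ([0,1] × ∂B₁) ∪ ({1} × B₁)`. -/
theorem parabolic_gradient_estimate_C1
    (d : ℕ) (hd : 1 ≤ d) (δ K : ℝ) (hδ0 : 0 < δ) (hδ1 : δ < 1) (hK : 0 ≤ K) :
    ∃ γ N : ℝ, γ ∈ Set.Ioc (0 : ℝ) 1 ∧ 0 < N ∧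
      ∀ (a : ℝ × EuclideanSpace ℝ (Fin d) → Matrix (Fin d) (Fin d) ℝ)
        (b : ℝ × EuclideanSpace ℝ (Fin d) → EuclideanSpace ℝ (Fin d))
        (c : ℝ × EuclideanSpace ℝ (Fin d) → ℝ)
        (u ut : ℝ × EuclideanSpace ℝ (Fin d) → ℝ)
        (du : ℝ × EuclideanSpace ℝ (Fin d) → EuclideanSpace ℝ (Fin d))
        (d2u : ℝ × EuclideanSpace ℝ (Fin d) → Matrix (Fin d) (Fin d) ℝ),
        -- measurability of the coefficients of `L`
        (∀ i j, Measurable fun z => a z i j) →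
        (∀ i, Measurable fun z => b z i) →
        Measurable c →
        -- `a` is `S_δ`-valued
        (∀ z, (a z).IsSymm) →
        (∀ z (ξ : EuclideanSpace ℝ (Fin d)),
          δ * ‖ξ‖ ^ 2 ≤ ∑ i, ∑ j, a z i j * ξ i * ξ j ∧
          ∑ i, ∑ j, a z i j * ξ i * ξ j ≤ δ⁻¹ * ‖ξ‖ ^ 2) →
        -- `|b| + c ≤ K`, `c ≥ 0`
        (∀ z, ‖b z‖ + c z ≤ K) →
        (∀ z, 0 ≤ c z) →
        -- measurability of `u` and its derivatives
        Measurable u → Measurable ut →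
        (∀ i, Measurable fun z => du z i) →
        (∀ i j, Measurable fun z => d2u z i j) →
        -- `u ∈ C(C̄_{2,1})`
        ContinuousOn u (closure (Set.Ioo (0 : ℝ) 1 ×ˢ Metric.ball (0 : EuclideanSpace ℝ (Fin d)) 1)) →
        -- `ut = ∂ₜu`, `du = Du`, `d2u = D²u` pointwise in `C_{2,1}`
        (∀ z ∈ Set.Ioo (0 : ℝ) 1 ×ˢ Metric.ball (0 : EuclideanSpace ℝ (Fin d)) 1,
          HasDerivAt (fun s => u (s, z.2)) (ut z) z.1) →
        (∀ z ∈ Set.Ioo (0 : ℝ) 1 ×ˢ Metric.ball (0 : EuclideanSpace ℝ (Fin d)) 1, ∀ i,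
          HasDerivAt (fun s : ℝ => u (z.1, z.2 + s • EuclideanSpace.single i (1 : ℝ))) (du z i) 0) →
        (∀ z ∈ Set.Ioo (0 : ℝ) 1 ×ˢ Metric.ball (0 : EuclideanSpace ℝ (Fin d)) 1, ∀ i j,
          HasDerivAt (fun s : ℝ => du (z.1, z.2 + s • EuclideanSpace.single j (1 : ℝ)) i)
            (d2u z i j) 0) →
        -- local `L_{d+1}` integrability of the derivatives (`u ∈ W^{1,2}_{d+1,loc}`)
        (∀ G : Set (ℝ × EuclideanSpace ℝ (Fin d)), IsCompact G →
          G ⊆ Set.Ioo (0 : ℝ) 1 ×ˢ Metric.ball (0 : EuclideanSpace ℝ (Fin d)) 1 →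
          IntegrableOn (fun z => |ut z| ^ ((d : ℝ) + 1) + ‖du z‖ ^ ((d : ℝ) + 1) +
            frobNorm (d2u z) ^ ((d : ℝ) + 1)) G volume) →
        (∫⁻ z in Set.Ioo (0 : ℝ) 1 ×ˢ Metric.ball (0 : EuclideanSpace ℝ (Fin d)) 1,
            ENNReal.ofReal (‖du z‖) ^ γ ∂volume)
          ≤ ENNReal.ofReal N *
              (∫⁻ z in Set.Ioo (0 : ℝ) 1 ×ˢ Metric.ball (0 : EuclideanSpace ℝ (Fin d)) 1,
                ENNReal.ofReal
                  |ut z + (∑ i, ∑ j, a z i j * d2u z i j) + (∑ i, b z i * du z i) - c z * u z|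
                  ^ ((d : ℝ) + 1) ∂volume) ^ (γ / ((d : ℝ) + 1))
            + ENNReal.ofReal N *
              ENNReal.ofReal
                ((⨆ z ∈ (Set.Icc (0 : ℝ) 1 ×ˢ Metric.sphere (0 : EuclideanSpace ℝ (Fin d)) 1 ∪
                    {(1 : ℝ)} ×ˢ Metric.ball (0 : EuclideanSpace ℝ (Fin d)) 1), |u z|) ^ γ) := by
  have hp : (0 : ℝ) < (d : ℝ) + 1 := by positivity
  obtain ⟨γ, N, hγ0, hγ1, hN, H⟩ := PGE.scaled d hδ0 hδ1 hK
  refine ⟨γ, N, ⟨hγ0, hγ1⟩, hN, ?_⟩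
  intro a b c u ut du d2u ham hbm hcm has hae hbc hc0 h1 h2 h3 h4 h5 h6 h7 h8 h9
  have hreg : PGE.Reg u ut du d2u := PGE.Reg_of h1 h2 h3 h4 h5 h6 h7 h8 h9
  have hco : PGE.Coef δ K a b c := ⟨hae, has, ham, hbm, hcm, hbc, hc0⟩
  set S := (Set.Icc (0 : ℝ) 1 ×ˢ Metric.sphere (0 : EuclideanSpace ℝ (Fin d)) 1 ∪
                    {(1 : ℝ)} ×ˢ Metric.ball (0 : EuclideanSpace ℝ (Fin d)) 1) with hS
  have hSC : S ⊆ PGE.Cb d := by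
    rintro z (hz | hz)
    · rw [PGE.mem_Cb]
      have e := mem_sphere_zero_iff_norm.1 hz.2
      exact ⟨hz.1, e.le⟩
    · rw [PGE.mem_Cb]
      have e := mem_ball_zero_iff.1 hz.2
      have e1 : z.1 = 1 := hz.1
      exact ⟨⟨by rw [e1]; norm_num, e1.le⟩, e.le⟩
  obtain ⟨hM0, hM⟩ := PGE.le_bsup hreg.cont hSC
  set M0 := ⨆ z ∈ S, |u z| with hM0def
  have hlop : ∀ z, ut z + (∑ i, ∑ j, a z i j * d2u z i j) + (∑ i, b z i * du z i) - c z * u z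
      = PGE.Lop a b c u ut du d2u z := by
    intro z
    rw [PGE.Lop, PGE.inner_eq]; rfl
  simp only [hlop]
  set I := ∫⁻ z in Set.Ioo (0 : ℝ) 1 ×ˢ Metric.ball (0 : EuclideanSpace ℝ (Fin d)) 1,
                ENNReal.ofReal |PGE.Lop a b c u ut du d2u z| ^ ((d : ℝ) + 1) with hI
  by_cases hIt : I = ⊤
  · rw [hIt, ENNReal.top_rpow_of_pos (by positivity), ENNReal.mul_top (by simpa using hN), top_add]
    exact le_top
  set F := (I ^ (1 / ((d : ℝ) + 1))).toReal with hF
  have hFt : I ^ (1 / ((d : ℝ) + 1)) ≠ ⊤ := ENNReal.rpow_ne_top_of_nonneg (by positivity) hIt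
  have hFI : ENNReal.ofReal F = I ^ (1 / ((d : ℝ) + 1)) := ENNReal.ofReal_toReal hFt
  have hpow : ∀ x : ℝ≥0∞, x ^ ((d : ℝ) + 1) = x ^ (d + 1) := fun x => by
    rw [← ENNReal.rpow_natCast]; push_cast; rfl
  have hFF : ∫⁻ z in PGE.Cy d, ENNReal.ofReal |PGE.Lop a b c u ut du d2u z| ^ (d + 1) ≤
      ENNReal.ofReal F ^ (d + 1) := by
    rw [← hpow, hFI, ← ENNReal.rpow_mul, one_div_mul_cancel hp.ne', ENNReal.rpow_one, hI]
    simp only [hpow]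
    exact le_rfl
  have hlat : ∀ z ∈ PGE.Cb d, ‖z.2‖ = 1 → |u z| ≤ M0 := fun z hz hz1 =>
    hM z (Or.inl ⟨(PGE.mem_Cb.1 hz).1, mem_sphere_zero_iff_norm.2 hz1⟩)
  have htop : ∀ z ∈ PGE.Cb d, z.1 = 1 → |u z| ≤ M0 := fun z hz hz1 => by
    rcases (PGE.mem_Cb.1 hz).2.lt_or_eq with h | h
    · exact hM z (Or.inr ⟨hz1, mem_ball_zero_iff.2 h⟩)
    · exact hlat z hz h
  have key := H a b c u ut du d2u hco hreg F ENNReal.toReal_nonneg hFF M0 hM0 hlat htop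
  have hF0 : 0 ≤ F := ENNReal.toReal_nonneg
  have e : ENNReal.ofReal (F ^ γ) = I ^ (γ / ((d : ℝ) + 1)) := by
    rw [← ENNReal.ofReal_rpow_of_nonneg hF0 hγ0.le, hFI, ← ENNReal.rpow_mul]
    congr 1; ring
  rw [← e, ← ENNReal.ofReal_mul hN.le, ← ENNReal.ofReal_mul hN.le, ← ENNReal.ofReal_add (by positivity) (by positivity)]
  exact key
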